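/- arXiv:1203.5624 — 3 statements merged into one kernel-verified Lean document; each statement's English description precedes it below -/
import Mathlib

section
/- For every C ≥ 1 and K ≥ 0 there exists δ > 1 with the following property: if (X_n) is a sequence of finite connected graphs, each of which is (C,K)-roughly transitive, with |X_n| → ∞ and |X_n| ≤ A · diam(X_n)^δ for all n for some constant A > 0, then the rescaled spaces X'_n converge in Gromov–Hausdorff distance to the circle ℝ/2ℤ equipped with its quotient metric (the circle of circumference 2). -/
open Filter

/-- `f` is a `(C,K)`-quasi-isometry between the spaces with distance functions
`dX` and `dY`. -/
def IsQuasiIsometry {X Y : Type*} (C K : ℝ) (dX : X → X → ℝ) (dY : Y → Y → ℝ)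
    (f : X → Y) : Prop :=
  (∀ x y : X, C⁻¹ * dX x y - K ≤ dY (f x) (f y) ∧ dY (f x) (f y) ≤ C * dX x y + K) ∧
    ∀ y : Y, ∃ x : X, dY (f x) y ≤ K

/-- A space with distance function `dX` is `(C,K)`-roughly transitive if any point
can be sent to any other point by a `(C,K)`-quasi-isometry of the space. -/
def RoughlyTransitive {X : Type*} (C K : ℝ) (dX : X → X → ℝ) : Prop :=
  ∀ x y : X, ∃ f : X → X, IsQuasiIsometry C K dX dX f ∧ f x = y

/-- Gromov–Hausdorff convergence of a sequence of spaces (given by their distance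
functions `dV n`) to a target space with distance function `dY`, expressed via
ε-isometries. -/
def GHConvergesTo (V : ℕ → Type*) (dV : ∀ n, V n → V n → ℝ)
    {Y : Type*} (dY : Y → Y → ℝ) : Prop :=
  ∀ ε : ℝ, 0 < ε → ∃ N₀ : ℕ, ∀ n, N₀ ≤ n → ∃ f : V n → Y,
    (∀ y : Y, ∃ v : V n, dY (f v) y < ε) ∧
    (∀ u v : V n, |dY (f u) (f v) - dV n u v| < ε)

/-- `γ` is a geodesic of length `L`. -/
def Geo {V : Type*} (G : SimpleGraph V) (γ : ℕ → V) (L : ℕ) : Prop :=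
  ∀ i j, i ≤ j → j ≤ L → G.dist (γ i) (γ j) + i = j

lemma exists_geo {V : Type*} {G : SimpleGraph V} (hG : G.Connected) (x y : V) :
    ∃ γ : ℕ → V, γ 0 = x ∧ γ (G.dist x y) = y ∧ Geo G γ (G.dist x y) := by
  obtain ⟨p, hp⟩ := hG.exists_walk_length_eq_dist x y
  have hstep : ∀ i, G.dist (p.getVert i) (p.getVert (i+1)) ≤ 1 := by
    intro i
    by_cases hi : i < p.length
    · exact (SimpleGraph.dist_eq_one_iff_adj.2 (p.adj_getVert_succ hi)).le
    · rw [p.getVert_of_length_le (by omega), p.getVert_of_length_le (by omega)]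
      simp
  have hup : ∀ i k, G.dist (p.getVert i) (p.getVert (i+k)) ≤ k := by
    intro i k
    induction k with
    | zero => simp
    | succ k ih =>
      have := hG.dist_triangle (u := p.getVert i) (v := p.getVert (i+k)) (w := p.getVert (i+(k+1)))
      have h2 := hstep (i+k)
      rw [← add_assoc] at *
      omega
  have h0 : p.getVert 0 = x := p.getVert_zero
  have h1 : p.getVert (G.dist x y) = y := by rw [← hp]; exact p.getVert_length
  refine ⟨p.getVert, h0, h1, ?_⟩
  intro i j hij hj
  obtain ⟨a, rfl⟩ := Nat.exists_eq_add_of_le hij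
  obtain ⟨b, hb⟩ := Nat.exists_eq_add_of_le hj
  have e1 := hup 0 i
  have e2 := hup i a
  have e3 := hup (i+a) b
  rw [← hb, h1] at e3
  rw [h0, zero_add] at e1
  have t1 := hG.dist_triangle (u := x) (v := p.getVert i) (w := y)
  have t2 := hG.dist_triangle (u := p.getVert i) (v := p.getVert (i+a)) (w := y)
  omega

/-- Lens-like neighbourhood of a geodesic. -/
noncomputable def lens {V : Type*} [Fintype V] (G : SimpleGraph V) (γ : ℕ → V) (L : ℕ) :
    Finset V :=
  open Classical in
  Finset.univ.filter
    (fun v => ∃ t, t ≤ L ∧ 2 * G.dist v (γ t) < t ∧ 2 * G.dist v (γ t) + t < L)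

lemma mem_lens {V : Type*} [Fintype V] (G : SimpleGraph V) (γ : ℕ → V) (L : ℕ) (v : V) :
    v ∈ lens G γ L ↔ ∃ t, t ≤ L ∧ 2 * G.dist v (γ t) < t ∧ 2 * G.dist v (γ t) + t < L := by
  classical
  simp [lens]

/-- The tripod condition at scale `m`. -/
def Tripod {V : Type*} (G : SimpleGraph V) (N m : ℕ) : Prop :=
  ∀ γ, Geo G γ (40 * N * m) → ∃ p, G.dist p (γ (20 * N * m)) ≤ 2 * N * m ∧
    ∀ t, t ≤ 40 * N * m → 2 * m ≤ G.dist p (γ t)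

lemma growth_step {V : Type*} [Fintype V] {G : SimpleGraph V} (hG : G.Connected) (N m c : ℕ)
    (hN : 1 ≤ N) (hm : 1 ≤ m) (hT : Tripod G N m)
    (hc : ∀ γ, Geo G γ m → c ≤ (lens G γ m).card) (γ : ℕ → V) (hγ : Geo G γ (40 * N * m)) :
    (40 * N + 1) * c ≤ (lens G γ (40 * N * m)).card := by
  classical
  obtain ⟨p, hp, hp2⟩ := hT γ hγ
  set ℓ := 40 * N * m with hℓ
  have hNm : m ≤ N * m := Nat.le_mul_of_pos_left m hN
  have eℓ : ℓ = 40 * (N * m) := by rw [hℓ]; ring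
  have e2 : 20 * N * m = 20 * (N * m) := by ring
  have e3 : 2 * N * m = 2 * (N * m) := by ring
  rw [e2, e3] at hp
  generalize N * m = Q at *
  -- nearest point
  obtain ⟨t0, ht0, hmin⟩ := Finset.exists_min_image (Finset.range (ℓ + 1))
    (fun t => G.dist p (γ t)) ⟨0, by simp⟩
  have ht0' : t0 ≤ ℓ := by simpa [Nat.lt_succ_iff] using ht0
  have hmin' : ∀ t, t ≤ ℓ → G.dist p (γ t0) ≤ G.dist p (γ t) := fun t ht =>
    hmin t (by simp; omega)
  obtain ⟨τ, hτ0, hτ1, hτ⟩ := exists_geo hG (γ t0) p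
  have hh : 2 * m ≤ G.dist (γ t0) p := by rw [G.dist_comm]; exact hp2 t0 ht0'
  set h := G.dist (γ t0) p with hhdef
  have hph : G.dist p (γ t0) = h := by rw [G.dist_comm]
  let Γ : ℕ → ℕ → V := fun i s => if i < 40 * N then γ (i * m + s) else τ (m + s)
  have hle : ∀ i, i < 40 * N → i * m + m ≤ ℓ := by
    intro i hi
    calc i * m + m = (i+1) * m := by ring
      _ ≤ (40 * N) * m := Nat.mul_le_mul_right m hi
  have hΓgeo : ∀ i, Geo G (Γ i) m := by
    intro i a b hab hb
    by_cases hi : i < 40 * N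
    · simp only [Γ, hi, if_true]
      have := hγ (i*m+a) (i*m+b) (by omega) (by have := hle i hi; omega)
      omega
    · simp only [Γ, hi, if_false]
      have := hτ (m+a) (m+b) (by omega) (by omega)
      omega
  have hsub : ∀ i, lens G (Γ i) m ⊆ lens G γ ℓ := by
    intro i v hv
    rw [mem_lens] at hv ⊢
    obtain ⟨t, ht, h1, h2⟩ := hv
    by_cases hi : i < 40 * N
    · simp only [Γ, hi, if_true] at h1 h2
      have := hle i hi
      exact ⟨i*m+t, by omega, by omega, by omega⟩
    · simp only [Γ, hi, if_false] at h1 h2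
      refine ⟨t0, ht0', ?_⟩
      have a1 := hτ 0 (m+t) (by omega) (by omega)
      rw [hτ0] at a1
      have a2 := hG.dist_triangle (u := v) (v := τ (m+t)) (w := γ t0)
      rw [G.dist_comm (u := τ (m+t))] at a2
      have a3 := hmin' (20 * Q) (by omega)
      have a4 := hG.dist_triangle (u := γ t0) (v := p) (w := γ (20 * Q))
      rcases le_total t0 (20 * Q) with hc | hc
      · have := hγ t0 (20*Q) hc (by omega)
        omega
      · have := hγ (20*Q) t0 hc (by omega)
        rw [G.dist_comm] at this
        omega
  have hdisj1 : ∀ i j, i < j → j < 40 * N → Disjoint (lens G (Γ i) m) (lens G (Γ j) m) := by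
    intro i j hij hj
    rw [Finset.disjoint_left]
    intro v hv hv'
    rw [mem_lens] at hv hv'
    obtain ⟨t, ht, h1, h2⟩ := hv
    obtain ⟨t', ht', h1', h2'⟩ := hv'
    have hi : i < 40 * N := by omega
    simp only [Γ, hi, hj, if_true] at h1 h2 h1' h2'
    have : i * m + m ≤ j * m := by
      calc i * m + m = (i+1) * m := by ring
        _ ≤ j * m := Nat.mul_le_mul_right m hij
    have hj' := hle j hj
    have g := hγ (i*m+t) (j*m+t') (by omega) (by omega)
    have a2 := hG.dist_triangle (u := γ (i*m+t)) (v := v) (w := γ (j*m+t'))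
    rw [G.dist_comm (v := v)] at a2
    omega
  have hdisj2 : ∀ i j, i < 40 * N → ¬ j < 40 * N → Disjoint (lens G (Γ i) m) (lens G (Γ j) m) := by
    intro i j hi hj
    rw [Finset.disjoint_left]
    intro v hv hv'
    rw [mem_lens] at hv hv'
    obtain ⟨t, ht, h1, h2⟩ := hv
    obtain ⟨t', ht', h1', h2'⟩ := hv'
    simp only [Γ, hi, hj, if_true, if_false] at h1 h2 h1' h2'
    have hj' := hle i hi
    have a2 := hG.dist_triangle (u := τ (m+t')) (v := v) (w := γ (i*m+t))
    rw [G.dist_comm (v := v)] at a2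
    have a3 := hmin' (i*m+t) (by omega)
    have a4 := hG.dist_triangle (u := p) (v := τ (m+t')) (w := γ (i*m+t))
    have a5 := hτ (m+t') h (by omega) le_rfl
    rw [hτ1, G.dist_comm] at a5
    omega
  have hpd : ((Finset.range (40 * N + 1) : Finset ℕ) : Set ℕ).PairwiseDisjoint
      (fun i => lens G (Γ i) m) := by
    intro i hi j hj hij
    simp only [Finset.coe_range, Set.mem_Iio] at hi hj
    simp only [Function.onFun]
    rcases lt_or_gt_of_ne hij with hlt | hlt
    · by_cases hj' : j < 40 * N
      · exact hdisj1 i j hlt hj'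
      · exact hdisj2 i j (by omega) hj'
    · by_cases hj' : i < 40 * N
      · exact (hdisj1 j i hlt hj').symm
      · exact (hdisj2 j i (by omega) hj').symm
  calc (40 * N + 1) * c = ∑ i ∈ Finset.range (40 * N + 1), c := by simp
    _ ≤ ∑ i ∈ Finset.range (40 * N + 1), (lens G (Γ i) m).card :=
        Finset.sum_le_sum (fun i _ => hc _ (hΓgeo i))
    _ = ((Finset.range (40 * N + 1)).biUnion (fun i => lens G (Γ i) m)).card :=
        (Finset.card_biUnion hpd).symm
    _ ≤ (lens G γ ℓ).card := Finset.card_le_card (Finset.biUnion_subset.2 (fun i _ => hsub i))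

lemma growth {V : Type*} [Fintype V] {G : SimpleGraph V} (hG : G.Connected) (N l k : ℕ)
    (hN : 1 ≤ N) (hl : 3 ≤ l) (hT : ∀ j, j < k → Tripod G N ((40 * N) ^ j * l))
    (γ : ℕ → V) (hγ : Geo G γ ((40 * N) ^ k * l)) :
    (40 * N + 1) ^ k ≤ (lens G γ ((40 * N) ^ k * l)).card := by
  induction k generalizing γ with
  | zero =>
    simp only [pow_zero, one_mul]
    refine Finset.card_pos.2 ⟨γ 1, ?_⟩
    rw [mem_lens]
    exact ⟨1, by omega, by simp, by simp; omega⟩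
  | succ k ih =>
    have e : (40 * N) ^ (k+1) * l = 40 * N * ((40 * N) ^ k * l) := by ring
    rw [e] at hγ ⊢
    rw [pow_succ, mul_comm]
    exact growth_step hG N _ _ hN (Nat.mul_pos (by positivity) (by omega)) (hT k (by omega))
      (fun γ' h' => ih (fun j hj => hT j (by omega)) γ' h') γ hγ

/-- Rough transitivity with natural constants. -/
def NRT {V : Type*} (G : SimpleGraph V) (C K : ℕ) : Prop :=
  ∀ x y : V, ∃ f : V → V, f x = y ∧ (∀ a b, G.dist (f a) (f b) ≤ C * G.dist a b + K) ∧
    (∀ a b, G.dist a b ≤ C * (G.dist (f a) (f b) + K)) ∧ ∀ v, ∃ a, G.dist (f a) v ≤ K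

/-- `g` is a quasi-line through `y`, parametrised by `[-T,T]`, covering the `ρ`-ball about `y`
up to `w`. -/
structure QLine {V : Type*} (G : SimpleGraph V) (C K T w ρ : ℕ) (y : V) (g : ℤ → V) : Prop where
  base : g 0 = y
  up : ∀ i j : ℤ, -T ≤ i → i ≤ j → j ≤ T → (G.dist (g i) (g j) : ℤ) ≤ C * (j - i) + K
  lo : ∀ i j : ℤ, -T ≤ i → i ≤ j → j ≤ T → j - i ≤ C * (G.dist (g i) (g j) + K)
  cov : ∀ v, G.dist y v ≤ ρ → ∃ t : ℤ, -T ≤ t ∧ t ≤ T ∧ G.dist v (g t) ≤ w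

lemma QLine.refl {V : Type*} {G : SimpleGraph V} {C K T w ρ : ℕ} {y : V} {g : ℤ → V}
    (h : QLine G C K T w ρ y g) : QLine G C K T w ρ y (fun i => g (-i)) where
  base := by simpa using h.base
  up i j hi hij hj := by
    have := h.up (-j) (-i) (by omega) (by omega) (by omega)
    rw [G.dist_comm] at this
    convert this using 3; ring
  lo i j hi hij hj := by
    have := h.lo (-j) (-i) (by omega) (by omega) (by omega)
    rw [G.dist_comm] at this
    convert this using 1; ring
  cov v hv := by
    obtain ⟨t, h1, h2, h3⟩ := h.cov v hv
    exact ⟨-t, by omega, by omega, by simpa using h3⟩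

lemma exists_qline {V : Type*} {G : SimpleGraph V} (hG : G.Connected) {C K N m ρ : ℕ}
    (hRT : NRT G C K) (hnT : ¬ Tripod G N m) (hρ : C * (ρ + 2 * K) ≤ 2 * N * m) (y : V) :
    ∃ g, QLine G C K (20 * N * m) (2 * C * m + 2 * K) ρ y g := by
  unfold Tripod at hnT
  push Not at hnT
  obtain ⟨γ, hγ, hcov⟩ := hnT
  obtain ⟨f, hf0, hf1, hf2, hf3⟩ := hRT (γ (20 * N * m)) y
  have e40 : 40 * N * m = 2 * (20 * N * m) := by ring
  simp only [e40] at hγ hcov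
  clear e40
  generalize 20 * N * m = T at *
  have key : ∀ i j : ℤ, -T ≤ i → i ≤ j → j ≤ T →
      (G.dist (γ (T + i).toNat) (γ (T + j).toNat) : ℤ) = j - i := by
    intro i j hi hij hj
    have := hγ (T + i).toNat (T + j).toNat (by omega) (by omega)
    omega
  refine ⟨fun i => f (γ (T + i).toNat), ⟨by simpa using hf0, ?_, ?_, ?_⟩⟩
  · intro i j hi hij hj
    rw [← key i j hi hij hj]
    exact_mod_cast hf1 _ _
  · intro i j hi hij hj
    rw [← key i j hi hij hj]
    exact_mod_cast hf2 _ _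
  · intro v hv
    obtain ⟨x, hx⟩ := hf3 v
    have h1 := hf2 x (γ T)
    rw [hf0] at h1
    have h2 := hG.dist_triangle (u := f x) (v := v) (w := y)
    rw [G.dist_comm (u := v)] at h2
    have h3 : G.dist x (γ T) ≤ 2 * N * m := by
      refine h1.trans (le_trans (Nat.mul_le_mul_left C ?_) hρ)
      omega
    obtain ⟨t, ht, ht2⟩ := hcov x h3
    refine ⟨(t : ℤ) - T, by omega, by omega, ?_⟩
    have e : ((T : ℤ) + ((t : ℤ) - T)).toNat = t := by omega
    simp only [e]
    have h4 := hf1 x (γ t)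
    have h5 := hG.dist_triangle (u := v) (v := f x) (w := f (γ t))
    rw [G.dist_comm (u := v) (v := f x)] at h5
    have h6 : C * G.dist x (γ t) ≤ C * (2 * m) := Nat.mul_le_mul_left C ht2.le
    have h7 : 2 * C * m = C * (2 * m) := by ring
    omega

lemma QLine.cross {V : Type*} {G : SimpleGraph V} (hG : G.Connected)
    {C K T w ρ : ℕ} {y : V} {g : ℤ → V}
    (h : QLine G C K T w ρ y g) {β : ℕ → V} {L : ℕ} (hβ : Geo G β L) (hL : L ≤ ρ) (h0 : β 0 = y)
    (a : ℕ) (ta t1 : ℤ) (hta : -T ≤ ta) (hta1 : ta ≤ t1) (hda : G.dist (β a) (g ta) ≤ w)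
    (b : ℕ) (hab : a ≤ b) (hb : b ≤ L) (tb : ℤ) (htb : tb ≤ T) (htb1 : t1 ≤ tb)
    (hdb : G.dist (β b) (g tb) ≤ w) :
    ∃ s, a ≤ s ∧ s ≤ b ∧ G.dist (β s) (g t1) ≤ w + (C * (C * (2 * w + 1 + K)) + K) := by
  have main : ∀ (c : ℕ) (x : V) (tc : ℤ), -T ≤ tc → tc ≤ t1 → G.dist x (g tc) ≤ w →
      ∀ z, G.dist x z ≤ 1 → ∀ td : ℤ, td ≤ T → t1 ≤ td → G.dist z (g td) ≤ w →
      G.dist z (g t1) ≤ w + (C * (C * (2 * w + 1 + K)) + K) := by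
    intro c x tc h1 h2 h3 z hxz td h4 h5 h6
    have q1 := h.lo tc td h1 (by omega) h4
    have q2 := h.up t1 td (by omega) h5 h4
    have r1 := hG.dist_triangle (u := g tc) (v := x) (w := g td)
    have r2 := hG.dist_triangle (u := x) (v := z) (w := g td)
    have r3 := hG.dist_triangle (u := z) (v := g td) (w := g t1)
    rw [G.dist_comm (u := g td)] at r3
    rw [G.dist_comm (u := g tc) (v := x)] at r1
    have r4 : G.dist (g tc) (g td) ≤ 2 * w + 1 := by omega
    have r5 : td - t1 ≤ C * (2 * w + 1 + K) := by
      have : (C : ℤ) * (G.dist (g tc) (g td) + K) ≤ C * (2 * w + 1 + K) := by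
        apply mul_le_mul_of_nonneg_left _ (by positivity)
        have : (G.dist (g tc) (g td) : ℤ) ≤ 2 * w + 1 := by exact_mod_cast r4
        omega
      omega
    have r6 : (C : ℤ) * (td - t1) ≤ C * (C * (2 * w + 1 + K)) :=
      mul_le_mul_of_nonneg_left r5 (by positivity)
    have r7 : G.dist (g t1) (g td) ≤ C * (C * (2 * w + 1 + K)) + K := by
      zify
      omega
    omega
  induction b, hab using Nat.le_induction generalizing tb with
  | base =>
    exact ⟨a, le_rfl, le_rfl, main 0 (β a) ta hta hta1 hda (β a) (by simp) tb htb htb1 hdb⟩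
  | succ b hab ih =>
    have hb0 := hβ 0 b (by omega) (by omega)
    rw [h0] at hb0
    obtain ⟨t, ht1, ht2, ht3⟩ := h.cov (β b) (by omega)
    rcases le_total t1 t with hc | hc
    · obtain ⟨s, hs1, hs2, hs3⟩ := ih (by omega) t ht2 hc ht3
      exact ⟨s, hs1, by omega, hs3⟩
    · refine ⟨b+1, by omega, le_rfl, main 0 (β b) t ht1 hc ht3 (β (b+1)) ?_ tb htb htb1 hdb⟩
      have := hβ b (b+1) (by omega) (by omega)
      omega

/-- Spheres of radius at most `R` have no three points that are pairwise more than `u` apart. -/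
def NT {V : Type*} (G : SimpleGraph V) (R u : ℕ) : Prop :=
  ∀ (y : V) (L : ℕ), L ≤ R → ∀ p q r : V, G.dist y p = L → G.dist y q = L → G.dist y r = L →
    G.dist p q ≤ u ∨ G.dist p r ≤ u ∨ G.dist q r ≤ u

/-- Every point has two points in opposite directions. -/
def TwoSided {V : Type*} (G : SimpleGraph V) (R u : ℕ) : Prop :=
  ∀ y : V, ∃ (L : ℕ) (p q : V), L ≤ R ∧ G.dist y p = L ∧ G.dist y q = L ∧ u < G.dist p q

lemma QLine.pair {V : Type*} {G : SimpleGraph V} (hG : G.Connected)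
    {C K T w ρ u : ℕ} {y : V} {g : ℤ → V} (h : QLine G C K T w ρ y g)
    (hu : 4 * w + 2 * (C * (C * (2 * w + 1 + K)) + K) ≤ u)
    {L : ℕ} (hL : L ≤ ρ) {p q : V} (hp : G.dist y p = L) (hq : G.dist y q = L)
    {t1 t2 : ℤ} (h0 : 0 ≤ t1) (h12 : t1 ≤ t2) (h2 : t2 ≤ T) (hp1 : G.dist p (g t1) ≤ w)
    (hq2 : G.dist q (g t2) ≤ w) : G.dist p q ≤ u := by
  obtain ⟨β, hβ0, hβ1, hβ⟩ := exists_geo hG y q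
  rw [hq] at hβ1 hβ
  obtain ⟨s, -, hs, hs2⟩ := h.cross hG hβ hL hβ0 0 0 t1 (by omega) h0
    (by rw [hβ0, h.base]; simp) L (Nat.zero_le _) le_rfl t2 h2 h12 (by rw [hβ1]; exact hq2)
  have b1 := hβ 0 s (by omega) hs
  have b2 := hβ s L hs le_rfl
  rw [hβ0] at b1
  rw [hβ1] at b2
  have r1 := hG.dist_triangle (u := p) (v := g t1) (w := β s)
  rw [G.dist_comm (u := g t1)] at r1
  have r2 := hG.dist_triangle (u := y) (v := β s) (w := p)
  rw [G.dist_comm (u := β s) (v := p)] at r2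
  have r3 := hG.dist_triangle (u := p) (v := β s) (w := q)
  omega

lemma QLine.pair' {V : Type*} {G : SimpleGraph V} (hG : G.Connected)
    {C K T w ρ u : ℕ} {y : V} {g : ℤ → V} (h : QLine G C K T w ρ y g)
    (hu : 4 * w + 2 * (C * (C * (2 * w + 1 + K)) + K) ≤ u)
    {L : ℕ} (hL : L ≤ ρ) {p q : V} (hp : G.dist y p = L) (hq : G.dist y q = L)
    {t1 t2 : ℤ} (h01 : 0 ≤ t1) (h02 : 0 ≤ t2) (h1 : t1 ≤ T) (h2 : t2 ≤ T)
    (hp1 : G.dist p (g t1) ≤ w) (hq2 : G.dist q (g t2) ≤ w) : G.dist p q ≤ u := by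
  rcases le_total t1 t2 with hc | hc
  · exact h.pair hG hu hL hp hq h01 hc h2 hp1 hq2
  · rw [G.dist_comm]
    exact h.pair hG hu hL hq hp h02 hc h1 hq2 hp1

lemma QLine.pair'' {V : Type*} {G : SimpleGraph V} (hG : G.Connected)
    {C K T w ρ u : ℕ} {y : V} {g : ℤ → V} (h : QLine G C K T w ρ y g)
    (hu : 4 * w + 2 * (C * (C * (2 * w + 1 + K)) + K) ≤ u)
    {L : ℕ} (hL : L ≤ ρ) {p q : V} (hp : G.dist y p = L) (hq : G.dist y q = L)
    {t1 t2 : ℤ} (h01 : t1 ≤ 0) (h02 : t2 ≤ 0) (h1 : -T ≤ t1) (h2 : -T ≤ t2)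
    (hp1 : G.dist p (g t1) ≤ w) (hq2 : G.dist q (g t2) ≤ w) : G.dist p q ≤ u :=
  h.refl.pair' hG hu hL hp hq (t1 := -t1) (t2 := -t2) (by omega) (by omega) (by omega) (by omega)
    (by simpa using hp1) (by simpa using hq2)

lemma nt_of_qline {V : Type*} {G : SimpleGraph V} (hG : G.Connected)
    {C K T w ρ u : ℕ} (h : ∀ y, ∃ g, QLine G C K T w ρ y g)
    (hu : 4 * w + 2 * (C * (C * (2 * w + 1 + K)) + K) ≤ u) : NT G ρ u := by
  intro y L hL p q r hp hq hr
  obtain ⟨g, hg⟩ := h y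
  obtain ⟨t1, a1, b1, c1⟩ := hg.cov p (by omega)
  obtain ⟨t2, a2, b2, c2⟩ := hg.cov q (by omega)
  obtain ⟨t3, a3, b3, c3⟩ := hg.cov r (by omega)
  rcases le_total 0 t1 with h1 | h1 <;> rcases le_total 0 t2 with h2 | h2 <;>
    rcases le_total 0 t3 with h3 | h3
  · exact Or.inl (hg.pair' hG hu hL hp hq h1 h2 b1 b2 c1 c2)
  · exact Or.inl (hg.pair' hG hu hL hp hq h1 h2 b1 b2 c1 c2)
  · exact Or.inr (Or.inl (hg.pair' hG hu hL hp hr h1 h3 b1 b3 c1 c3))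
  · exact Or.inr (Or.inr (hg.pair'' hG hu hL hq hr h2 h3 a2 a3 c2 c3))
  · exact Or.inr (Or.inr (hg.pair' hG hu hL hq hr h2 h3 b2 b3 c2 c3))
  · exact Or.inr (Or.inl (hg.pair'' hG hu hL hp hr h1 h3 a1 a3 c1 c3))
  · exact Or.inl (hg.pair'' hG hu hL hp hq h1 h2 a1 a2 c1 c2)
  · exact Or.inl (hg.pair'' hG hu hL hp hq h1 h2 a1 a2 c1 c2)

lemma QLine.two {V : Type*} {G : SimpleGraph V} (hG : G.Connected)
    {C K T w ρ u₂ k : ℕ} {y : V} {g : ℤ → V} (h : QLine G C K T w ρ y g)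
    (hkT : k ≤ T) (hkρ : C * k + K ≤ ρ)
    (hk1 : C * (w + u₂ + K) < k)
    (hk2 : C * (w + (C * (C * (2 * w + 1 + K)) + K) + K) < k)
    (hle : G.dist y (g (-k)) ≤ G.dist y (g k)) :
    ∃ (L : ℕ) (p q : V), L ≤ ρ ∧ G.dist y p = L ∧ G.dist y q = L ∧ u₂ < G.dist p q := by
  obtain ⟨β, hβ0, hβ1, hβ⟩ := exists_geo hG y (g k)
  set L := G.dist y (g (-k)) with hL
  have hup := h.up 0 k (by omega) (by omega) (by omega)
  rw [h.base] at hup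
  have hkρ' : G.dist y (g k) ≤ ρ := by
    refine le_trans ?_ hkρ
    zify
    simpa using hup
  have hlo := h.lo (-k) 0 (by omega) (by omega) (by omega)
  rw [h.base, G.dist_comm, ← hL] at hlo
  have b0 := hβ 0 L (by omega) hle
  rw [hβ0] at b0
  refine ⟨L, g (-k), β L, by omega, rfl, by omega, ?_⟩
  by_contra hcon
  push Not at hcon
  obtain ⟨t, ht1, ht2, ht3⟩ := h.cov (β L) (by omega)
  have htneg : t ≤ 0 := by
    by_contra hpos
    push Not at hpos
    have q := h.lo (-k) t (by omega) (by omega) ht2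
    have r := hG.dist_triangle (u := g (-k)) (v := β L) (w := g t)
    have : (C : ℤ) * (G.dist (g (-k)) (g t) + K) ≤ C * (w + u₂ + K) := by
      apply mul_le_mul_of_nonneg_left _ (by positivity)
      have : (G.dist (g (-k)) (g t) : ℤ) ≤ w + u₂ := by exact_mod_cast (by omega)
      omega
    zify at hk1
    omega
  obtain ⟨s, hs1, hs2, hs3⟩ := h.cross hG hβ hkρ' hβ0 L t 0 ht1 htneg ht3 _ hle le_rfl k
    (by omega) (by omega) (by rw [hβ1]; simp)
  have b1 := hβ 0 s (by omega) (by omega)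
  rw [hβ0] at b1
  rw [h.base, G.dist_comm] at hs3
  have hL2 : L ≤ w + (C * (C * (2 * w + 1 + K)) + K) := by omega
  have : C * (L + K) ≤ C * (w + (C * (C * (2 * w + 1 + K)) + K) + K) :=
    Nat.mul_le_mul_left C (by omega)
  zify at this hk2
  omega

lemma twoSided_of_qline {V : Type*} {G : SimpleGraph V} (hG : G.Connected)
    {C K T w ρ u₂ k : ℕ} (h : ∀ y, ∃ g, QLine G C K T w ρ y g)
    (hkT : k ≤ T) (hkρ : C * k + K ≤ ρ)
    (hk1 : C * (w + u₂ + K) < k)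
    (hk2 : C * (w + (C * (C * (2 * w + 1 + K)) + K) + K) < k) : TwoSided G ρ u₂ := by
  intro y
  obtain ⟨g, hg⟩ := h y
  rcases le_total (G.dist y (g (-k))) (G.dist y (g k)) with hc | hc
  · exact hg.two hG hkT hkρ hk1 hk2 hc
  · exact hg.refl.two hG hkT hkρ hk1 hk2 (by simpa using hc)

/-- Summary of the local analysis. -/
lemma local_structure {V : Type*} {G : SimpleGraph V} (hG : G.Connected) {C K m : ℕ}
    (hC : 1 ≤ C) (hm : 1 ≤ m) (hKm : K ≤ m) (hRT : NRT G C K)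
    (hnT : ¬ Tripod G (10000 * C ^ 6) m) :
    NT G (9000 * C ^ 5 * m) (40 * C ^ 3 * m) ∧
      TwoSided G (9000 * C ^ 5 * m) (100 * (40 * C ^ 3 * m)) := by
  have c1 : C ≤ C ^ 2 := Nat.le_self_pow (by norm_num) C
  have p1 : m ≤ C * m := Nat.le_mul_of_pos_left m hC
  have p2 : C * m ≤ C * (C * m) := Nat.le_mul_of_pos_left _ hC
  have p3 : C * (C * m) ≤ C * (C * (C * m)) := Nat.le_mul_of_pos_left _ hC
  have p4 : C * (C * (C * m)) ≤ C * (C * (C * (C * m))) := Nat.le_mul_of_pos_left _ hC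
  have p5 : C * (C * (C * (C * m))) ≤ C * (C * (C * (C * (C * m)))) :=
    Nat.le_mul_of_pos_left _ hC
  have p6 : C * (C * (C * (C * (C * m)))) ≤ C * (C * (C * (C * (C * (C * m))))) :=
    Nat.le_mul_of_pos_left _ hC
  have k1 : C * K ≤ C * m := Nat.mul_le_mul_left C hKm
  have k2 : C * (C * K) ≤ C * (C * m) := Nat.mul_le_mul_left C k1
  have l1 : C * (C * 1) ≤ C * (C * m) := Nat.mul_le_mul_left C (Nat.mul_le_mul_left C hm)
  have l3 : C * (C * (C * K)) ≤ C * (C * (C * m)) := Nat.mul_le_mul_left C k2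
  have l4 : C * (C * (C * 1)) ≤ C * (C * (C * m)) := Nat.mul_le_mul_left C l1
  have hq : ∀ y, ∃ g, QLine G C K (20 * (10000 * C ^ 6) * m) (2 * C * m + 2 * K)
      (9000 * C ^ 5 * m) y g := by
    intro y
    refine exists_qline hG hRT hnT ?_ y
    have e1 : C * (9000 * C ^ 5 * m + 2 * K) =
      9000 * (C * (C * (C * (C * (C * (C * m)))))) + 2 * (C * K) := by ring
    have e2 : 2 * (10000 * C ^ 6) * m = 20000 * (C * (C * (C * (C * (C * (C * m)))))) := by ring
    rw [e1, e2]
    omega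
  constructor
  · refine nt_of_qline hG hq ?_
    have e1 : 4 * (2 * C * m + 2 * K) + 2 * (C * (C * (2 * (2 * C * m + 2 * K) + 1 + K)) + K)
      = 8 * (C * m) + 10 * K + 8 * (C * (C * (C * m))) + 10 * (C * (C * K)) + 2 * (C * (C * 1)) := by
      ring
    have e2 : 40 * C ^ 3 * m = 40 * (C * (C * (C * m))) := by ring
    rw [e1, e2]
    omega
  · refine twoSided_of_qline hG hq (k := 8000 * C ^ 4 * m) ?_ ?_ ?_ ?_
    · have e1 : 8000 * C ^ 4 * m = 8000 * (C * (C * (C * (C * m)))) := by ring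
      have e2 : 20 * (10000 * C ^ 6) * m = 200000 * (C * (C * (C * (C * (C * (C * m)))))) := by ring
      rw [e1, e2]
      omega
    · have e1 : C * (8000 * C ^ 4 * m) + K = 8000 * (C * (C * (C * (C * (C * m))))) + K := by ring
      have e2 : 9000 * C ^ 5 * m = 9000 * (C * (C * (C * (C * (C * m))))) := by ring
      rw [e1, e2]
      omega
    · have e1 : C * (2 * C * m + 2 * K + 100 * (40 * C ^ 3 * m) + K) =
        2 * (C * (C * m)) + 3 * (C * K) + 4000 * (C * (C * (C * (C * m)))) := by ring
      have e2 : 8000 * C ^ 4 * m = 8000 * (C * (C * (C * (C * m)))) := by ring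
      rw [e1, e2]
      omega
    · have e1 : C * (2 * C * m + 2 * K + (C * (C * (2 * (2 * C * m + 2 * K) + 1 + K)) + K) + K) =
        2 * (C * (C * m)) + 4 * (C * K) + 4 * (C * (C * (C * (C * m)))) + 5 * (C * (C * (C * K)))
          + C * (C * (C * 1)) := by ring
      have e2 : 8000 * C ^ 4 * m = 8000 * (C * (C * (C * (C * m)))) := by ring
      rw [e1, e2]
      omega

lemma near_level {V : Type*} {G : SimpleGraph V} (hG : G.Connected) {α : ℕ → V} {L u t s : ℕ}
    (hα : Geo G α L) (ht : t ≤ L) (hs : s ≤ L) {v : V} (hv : G.dist (α 0) v = s)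
    (h : G.dist v (α t) ≤ u) : G.dist v (α s) ≤ 2 * u := by
  have a1 := hα 0 t (by omega) ht
  have r1 := hG.dist_triangle (u := α 0) (v := v) (w := α t)
  have r2 := hG.dist_triangle (u := α 0) (v := α t) (w := v)
  rw [G.dist_comm (u := α t) (v := v)] at r2
  have r3 := hG.dist_triangle (u := v) (v := α t) (w := α s)
  rcases le_total t s with hc | hc
  · have := hα t s hc hs
    omega
  · have := hα s t hc ht
    rw [G.dist_comm] at this
    omega

lemma nonbranch {V : Type*} {G : SimpleGraph V} (hG : G.Connected) {R u : ℕ} (hNT : NT G R u)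
    {α : ℕ → V} {L t s ρ : ℕ} (hα : Geo G α L) (hρ : ρ ≤ R) (ht1 : ρ ≤ t) (ht2 : t + ρ ≤ L)
    (hs : s ≤ L) {v : V} (hv : G.dist (α 0) v = s) (h : G.dist v (α t) ≤ ρ) :
    G.dist v (α s) ≤ 2 * u := by
  obtain ⟨m, hm⟩ : ∃ m, G.dist v (α t) = m := ⟨_, rfl⟩
  have a1 := hα t (t + m) (by omega) (by omega)
  have a2 := hα (t - m) t (by omega) (by omega)
  have a3 := hα (t - m) (t + m) (by omega) (by omega)
  rcases hNT (α t) m (by omega) v (α (t + m)) (α (t - m)) (by rw [G.dist_comm]; exact hm) (by omega)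
    (by rw [G.dist_comm]; omega) with h1 | h1 | h1
  · exact near_level hG hα (by omega) hs hv h1
  · exact near_level hG hα (by omega) hs hv h1
  · rw [G.dist_comm] at h1
    exact near_level hG hα (t := t) (by omega) hs hv (by omega)

lemma forward {V : Type*} {G : SimpleGraph V} (hG : G.Connected) {R u : ℕ} (hNT : NT G R u)
    {α β : ℕ → V} {L L' t₀ : ℕ} (hα : Geo G α L) (hβ : Geo G β L') (h0 : β 0 = α 0) (hu : 1 ≤ u)
    (hR : 6 * u ≤ R) (ht₀ : 3 * u ≤ t₀) (h : G.dist (β t₀) (α t₀) ≤ 2 * u) (t : ℕ) (ht : t₀ ≤ t)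
    (ht' : t ≤ L') (htL : t + 3 * u ≤ L) : G.dist (β t) (α t) ≤ 2 * u := by
  induction t, ht using Nat.le_induction with
  | base => exact h
  | succ t ht ih =>
    have ih' := ih (by omega) (by omega)
    have b1 := hβ t (t+1) (by omega) ht'
    have b2 := hβ 0 (t+1) (by omega) ht'
    rw [h0] at b2
    have r := hG.dist_triangle (u := β (t+1)) (v := β t) (w := α t)
    rw [G.dist_comm (u := β (t+1)) (v := β t)] at r
    exact nonbranch hG hNT hα (ρ := 3 * u) (t := t) (by omega) (by omega) (by omega) (by omega)
      (by omega) (by omega)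

lemma backward {V : Type*} {G : SimpleGraph V} (hG : G.Connected) {R u : ℕ} (hNT : NT G R u)
    {α β : ℕ → V} {L L' t₀ : ℕ} (hα : Geo G α L) (hβ : Geo G β L') (h0 : β 0 = α 0) (hu : 1 ≤ u)
    (hR : 6 * u ≤ R) (ht₀ : 3 * u ≤ t₀) (t : ℕ) (ht : t₀ ≤ t)
    (ht' : t ≤ L') (htL : t + 3 * u ≤ L) (h : G.dist (β t) (α t) ≤ 2 * u) :
    G.dist (β t₀) (α t₀) ≤ 2 * u := by
  induction t, ht using Nat.le_induction with
  | base => exact h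
  | succ t ht ih =>
    refine ih (by omega) (by omega) ?_
    have b1 := hβ t (t+1) (by omega) ht'
    have b2 := hβ 0 t (by omega) (by omega)
    rw [h0] at b2
    have r := hG.dist_triangle (u := β t) (v := β (t+1)) (w := α (t+1))
    exact nonbranch hG hNT hα (ρ := 3 * u) (t := t+1) (by omega) (by omega) (by omega) (by omega)
      (by omega) (by omega)

lemma follow_end {V : Type*} {G : SimpleGraph V} (hG : G.Connected) {R u : ℕ} (hNT : NT G R u)
    {α β : ℕ → V} {L L' : ℕ} (hα : Geo G α L) (hβ : Geo G β L') (h0 : β 0 = α 0) (hu : 1 ≤ u)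
    (hR : 6 * u ≤ R) (hL : 6 * u ≤ L)
    (h : G.dist (β (3 * u)) (α (3 * u)) ≤ 2 * u) (t : ℕ) (ht : 3 * u ≤ t)
    (ht' : t ≤ L') (htL : t ≤ L) : G.dist (β t) (α t) ≤ 8 * u := by
  by_cases hc : t + 3 * u ≤ L
  · have := forward hG hNT hα hβ h0 hu hR le_rfl h t ht ht' hc
    omega
  · have := forward hG hNT hα hβ h0 hu hR le_rfl h (L - 3 * u) (by omega) (by omega) (by omega)
    have a := hα (L - 3 * u) t (by omega) htL
    have b := hβ (L - 3 * u) t (by omega) (by omega)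
    have r1 := hG.dist_triangle (u := β t) (v := β (L - 3 * u)) (w := α t)
    have r2 := hG.dist_triangle (u := β (L - 3 * u)) (v := α (L - 3 * u)) (w := α t)
    rw [G.dist_comm] at b
    omega

/-- Along a geodesic, a predicate that changes value changes it at some step. -/
lemma exists_switch (P : ℕ → Prop) (L : ℕ) (h0 : P 0) (hL : ¬ P L) :
    ∃ i, i < L ∧ P i ∧ ¬ P (i + 1) := by
  by_contra hcon
  push Not at hcon
  have : ∀ i, i ≤ L → P i := by
    intro i
    induction i with
    | zero => exact fun _ => h0
    | succ i ih => exact fun hi => hcon i (by omega) (ih (by omega))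
  exact hL (this L le_rfl)

lemma global_structure {V : Type*} {G : SimpleGraph V} (hG : G.Connected) {R u D : ℕ}
    (hu : 1 ≤ u) (hNT : NT G R u) (hTS : TwoSided G R (100 * u)) (hD : ∀ x y, G.dist x y ≤ D)
    (o y : V) (hoy : G.dist o y = D) (hRD : 10 * R ≤ D) :
    ∃ A : V → Prop,
      (∀ z z', (A z ↔ A z') → G.dist o z ≤ G.dist o z' →
        G.dist z z' + G.dist o z ≤ G.dist o z' + 4 * R) ∧
      (∀ z z', A z → ¬ A z' → G.dist z z' + G.dist o z + G.dist o z' ≤ 2 * D + 6 * R) ∧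
      (∀ z z', A z → ¬ A z' → G.dist o z + G.dist o z' ≤ G.dist z z' + 10 * R ∨
        2 * D ≤ G.dist z z' + G.dist o z + G.dist o z' + 10 * R) ∧
      (∀ t, R ≤ t → t + 2 * R ≤ D →
        (∃ z, A z ∧ G.dist o z = t) ∧ (∃ z, ¬ A z ∧ G.dist o z = t)) := by
  have hRu : 50 * u < R := by
    obtain ⟨L, p, q, h1, h2, h3, h4⟩ := hTS o
    have := hG.dist_triangle (u := p) (v := o) (w := q)
    rw [G.dist_comm (u := p) (v := o)] at this
    omega
  choose σ hσ0 hσ1 hσ using fun z => exists_geo hG o z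
  obtain ⟨α, hα0, hα1, hα⟩ := exists_geo hG o y
  rw [hoy] at hα1 hα
  have hα' : ∀ t, t ≤ D → G.dist o (α t) = t := by
    intro t ht
    have := hα 0 t (by omega) ht
    rw [hα0] at this
    omega
  let A : V → Prop := fun z => G.dist o z < 3 * u ∨ G.dist (σ z (3 * u)) (α (3 * u)) ≤ 2 * u
  -- points of A are close to α
  have hA : ∀ z, A z → G.dist z (α (G.dist o z)) ≤ 8 * u := by
    intro z hz
    rcases hz with hz | hz
    · have r := hG.dist_triangle (u := z) (v := o) (w := α (G.dist o z))
      rw [hα' _ (hD _ _), G.dist_comm (u := z) (v := o)] at r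
      omega
    · by_cases hz' : G.dist o z < 3 * u
      · have r := hG.dist_triangle (u := z) (v := o) (w := α (G.dist o z))
        rw [hα' _ (hD _ _), G.dist_comm (u := z) (v := o)] at r
        omega
      · have := follow_end hG hNT hα (hσ z) (by rw [hσ0, hα0]) hu (by omega) (by omega) hz
          (G.dist o z) (by omega) le_rfl (hD _ _)
        rwa [hσ1] at this
  have hA2 : ∀ z, A z → 3 * u ≤ G.dist o z → G.dist o z + 3 * u ≤ D →
      G.dist z (α (G.dist o z)) ≤ 2 * u := by
    intro z hz h1 h2
    have hz : G.dist (σ z (3 * u)) (α (3 * u)) ≤ 2 * u := hz.resolve_left (by omega)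
    have := forward hG hNT hα (hσ z) (by rw [hσ0, hα0]) hu (by omega) le_rfl hz _ h1 le_rfl h2
    rwa [hσ1] at this
  -- the second arm
  obtain ⟨y', hy', hnA⟩ : ∃ y', G.dist y y' ≤ R ∧ ¬ A y' := by
    obtain ⟨L, p, q, h1, h2, h3, h4⟩ := hTS y
    by_contra hcon
    push Not at hcon
    have key : ∀ p, G.dist y p = L → G.dist p (α (D - L)) ≤ 16 * u := by
      intro p hp
      have h5 := hA p (hcon p (by omega))
      have h6 := hD o p
      have r1 := hG.dist_triangle (u := y) (v := p) (w := α (G.dist o p))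
      have r2 := hG.dist_triangle (u := p) (v := α (G.dist o p)) (w := y)
      have a1 := hα (G.dist o p) D h6 le_rfl
      rw [hα1] at a1
      rw [G.dist_comm (u := y) (v := α _)] at r1
      rw [G.dist_comm (u := p) (v := y)] at r2
      have r3 := hG.dist_triangle (u := p) (v := α (G.dist o p)) (w := α (D - L))
      rcases le_total (G.dist o p) (D - L) with hc | hc
      · have := hα _ _ hc (by omega)
        omega
      · have := hα _ _ hc (by omega)
        rw [G.dist_comm] at this
        omega
    have k1 := key p h2
    have k2 := key q h3
    have r := hG.dist_triangle (u := p) (v := α (D - L)) (w := q)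
    rw [G.dist_comm (u := α (D - L))] at r
    omega
  have hy3 : 3 * u ≤ G.dist o y' := by
    by_contra hc
    exact hnA (Or.inl (by omega))
  have hyne : ¬ G.dist (σ y' (3 * u)) (α (3 * u)) ≤ 2 * u := fun hc => hnA (Or.inr hc)
  have hLD := hD o y'
  have hLR : D ≤ G.dist o y' + R := by
    have r := hG.dist_triangle (u := o) (v := y') (w := y)
    rw [G.dist_comm (u := y') (v := y)] at r
    omega
  have hβ0 := hσ0 y'
  have hβ1 := hσ1 y'
  have hβ := hσ y'
  have hσ3 : ∀ z, 3 * u ≤ G.dist o z → G.dist o (σ z (3 * u)) = 3 * u := by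
    intro z hz
    have := hσ z 0 (3 * u) (by omega) hz
    rw [hσ0] at this
    omega
  have hB0 : ∀ z, ¬ A z → 3 * u ≤ G.dist o z ∧
      G.dist (σ z (3 * u)) (σ y' (3 * u)) ≤ 2 * u := by
    intro z hz
    have h3 : 3 * u ≤ G.dist o z := by
      by_contra hc
      exact hz (Or.inl (by omega))
    have hne : ¬ G.dist (σ z (3 * u)) (α (3 * u)) ≤ 2 * u := fun hc => hz (Or.inr hc)
    refine ⟨h3, ?_⟩
    rcases hNT o (3 * u) (by omega) (σ z (3 * u)) (σ y' (3 * u)) (α (3 * u)) (hσ3 z h3)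
      (hσ3 y' hy3) (hα' _ (by omega)) with h | h | h
    · omega
    · omega
    · omega
  generalize hβdef : σ y' = β at *
  generalize hLdef : G.dist o y' = Lβ at *
  have hB1 : ∀ z, ¬ A z → G.dist z (β (min (G.dist o z) Lβ)) ≤ 8 * u + R := by
    intro z hz
    obtain ⟨h1, h2⟩ := hB0 z hz
    have h3 := follow_end hG hNT hβ (hσ z) (by rw [hσ0, hβ0]) hu (by omega) (by omega) h2
          (min (G.dist o z) Lβ) (by omega) (by omega) (by omega)
    have h4 := hσ z (min (G.dist o z) Lβ) (G.dist o z) (by omega) le_rfl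
    rw [hσ1, G.dist_comm] at h4
    have r := hG.dist_triangle (u := z) (v := σ z (min (G.dist o z) Lβ))
      (w := β (min (G.dist o z) Lβ))
    have h5 := hD o z
    omega
  have hB2 : ∀ z, ¬ A z → G.dist o z + 3 * u ≤ Lβ → G.dist z (β (G.dist o z)) ≤ 2 * u := by
    intro z hz hz2
    obtain ⟨h1, h2⟩ := hB0 z hz
    have := forward hG hNT hβ (hσ z) (by rw [hσ0, hβ0]) hu (by omega) le_rfl h2 _ h1 le_rfl hz2
    rwa [hσ1] at this
  have hβ' : ∀ t, t ≤ Lβ → G.dist o (β t) = t := by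
    intro t ht
    have := hβ 0 t (by omega) ht
    rw [hβ0] at this
    omega
  have hsep : ∀ t, 6 * u ≤ t → t ≤ Lβ → t + 6 * u ≤ D → ¬ G.dist (β t) (α t) ≤ 6 * u := by
    intro t h1 h2 h3 h4
    have h5 := nonbranch hG hNT hα (ρ := 6 * u) (t := t) (s := t) (v := β t) (by omega) h1 h3
      (by omega) (by rw [hα0]; exact hβ' t h2) h4
    exact hyne (backward hG hNT hα hβ (by rw [hβ0, hα0]) hu (by omega) le_rfl t (by omega) h2
      (by omega) h5)
  refine ⟨A, ?_, ?_, ?_, ?_⟩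
  · intro z z' hzz hle
    have hD' := hD o z'
    by_cases hz : A z
    · have h1 := hA z hz
      have h2 := hA z' (hzz.1 hz)
      have h3 := hα _ _ hle hD'
      have r1 := hG.dist_triangle (u := z) (v := α (G.dist o z)) (w := z')
      have r2 := hG.dist_triangle (u := α (G.dist o z)) (v := α (G.dist o z')) (w := z')
      rw [G.dist_comm (u := α (G.dist o z')) (v := z')] at r2
      omega
    · have h1 := hB1 z hz
      have h2 := hB1 z' (fun h => hz (hzz.2 h))
      have h3 := hβ (min (G.dist o z) Lβ) (min (G.dist o z') Lβ) (by omega) (by omega)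
      have r1 := hG.dist_triangle (u := z) (v := β (min (G.dist o z) Lβ)) (w := z')
      have r2 := hG.dist_triangle (u := β (min (G.dist o z) Lβ))
        (v := β (min (G.dist o z') Lβ)) (w := z')
      rw [G.dist_comm (u := β (min (G.dist o z') Lβ)) (v := z')] at r2
      omega
  · intro z z' hz hz'
    have h1 := hA z hz
    have h2 := hB1 z' hz'
    have h5 := hD o z
    have h6 := hD o z'
    have h3 := hα _ D h5 le_rfl
    have h4 := hβ (min (G.dist o z') Lβ) Lβ (by omega) le_rfl
    rw [hα1] at h3
    rw [hβ1, G.dist_comm] at h4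
    have r1 := hG.dist_triangle (u := z) (v := α (G.dist o z)) (w := z')
    have r2 := hG.dist_triangle (u := α (G.dist o z)) (v := y) (w := z')
    have r3 := hG.dist_triangle (u := y) (v := y') (w := z')
    have r4 := hG.dist_triangle (u := y') (v := β (min (G.dist o z') Lβ)) (w := z')
    rw [G.dist_comm (u := β (min (G.dist o z') Lβ)) (v := z')] at r4
    omega
  · intro z z' hz hz'
    obtain ⟨τ, hτ0, hτ1, hτ⟩ := exists_geo hG z z'
    obtain ⟨i, hi, hAi, hAi'⟩ := exists_switch (fun i => A (τ i)) (G.dist z z')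
      (by simpa [hτ0] using hz) (by simpa [hτ1] using hz')
    have g1 := hτ 0 i (by omega) (by omega)
    have g2 := hτ i (i+1) (by omega) (by omega)
    have g3 := hτ (i+1) _ (by omega) le_rfl
    rw [hτ0] at g1
    rw [hτ1] at g3
    have r1 := hG.dist_triangle (u := o) (v := τ i) (w := z)
    have r2 := hG.dist_triangle (u := o) (v := τ (i+1)) (w := z')
    have r3 := hG.dist_triangle (u := o) (v := z) (w := τ i)
    have r4 := hG.dist_triangle (u := o) (v := z') (w := τ (i+1))
    have r5 := hG.dist_triangle (u := o) (v := τ i) (w := τ (i+1))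
    have r6 := hG.dist_triangle (u := o) (v := τ (i+1)) (w := τ i)
    rw [G.dist_comm (u := τ i) (v := z)] at r1
    rw [G.dist_comm (u := z') (v := τ (i+1))] at r4
    rw [G.dist_comm (u := τ (i+1)) (v := τ i)] at r6
    by_cases c1 : G.dist o (τ i) ≤ 4 * R
    · left; omega
    by_cases c2 : D ≤ G.dist o (τ i) + 4 * R
    · right; omega
    exfalso
    have k1 := hA2 _ hAi (by omega) (by omega)
    have k2 := hB2 _ hAi' (by omega)
    obtain ⟨t, ht⟩ : ∃ t, G.dist o (τ i) = t := ⟨_, rfl⟩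
    obtain ⟨t', ht'⟩ : ∃ t', G.dist o (τ (i+1)) = t' := ⟨_, rfl⟩
    rw [ht] at k1
    rw [ht'] at k2
    refine hsep t (by omega) (by omega) (by omega) ?_
    have s1 := hG.dist_triangle (u := β t) (v := β t') (w := α t)
    have s2 := hG.dist_triangle (u := β t') (v := τ (i+1)) (w := α t)
    have s3 := hG.dist_triangle (u := τ (i+1)) (v := τ i) (w := α t)
    rw [G.dist_comm (u := τ (i+1)) (v := τ i)] at s3
    rw [G.dist_comm (u := β t') (v := τ (i+1))] at s2
    rcases le_total t t' with hc | hc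
    · have := hβ t t' hc (by omega)
      omega
    · have := hβ t' t hc (by omega)
      rw [G.dist_comm] at this
      omega
  · intro t h1 h2
    have hs := hsep t (by omega) (by omega) (by omega)
    refine ⟨⟨α t, ?_, hα' t (by omega)⟩, ⟨β t, ?_, hβ' t (by omega)⟩⟩
    · by_contra hc
      have e := hα' t (by omega)
      have := hB2 _ hc (by omega)
      rw [e, G.dist_comm] at this
      omega
    · intro hc
      have e := hβ' t (by omega)
      have := hA2 _ hc (by omega) (by omega)
      rw [e] at this
      omega

lemma circle_norm_small (x : ℝ) (hx : |x| ≤ 1) : ‖(x : AddCircle (2 : ℝ))‖ = |x| :=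
  (AddCircle.norm_coe_eq_abs_iff 2 (by norm_num)).2 (by norm_num; exact hx)

lemma circle_norm_big (x : ℝ) (h1 : 1 ≤ x) (h2 : x ≤ 2) : ‖(x : AddCircle (2 : ℝ))‖ = 2 - x := by
  have e : (x : AddCircle (2 : ℝ)) = ((x - 2 : ℝ) : AddCircle (2 : ℝ)) := by
    rw [AddCircle.coe_sub, AddCircle.coe_period, sub_zero]
  rw [e, circle_norm_small _ (by rw [abs_le]; constructor <;> linarith), abs_of_nonpos (by linarith)]
  ring

lemma circle_norm_le (x : ℝ) : ‖(x : AddCircle (2 : ℝ))‖ ≤ |x| := by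
  by_cases h : |x| ≤ 1
  · exact (circle_norm_small x h).le
  · have := AddCircle.norm_le_half_period (2 : ℝ) (x := (x : AddCircle (2 : ℝ))) (by norm_num)
    norm_num at this
    linarith

lemma circle_rep (Y : AddCircle (2 : ℝ)) : ∃ x : ℝ, |x| ≤ 1 ∧ (x : AddCircle (2 : ℝ)) = Y := by
  haveI : Fact ((0 : ℝ) < 2) := ⟨by norm_num⟩
  obtain ⟨x, hx, rfl⟩ := (AddCircle.coe_image_Icc_eq (2 : ℝ) (-1)).ge (Set.mem_univ Y)
  exact ⟨x, by rw [abs_le]; constructor <;> linarith [hx.1, hx.2], rfl⟩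

lemma circle_map {V : Type*} {G : SimpleGraph V} (hG : G.Connected) {R u D : ℕ}
    (hu : 1 ≤ u) (hNT : NT G R u) (hTS : TwoSided G R (100 * u)) (hD : ∀ x y, G.dist x y ≤ D)
    (o y : V) (hoy : G.dist o y = D) (hRD : 10 * R ≤ D) (hR : 1 ≤ R) :
    ∃ f : V → AddCircle (2 : ℝ),
      (∀ Y, ∃ v, dist (f v) Y ≤ 10 * R / D) ∧
      (∀ z z', |dist (f z) (f z') - (G.dist z z' : ℝ) / D| ≤ 10 * R / D) := by
  classical
  obtain ⟨A, h1, h2, h3, h4⟩ := global_structure hG hu hNT hTS hD o y hoy hRD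
  have hDpos : (0 : ℝ) < D := by exact_mod_cast (by omega : 0 < D)
  have hRr : (1 : ℝ) ≤ R := by exact_mod_cast hR
  have hRD' : (10 : ℝ) * R ≤ D := by exact_mod_cast hRD
  let r : V → ℝ := fun z => (G.dist o z : ℝ) / D
  have hr0 : ∀ z, 0 ≤ r z := fun z => by positivity
  have hr1 : ∀ z, r z ≤ 1 := fun z => by
    rw [div_le_one hDpos]; exact_mod_cast hD o z
  let f : V → AddCircle (2 : ℝ) := fun z => if A z then (r z : AddCircle (2:ℝ))
    else ((-r z : ℝ) : AddCircle (2:ℝ))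
  have habs : ∀ z z', |r z - r z'| ≤ 1 := by
    intro z z'
    rw [abs_le]; constructor <;> linarith [hr0 z, hr1 z, hr0 z', hr1 z']
  have same : ∀ z z', (A z ↔ A z') → dist (f z) (f z') = |r z - r z'| := by
    intro z z' hzz
    by_cases hz : A z
    · have hz' := hzz.1 hz
      simp only [f, hz, hz', if_true]
      rw [dist_eq_norm, ← AddCircle.coe_sub, circle_norm_small _ (habs z z')]
    · have hz' : ¬ A z' := fun h => hz (hzz.2 h)
      simp only [f, hz, hz', if_false]
      rw [dist_eq_norm, ← AddCircle.coe_sub, circle_norm_small]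
      · rw [abs_sub_comm (r z)]; congr 1; ring
      · rw [show - r z - - r z' = r z' - r z by ring]; exact habs z' z
  have diff : ∀ z z', A z → ¬ A z' → dist (f z) (f z') = ‖((r z + r z' : ℝ) : AddCircle (2:ℝ))‖ := by
    intro z z' hz hz'
    simp only [f, hz, hz', if_true, if_false]
    rw [dist_eq_norm, ← AddCircle.coe_sub]
    congr 2; ring
  have est1 : ∀ z z', (A z ↔ A z') → G.dist o z ≤ G.dist o z' →
      |dist (f z) (f z') - (G.dist z z' : ℝ) / D| ≤ 10 * R / D := by
    intro z z' hzz hle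
    have a := h1 z z' hzz hle
    have b := hG.dist_triangle (u := o) (v := z) (w := z')
    rify at a b hle
    rw [same z z' hzz]
    have e : |r z - r z'| = ((G.dist o z' : ℝ) - G.dist o z) / D := by
      rw [abs_sub_comm, abs_of_nonneg]
      · simp only [r]; ring
      · simp only [r]; rw [← sub_div]; exact div_nonneg (by linarith) hDpos.le
    rw [e, ← sub_div, abs_div, abs_of_pos hDpos]
    gcongr
    rw [abs_le]; constructor <;> linarith
  have est2 : ∀ z z', A z → ¬ A z' →
      |dist (f z) (f z') - (G.dist z z' : ℝ) / D| ≤ 10 * R / D := by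
    intro z z' hz hz'
    have a := h2 z z' hz hz'
    have b := h3 z z' hz hz'
    have c := hG.dist_triangle (u := z) (v := o) (w := z')
    rw [G.dist_comm (u := z) (v := o)] at c
    rify at a b c
    rw [diff z z' hz hz']
    have hrr : r z + r z' = ((G.dist o z : ℝ) + G.dist o z') / D := by simp only [r]; ring
    rcases le_total (r z + r z') 1 with hc | hc
    · rw [circle_norm_small _ (by rw [abs_of_nonneg (add_nonneg (hr0 z) (hr0 z'))]; exact hc),
        abs_of_nonneg (add_nonneg (hr0 z) (hr0 z')), hrr, ← sub_div, abs_div, abs_of_pos hDpos]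
      rw [hrr, div_le_one hDpos] at hc
      gcongr
      rw [abs_le]
      rcases b with b | b <;> constructor <;> linarith
    · rw [circle_norm_big _ hc (by linarith [hr1 z, hr1 z']), hrr]
      rw [hrr, one_le_div hDpos] at hc
      have e : 2 - ((G.dist o z : ℝ) + G.dist o z') / D - (G.dist z z' : ℝ) / D =
        (2 * D - ((G.dist o z : ℝ) + G.dist o z') - G.dist z z') / D := by
        field_simp
      rw [e, abs_div, abs_of_pos hDpos]
      gcongr
      rw [abs_le]
      rcases b with b | b <;> constructor <;> linarith
  refine ⟨f, ?_, ?_⟩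
  · intro Y
    obtain ⟨x, hx, rfl⟩ := circle_rep Y
    have hfl : ∃ t : ℕ, R ≤ t ∧ t + 2 * R ≤ D ∧ |(t : ℝ) - |x| * D| ≤ 10 * R := by
      have q1 : (⌊|x| * D⌋₊ : ℝ) ≤ |x| * D := Nat.floor_le (by positivity)
      have q2 : |x| * D < ⌊|x| * D⌋₊ + 1 := Nat.lt_floor_add_one _
      have q3 : |x| * D ≤ D := by nlinarith [abs_nonneg x]
      have q0 : 0 ≤ |x| * D := by positivity
      generalize |x| * D = X at *
      by_cases c1 : ⌊X⌋₊ < R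
      · refine ⟨R, le_rfl, by omega, ?_⟩
        have : (⌊X⌋₊ : ℝ) < R := by exact_mod_cast c1
        rw [abs_le]; constructor <;> linarith
      · by_cases c2 : ⌊X⌋₊ + 2 * R ≤ D
        · refine ⟨⌊X⌋₊, by omega, c2, ?_⟩
          rw [abs_le]; constructor <;> linarith
        · refine ⟨D - 2 * R, by omega, by omega, ?_⟩
          have : (D : ℝ) < ⌊X⌋₊ + 2 * R := by exact_mod_cast (by omega)
          rw [Nat.cast_sub (by omega)]
          push_cast
          rw [abs_le]; constructor <;> linarith
    obtain ⟨t, ht1, ht2, ht3⟩ := hfl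
    have ht4 : |(t : ℝ) / D - (|x|)| ≤ 10 * R / D := by
      have : (t : ℝ) / D - |x| = (t - |x| * D) / D := by field_simp
      rw [this, abs_div, abs_of_pos hDpos]
      gcongr
    obtain ⟨⟨z, hz, hzt⟩, ⟨z', hz', hzt'⟩⟩ := h4 t ht1 ht2
    rcases le_total 0 x with hc | hc
    · refine ⟨z, ?_⟩
      simp only [f, hz, if_true]
      rw [dist_eq_norm, ← AddCircle.coe_sub]
      refine (circle_norm_le _).trans ?_
      rw [abs_of_nonneg hc] at ht4
      simpa [r, hzt] using ht4
    · refine ⟨z', ?_⟩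
      simp only [f, hz', if_false]
      rw [dist_eq_norm, ← AddCircle.coe_sub]
      refine (circle_norm_le _).trans ?_
      rw [abs_of_nonpos hc, ← abs_neg] at ht4
      simp only [r, hzt']
      rw [show -((t : ℝ) / D) - x = -((t : ℝ) / D - -x) by ring]
      exact ht4
  · intro z z'
    by_cases hz : A z <;> by_cases hz' : A z'
    · rcases le_total (G.dist o z) (G.dist o z') with hc | hc
      · exact est1 z z' (by tauto) hc
      · rw [dist_comm, G.dist_comm]; exact est1 z' z (by tauto) hc
    · exact est2 z z' hz hz'
    · rw [dist_comm, G.dist_comm]; exact est2 z' z hz' hz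
    · rcases le_total (G.dist o z) (G.dist o z') with hc | hc
      · exact est1 z z' (by tauto) hc
      · rw [dist_comm, G.dist_comm]; exact est1 z' z (by tauto) hc

lemma nrt_of_roughlyTransitive {V : Type*} {G : SimpleGraph V} {C K : ℝ} (hC : 1 ≤ C) (hK : 0 ≤ K)
    (h : RoughlyTransitive C K (fun u v : V => (G.dist u v : ℝ))) : NRT G ⌈C⌉₊ ⌈K⌉₊ := by
  intro x y
  obtain ⟨f, ⟨h1, h2⟩, h3⟩ := h x y
  have hC' := Nat.le_ceil C
  have hK' := Nat.le_ceil K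
  have hC0 : 0 < C := by linarith
  refine ⟨f, h3, ?_, ?_, ?_⟩
  · intro a b
    have := (h1 a b).2
    have h4 : C * (G.dist a b : ℝ) ≤ ⌈C⌉₊ * (G.dist a b : ℝ) := by gcongr
    have : (G.dist (f a) (f b) : ℝ) ≤ ⌈C⌉₊ * (G.dist a b : ℝ) + ⌈K⌉₊ := by linarith
    exact_mod_cast this
  · intro a b
    have := (h1 a b).1
    have h5 : C⁻¹ * (G.dist a b : ℝ) ≤ G.dist (f a) (f b) + K := by simp only at this; linarith
    rw [inv_mul_le_iff₀ hC0] at h5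
    have : (G.dist a b : ℝ) ≤ ⌈C⌉₊ * (G.dist (f a) (f b) + ⌈K⌉₊) := h5.trans (by gcongr)
    exact_mod_cast this
  · intro v
    obtain ⟨a, ha⟩ := h2 v
    refine ⟨a, ?_⟩
    have : (G.dist (f a) v : ℝ) ≤ ⌈K⌉₊ := le_trans ha hK'
    exact_mod_cast this

lemma exists_scale {V : Type*} [Fintype V] {G : SimpleGraph V} (hG : G.Connected)
    {N l J k₀ D : ℕ} {A δ : ℝ} (hA : 0 < A) (hδ : 0 ≤ δ) (hN : 1 ≤ N) (hl : 3 ≤ l)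
    (hq : ∀ k, k₀ ≤ k →
      A * ((l : ℝ) * ((40 * N : ℕ) : ℝ) ^ (k + 1)) ^ δ < (((40 * N + 1) ^ (k - J) : ℕ) : ℝ))
    (o y : V) (hoy : G.dist o y = D) (hD : l * (40 * N) ^ (k₀ + J) ≤ D)
    (hcard : (Nat.card V : ℝ) ≤ A * (D : ℝ) ^ δ) :
    ∃ j, (40 * N) ^ j * l * (40 * N) ^ J ≤ D ∧ ¬ Tripod G N ((40 * N) ^ j * l) := by
  have hM : 1 < 40 * N := by omega
  have hMpos : 0 < 40 * N := by omega
  have hlpos : 0 < l := by omega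
  have hdiv : (40 * N) ^ (k₀ + J) ≤ D / l := by
    rw [Nat.le_div_iff_mul_le hlpos, mul_comm]; exact hD
  have hpos : D / l ≠ 0 := by
    have : 0 < (40 * N) ^ (k₀ + J) := by positivity
    omega
  obtain ⟨k, hk⟩ : ∃ k, k = Nat.log (40 * N) (D / l) := ⟨_, rfl⟩
  have hk1 : (40 * N) ^ k ≤ D / l := hk ▸ Nat.pow_log_le_self _ hpos
  have hk2 : D / l < (40 * N) ^ (k + 1) := hk ▸ Nat.lt_pow_succ_log_self hM _
  have hk0 : k₀ + J ≤ k := by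
    rw [hk]
    exact Nat.le_log_of_pow_le hM hdiv
  have hk1' : (40 * N) ^ k * l ≤ D := (Nat.le_div_iff_mul_le hlpos).1 hk1
  have hk2' : D < (40 * N) ^ (k + 1) * l := (Nat.div_lt_iff_lt_mul hlpos).1 hk2
  by_contra hcon
  push Not at hcon
  have hT : ∀ j, j < k - J → Tripod G N ((40 * N) ^ j * l) := by
    intro j hj
    apply hcon
    calc (40 * N) ^ j * l * (40 * N) ^ J = (40 * N) ^ (j + J) * l := by ring
      _ ≤ (40 * N) ^ k * l := by gcongr; omega
      _ ≤ D := hk1'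
  obtain ⟨γ, -, -, hγ⟩ := exists_geo hG o y
  rw [hoy] at hγ
  have hle : (40 * N) ^ (k - J) * l ≤ D := le_trans (by gcongr; omega) hk1'
  have hg := growth hG N l (k - J) hN hl hT γ (fun i j hij hj => hγ i j hij (hj.trans hle))
  have hg2 : (40 * N + 1) ^ (k - J) ≤ Nat.card V := by
    rw [Nat.card_eq_fintype_card]
    exact hg.trans (Finset.card_le_univ _)
  have hq' := hq k (by omega)
  have h1 : (((40 * N + 1) ^ (k - J) : ℕ) : ℝ) ≤ Nat.card V := by exact_mod_cast hg2
  have h2 : A * (D : ℝ) ^ δ ≤ A * ((l : ℝ) * ((40 * N : ℕ) : ℝ) ^ (k + 1)) ^ δ := by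
    gcongr
    have : (D : ℝ) ≤ (((40 * N) ^ (k + 1) * l : ℕ) : ℝ) := by exact_mod_cast hk2'.le
    refine this.trans (le_of_eq ?_)
    push_cast; ring
  linarith

lemma exists_k0 {M l J : ℕ} {A δ : ℝ} (hA : 0 < A) (hM : 1 < M) (hl : 3 ≤ l)
    (hδ : (M : ℝ) ^ δ < M + 1) :
    ∃ k₀, J ≤ k₀ ∧ ∀ k, k₀ ≤ k →
      A * ((l : ℝ) * (M : ℝ) ^ (k + 1)) ^ δ < (((M + 1) ^ (k - J) : ℕ) : ℝ) := by
  have hMr : (0 : ℝ) < M := by exact_mod_cast (by omega : 0 < M)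
  have hlr : (0 : ℝ) < l := by exact_mod_cast (by omega : 0 < l)
  set b := (M : ℝ) ^ δ with hb
  have hbpos : 0 < b := Real.rpow_pos_of_pos hMr δ
  have hq : 1 < ((M : ℝ) + 1) / b := by rwa [one_lt_div hbpos]
  have ht := tendsto_pow_atTop_atTop_of_one_lt hq
  obtain ⟨k₀, hk₀⟩ := (eventually_atTop.1
    (ht.eventually_gt_atTop (A * (l : ℝ) ^ δ * b * ((M : ℝ) + 1) ^ J)))
  refine ⟨max k₀ J, le_max_right _ _, fun k hk => ?_⟩
  have h := hk₀ k (le_trans (le_max_left _ _) hk)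
  have hJ : J ≤ k := le_trans (le_max_right _ _) hk
  rw [Real.mul_rpow hlr.le (by positivity), ← Real.rpow_natCast, ← Real.rpow_mul hMr.le,
    mul_comm ((k + 1 : ℕ) : ℝ) δ, Real.rpow_mul hMr.le, Real.rpow_natCast, ← hb]
  rw [div_pow, lt_div_iff₀ (by positivity)] at h
  push_cast
  have e : ((M : ℝ) + 1) ^ k = ((M : ℝ) + 1) ^ (k - J) * ((M : ℝ) + 1) ^ J := by
    rw [← pow_add]; congr 1; omega
  rw [e] at h
  have hp : (0 : ℝ) < ((M : ℝ) + 1) ^ J := by positivity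
  refine lt_of_mul_lt_mul_right (lt_of_eq_of_lt ?_ h) hp.le
  ring

/-- **Theorem 3.** For all `C ≥ 1` and `K ≥ 0` there exists `δ > 1` such that:
for every sequence `(X_n)` of finite connected `(C,K)`-roughly transitive graphs
with `|X_n| → ∞` and `|X_n| ≤ A · diam(X_n)^δ` (for some constant `A > 0`), the
rescaled spaces `X'_n` converge in the Gromov–Hausdorff distance to the circle
`ℝ/2ℤ` of circumference 2 (with its quotient metric). -/
theorem roughly_transitive_scaling_limit_circle
    (C K : ℝ) (hC : 1 ≤ C) (hK : 0 ≤ K) :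
    ∃ δ : ℝ, 1 < δ ∧
      ∀ (V : ℕ → Type) (G : ∀ n, SimpleGraph (V n)) (_ : ∀ n, Fintype (V n)),
        (∀ n, (G n).Connected) →
        (∀ n, RoughlyTransitive C K (fun u v : V n => ((G n).dist u v : ℝ))) →
        Tendsto (fun n => Nat.card (V n)) atTop atTop →
        (∃ A : ℝ, 0 < A ∧ ∀ n, (Nat.card (V n) : ℝ) ≤ A * ((G n).diam : ℝ) ^ δ) →
        GHConvergesTo V
          (fun n u v => ((G n).dist u v : ℝ) / ((G n).diam : ℝ))
          (fun x y : AddCircle (2 : ℝ) => dist x y) := by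

  obtain ⟨Cn, hCn⟩ : ∃ c, c = ⌈C⌉₊ := ⟨_, rfl⟩
  obtain ⟨Kn, hKn⟩ : ∃ c, c = ⌈K⌉₊ := ⟨_, rfl⟩
  have hCn1 : 1 ≤ Cn := by
    rw [hCn]; exact Nat.one_le_iff_ne_zero.2 (by simp; linarith)
  obtain ⟨N, hN⟩ : ∃ N, N = 10000 * Cn ^ 6 := ⟨_, rfl⟩
  have hN1 : 1 ≤ N := by
    rw [hN]; have : 0 < Cn ^ 6 := by positivity
    omega
  obtain ⟨M, hM⟩ : ∃ M, M = 40 * N := ⟨_, rfl⟩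
  have hM1 : 1 < M := by omega
  have hM1r : (1 : ℝ) < M := by exact_mod_cast hM1
  have hlog : 1 < Real.logb M ((M : ℝ) + 1) := by
    rw [Real.lt_logb_iff_rpow_lt hM1r (by linarith), Real.rpow_one]
    linarith
  obtain ⟨δ, hδ1, hδ2⟩ := exists_between hlog
  rw [Real.lt_logb_iff_rpow_lt hM1r (by linarith)] at hδ2
  refine ⟨δ, hδ1, ?_⟩
  intro V G hF hconn hRT hcard hA ε hε
  obtain ⟨A, hA, hAn⟩ := hA
  obtain ⟨l, hl⟩ : ∃ l, l = max 3 Kn := ⟨_, rfl⟩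
  have hl3 : 3 ≤ l := hl ▸ le_max_left _ _
  have hlK : Kn ≤ l := hl ▸ le_max_right _ _
  obtain ⟨κ, hκ⟩ : ∃ κ, κ = 9000 * Cn ^ 5 := ⟨_, rfl⟩
  have hκ1 : 1 ≤ κ := by
    rw [hκ]; have : 0 < Cn ^ 5 := by positivity
    omega
  obtain ⟨J, hJ⟩ := pow_unbounded_of_one_lt (max (10 * κ : ℝ) (10 * κ / ε)) hM1r
  have hJ1 : 10 * κ ≤ M ^ J := by
    have := (le_max_left (10 * κ : ℝ) (10 * κ / ε)).trans hJ.le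
    exact_mod_cast this
  have hJ2 : (10 * κ : ℝ) < ε * M ^ J := by
    have := (le_max_right (10 * κ : ℝ) (10 * κ / ε)).trans_lt hJ
    rw [div_lt_iff₀ hε] at this
    linarith
  obtain ⟨k₀, -, hk₀⟩ := exists_k0 (J := J) hA hM1 hl3 hδ2
  obtain ⟨B, hB⟩ := exists_nat_gt (A * ((l * M ^ (k₀ + J) : ℕ) : ℝ) ^ δ)
  obtain ⟨N₀, hN₀⟩ := eventually_atTop.1 (hcard.eventually_ge_atTop B)
  refine ⟨N₀, fun n hn => ?_⟩
  haveI := hF n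
  haveI := (hconn n).nonempty
  have hBn : B ≤ Nat.card (V n) := hN₀ n hn
  have hcn := hAn n
  have hne : (G n).ediam ≠ ⊤ := SimpleGraph.connected_iff_ediam_ne_top.1 (hconn n)
  have hDle : ∀ x y, (G n).dist x y ≤ (G n).diam := fun x y => SimpleGraph.dist_le_diam hne
  obtain ⟨o, y, hoy⟩ := (G n).exists_dist_eq_diam
  generalize hDd : (G n).diam = D at *
  have hD : l * M ^ (k₀ + J) ≤ D := by
    by_contra hlt
    push Not at hlt
    have h1 : (D : ℝ) ^ δ ≤ ((l * M ^ (k₀ + J) : ℕ) : ℝ) ^ δ :=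
      Real.rpow_le_rpow (by positivity) (by exact_mod_cast hlt.le) (by linarith)
    have h2 : (B : ℝ) ≤ Nat.card (V n) := by exact_mod_cast hBn
    have h3 := mul_le_mul_of_nonneg_left h1 hA.le
    linarith
  subst hM
  obtain ⟨j, hj1, hj2⟩ := exists_scale (hconn n) hA (by linarith) hN1 hl3 hk₀ o y hoy hD hcn
  have hnrt := nrt_of_roughlyTransitive hC hK (hRT n)
  rw [← hCn, ← hKn] at hnrt
  have hjl : l ≤ (40 * N) ^ j * l := Nat.le_mul_of_pos_left l (by positivity)
  generalize (40 * N) ^ j * l = m at *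
  rw [hN] at hj2
  obtain ⟨hNT, hTS⟩ := local_structure (hconn n) hCn1 (by omega) (by omega) hnrt hj2
  rw [← hκ] at hNT hTS
  have hu1 : 1 ≤ 40 * Cn ^ 3 * m := by
    have : 0 < m := by omega
    have : 0 < 40 * Cn ^ 3 * m := by positivity
    omega
  have hR1 : 1 ≤ κ * m := Nat.mul_pos hκ1 (by omega)
  have hRD : 10 * (κ * m) ≤ D := by
    calc 10 * (κ * m) = m * (10 * κ) := by ring
      _ ≤ m * (40 * N) ^ J := Nat.mul_le_mul_left m hJ1
      _ ≤ D := hj1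
  obtain ⟨f, hf1, hf2⟩ := circle_map (hconn n) hu1 hNT hTS hDle o y hoy hRD hR1
  have hDpos : (0 : ℝ) < D := by exact_mod_cast (by omega : 0 < D)
  have hm0 : (0 : ℝ) < m := by exact_mod_cast (by omega : 0 < m)
  have hlt : 10 * ((κ * m : ℕ) : ℝ) / D < ε := by
    rw [div_lt_iff₀ hDpos]
    have h1 : (m : ℝ) * ((40 * N : ℕ) : ℝ) ^ J ≤ D := by exact_mod_cast hj1
    push_cast at *
    nlinarith
  exact ⟨f, fun Y => (hf1 Y).imp fun v hv => lt_of_le_of_lt hv hlt,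
    fun z z' => by
      have := lt_of_le_of_lt (hf2 z z') hlt
      simp only [hDd]
      exact this⟩
end

section
/- Let (X_n) be a sequence of finite connected vertex-transitive graphs with |X_n| → ∞ and |X_n|/diam(X_n)^{2 − 1/log₃4} → 0. Then the rescaled spaces X'_n converge in Gromov–Hausdorff distance to the circle ℝ/2ℤ equipped with its quotient metric (the circle of circumference 2). -/
open Filter

namespace CircleLimit

open SimpleGraph

variable {V : Type} {G : SimpleGraph V}

/-- Sum of an edge function along a walk. -/
def ws (c : V → V → ℤ) : {u v : V} → G.Walk u v → ℤ
  | _, _, .nil => 0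
  | _, _, .cons (u := u) (v := v) _ p => c u v + ws c p

@[simp] lemma ws_nil (c : V → V → ℤ) (u : V) : ws c (Walk.nil : G.Walk u u) = 0 := rfl

@[simp] lemma ws_cons (c : V → V → ℤ) {u v w : V} (h : G.Adj u v) (p : G.Walk v w) :
    ws c (Walk.cons h p) = c u v + ws c p := rfl

lemma ws_append (c : V → V → ℤ) {u v w : V} (p : G.Walk u v) (q : G.Walk v w) :
    ws c (p.append q) = ws c p + ws c q := by
  induction p with
  | nil => simp
  | cons h p ih => simp [ih, add_assoc]

lemma ws_reverse (c : V → V → ℤ) (hc : ∀ u v, c v u = - c u v) {u v : V} (p : G.Walk u v) :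
    ws c p.reverse = - ws c p := by
  induction p with
  | nil => simp
  | @cons a b d h p ih =>
    rw [Walk.reverse_cons, ws_append, ih]
    simp [hc a b]

lemma split_walk (c : V → V → ℤ) {u v : V} (w : G.Walk u v) (i : ℕ) (hi : i ≤ w.length) :
    ∃ (a : G.Walk u (w.getVert i)) (b : G.Walk (w.getVert i) v),
      a.length = i ∧ b.length = w.length - i ∧ ws c a + ws c b = ws c w ∧
      ∀ m, b.getVert m = w.getVert (i + m) := by
  induction w generalizing i with
  | nil =>
    simp at hi
    subst hi
    exact ⟨Walk.nil, Walk.nil, by simp⟩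
  | @cons x y z h p ih =>
    cases i with
    | zero =>
      exact ⟨Walk.nil, Walk.cons h p, rfl, rfl, zero_add _, fun m => by rw [Nat.zero_add]; rfl⟩
    | succ i =>
      obtain ⟨a, b, h1, h2, h3, h4⟩ := ih i (by simpa using hi)
      refine ⟨Walk.cons h a, b, ?_, ?_, ?_, ?_⟩
      · simp [h1]
      · simp [h2]
      · simp [← h3, add_assoc]
      · intro m
        have e : i + 1 + m = (i + m) + 1 := by ring
        rw [e]
        exact h4 m

lemma split_walk3 (c : V → V → ℤ) {u v : V} (w : G.Walk u v) (i j : ℕ) (hij : i ≤ j)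
    (hj : j ≤ w.length) :
    ∃ (a : G.Walk u (w.getVert i)) (b : G.Walk (w.getVert i) (w.getVert j))
      (d : G.Walk (w.getVert j) v),
      a.length = i ∧ b.length = j - i ∧ d.length = w.length - j ∧
      ws c a + ws c b + ws c d = ws c w := by
  obtain ⟨a, b, h1, h2, h3, h4⟩ := split_walk c w i (hij.trans hj)
  obtain ⟨e, f, g1, g2, g3, g4⟩ := split_walk c b (j - i) (by omega)
  have hv : b.getVert (j - i) = w.getVert j := by rw [h4]; congr 1; omega
  have key : ∃ (e : G.Walk (w.getVert i) (w.getVert j)) (f : G.Walk (w.getVert j) v),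
      e.length = j - i ∧ f.length = b.length - (j - i) ∧ ws c e + ws c f = ws c b := by
    rw [← hv]
    exact ⟨e, f, g1, g2, g3⟩
  obtain ⟨e, f, g1, g2, g3⟩ := key
  exact ⟨a, e, f, h1, g1, by omega, by omega⟩

/-- A geodesic parametrised by naturals. -/
lemma exists_geodesic (hG : G.Connected) (o o' : V) :
    ∃ γ : ℕ → V, γ 0 = o ∧ γ (G.dist o o') = o' ∧
      (∀ i < G.dist o o', G.Adj (γ i) (γ (i+1))) ∧
      ∀ i j, i ≤ j → j ≤ G.dist o o' → G.dist (γ i) (γ j) = j - i := by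
  obtain ⟨w, hw⟩ := hG.exists_walk_length_eq_dist o o'
  refine ⟨w.getVert, by simp, by rw [← hw]; simp, fun i hi => w.adj_getVert_succ (by omega), ?_⟩
  intro i j hij hj
  obtain ⟨a, b, d, h1, h2, h3, -⟩ := split_walk3 (fun _ _ => 0) w i j hij (by omega)
  have ha := dist_le a
  have hb := dist_le b
  have hd := dist_le d
  have t1 := hG.dist_triangle (u := o) (v := w.getVert i) (w := o')
  have t2 := hG.dist_triangle (u := w.getVert i) (v := w.getVert j) (w := o')
  omega

/-- A shortest closed walk of nonzero class is an isometrically embedded cycle. -/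
lemma exists_geodesic_cycle (hG : G.Connected) (c : V → V → ℤ) (hc : ∀ u v, c v u = - c u v)
    (T : ℕ) (hT : ∀ (v : V) (w : G.Walk v v), w.length ≤ T → ws c w = 0)
    (v₀ : V) (w₀ : G.Walk v₀ v₀) (hw₀ : ws c w₀ ≠ 0) :
    ∃ (L : ℕ) (p : ℕ → V), T < L ∧
      ∀ i j, i ≤ j → j ≤ L → G.dist (p i) (p j) = min (j - i) (L - (j - i)) := by
  classical
  have hex : ∃ L, ∃ (v : V) (w : G.Walk v v), w.length = L ∧ ws c w ≠ 0 :=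
    ⟨_, v₀, w₀, rfl, hw₀⟩
  obtain ⟨v, w, hwL, hw⟩ := Nat.find_spec hex
  set L := Nat.find hex with hL
  have hmin : ∀ (v : V) (w : G.Walk v v), w.length < L → ws c w = 0 := by
    intro v w h
    by_contra hne
    exact Nat.find_min hex h ⟨v, w, rfl, hne⟩
  refine ⟨L, w.getVert, ?_, ?_⟩
  · by_contra hle
    exact hw (hT v w (by omega))
  · intro i j hij hj
    obtain ⟨a, b, d, h1, h2, h3, h4⟩ := split_walk3 c w i j hij (by omega)
    have hb := dist_le b
    have hda := dist_le (d.append a)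
    rw [Walk.length_append, dist_comm] at hda
    obtain ⟨q, hq⟩ := hG.exists_walk_length_eq_dist (w.getVert i) (w.getVert j)
    by_contra hne
    have e1 := hmin _ (b.append q.reverse) (by
      rw [Walk.length_append, Walk.length_reverse]; omega)
    have e2 := hmin _ ((d.append a).append q) (by
      rw [Walk.length_append, Walk.length_append]; omega)
    rw [ws_append, ws_reverse c hc] at e1
    rw [ws_append, ws_append] at e2
    apply hw
    omega

/-! ### The separation argument -/

/-- The graph with the closed ball of radius `δ` around `x` deleted (made isolated). -/
def del (G : SimpleGraph V) (δ : ℕ) (x : V) : SimpleGraph V where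
  Adj u v := G.Adj u v ∧ δ < G.dist x u ∧ δ < G.dist x v
  symm := ⟨fun _ _ h => ⟨h.1.symm, h.2.2, h.2.1⟩⟩
  loopless := ⟨fun _ h => G.loopless.irrefl _ h.1⟩

lemma iso_dist (hG : G.Connected) (φ : G ≃g G) (u v : V) : G.dist (φ u) (φ v) = G.dist u v := by
  have key : ∀ (ψ : G ≃g G) (u v : V), G.dist (ψ u) (ψ v) ≤ G.dist u v := by
    intro ψ u v
    obtain ⟨w, hw⟩ := hG.exists_walk_length_eq_dist u v
    have := dist_le (w.map ψ.toHom)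
    rw [Walk.length_map, hw] at this
    exact this
  apply le_antisymm (key φ u v)
  have := key φ.symm (φ u) (φ v)
  simpa using this

lemma del_reach_map (hG : G.Connected) (δ : ℕ) (φ : G ≃g G) (x u v : V)
    (h : (del G δ x).Reachable u v) : (del G δ (φ x)).Reachable (φ u) (φ v) := by
  obtain ⟨w⟩ := h
  induction w with
  | nil => exact Reachable.refl _
  | @cons a b d hab p ih =>
    refine Reachable.trans (Adj.reachable ?_) ih
    refine ⟨φ.map_adj_iff.2 hab.1, ?_, ?_⟩
    · rw [iso_dist hG]; exact hab.2.1
    · rw [iso_dist hG]; exact hab.2.2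

lemma adj_dist (hG : G.Connected) (o : V) {u v : V} (h : G.Adj u v) :
    G.dist o v ≤ G.dist o u + 1 := by
  have := hG.dist_triangle (u := o) (v := u) (w := v)
  rw [dist_eq_one_iff_adj.2 h] at this
  exact this

lemma del_ball (hG : G.Connected) (δ : ℕ) (x a : V) (hxa : 2 * δ < G.dist x a) :
    ∀ n u, G.dist a u = n → n ≤ δ → (del G δ x).Reachable u a := by
  intro n
  induction n with
  | zero =>
    intro u hu _
    rw [hG.dist_eq_zero_iff] at hu
    subst hu
    exact Reachable.refl _
  | succ n ih =>
    intro u hu hn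
    obtain ⟨γ, h0, h1, hadj, hd⟩ := exists_geodesic hG a u
    have hγ : G.dist a (γ n) = n := by
      have := hd 0 n (by omega) (by omega)
      rw [h0] at this; omega
    refine Reachable.trans (Adj.reachable ?_) (ih (γ n) hγ (by omega))
    have hA := hadj n (by omega)
    rw [← hu, h1] at hA
    have t1 := hG.dist_triangle (u := x) (v := γ n) (w := a)
    have t2 := hG.dist_triangle (u := x) (v := u) (w := a)
    rw [dist_comm (v := a)] at t1 t2
    rw [dist_comm (u := γ n), hγ] at t1
    rw [dist_comm (u := u), hu] at t2
    rw [dist_comm (u := a)] at t1 t2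
    exact ⟨hA.symm, by omega, by omega⟩

lemma del_cover (hG : G.Connected) (δ : ℕ) (x a : V) (hxa : 2 * δ < G.dist x a) (u : V) :
    (del G δ x).Reachable u a ∨ (del G δ a).Reachable u x := by
  have hax : 2 * δ < G.dist a x := by rwa [dist_comm]
  have key : ∀ (u v : V) (_ : G.Walk u v), ((del G δ x).Reachable u a ∨ (del G δ a).Reachable u x)
      → ((del G δ x).Reachable v a ∨ (del G δ a).Reachable v x) := by
    intro u v w
    induction w with
    | nil => exact id
    | @cons u u' d h p ih =>
      intro hu
      apply ih
      by_cases ha' : G.dist a u' ≤ δ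
      · exact Or.inl (del_ball hG δ x a hxa _ u' rfl ha')
      by_cases hx' : G.dist x u' ≤ δ
      · exact Or.inr (del_ball hG δ a x hax _ u' rfl hx')
      push Not at ha' hx'
      have tr : ∀ z, G.dist x a ≤ G.dist x z + G.dist a z := by
        intro z
        have := hG.dist_triangle (u := x) (v := z) (w := a)
        rwa [dist_comm (u := z)] at this
      by_cases ha : G.dist a u ≤ δ
      · left
        refine Reachable.trans (Adj.reachable ?_) (del_ball hG δ x a hxa _ u rfl ha)
        have := tr u
        exact ⟨h.symm, hx', by omega⟩
      by_cases hx : G.dist x u ≤ δ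
      · right
        refine Reachable.trans (Adj.reachable ?_) (del_ball hG δ a x hax _ u rfl hx)
        have := tr u
        exact ⟨h.symm, ha', by omega⟩
      push Not at ha hx
      rcases hu with hu | hu
      · left
        refine Reachable.trans (Adj.reachable ?_) hu
        exact ⟨h.symm, hx', hx⟩
      · right
        refine Reachable.trans (Adj.reachable ?_) hu
        exact ⟨h.symm, ha', ha⟩
  obtain ⟨w⟩ := hG.preconnected a u
  exact key a u w (Or.inl (Reachable.refl _))

lemma no_separation [Finite V] (hG : G.Connected)
    (htrans : ∀ u v : V, ∃ φ : G ≃g G, φ u = v) (δ : ℕ) (x₀ b₁ b₂ : V)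
    (h1 : 2 * δ < G.dist x₀ b₁) (h2 : 2 * δ < G.dist x₀ b₂) :
    (del G δ x₀).Reachable b₁ b₂ := by
  by_contra hnot
  have hall : ∀ x, ∃ b₁ b₂, 2 * δ < G.dist x b₁ ∧ 2 * δ < G.dist x b₂ ∧
      ¬ (del G δ x).Reachable b₁ b₂ := by
    intro x
    obtain ⟨φ, hφ⟩ := htrans x₀ x
    refine ⟨φ b₁, φ b₂, ?_, ?_, ?_⟩
    · rw [← hφ, iso_dist hG]; exact h1
    · rw [← hφ, iso_dist hG]; exact h2
    · intro h
      apply hnot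
      have := del_reach_map hG δ φ.symm _ _ _ h
      rw [← hφ] at this
      simpa using this
  have key : ∀ n x a, 2 * δ < G.dist x a → {u | (del G δ x).Reachable u a}.ncard = n → False := by
    intro n
    induction n using Nat.strong_induction_on with
    | _ n ih =>
      intro x a hxa hn
      obtain ⟨c₁, c₂, k1, k2, k3⟩ := hall a
      have hb : ∃ b, 2 * δ < G.dist a b ∧ ¬ (del G δ a).Reachable b x := by
        by_cases hc : (del G δ a).Reachable c₁ x
        · exact ⟨c₂, k2, fun h => k3 (hc.trans h.symm)⟩
        · exact ⟨c₁, k1, hc⟩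
      obtain ⟨b, hb1, hb2⟩ := hb
      refine ih _ ?_ a b hb1 rfl
      rw [← hn]
      apply Set.ncard_lt_ncard _ (Set.toFinite _)
      refine ⟨?_, ?_⟩
      · intro u hu
        rcases del_cover hG δ x a hxa u with h | h
        · exact h
        · exact absurd (hu.symm.trans h) hb2
      · intro hsub
        have hab : (del G δ a).Reachable a b := hsub (Reachable.refl a)
        obtain ⟨w⟩ := hab
        cases w with
        | nil => simp at hb1
        | cons h p => have := h.2.1; simp at this
  exact key _ x₀ b₁ h1 rfl


/-! ### The cocycle attached to a local cut -/

open Classical in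
/-- Signed crossings of the part near `x` of the cut between levels `r` and `r+1` from `o`. -/
noncomputable def coc (G : SimpleGraph V) (o x : V) (r δ : ℕ) (u v : V) : ℤ :=
  (if G.dist o u = r ∧ G.dist o v = r + 1 ∧ G.dist x u ≤ δ then 1 else 0) -
  (if G.dist o v = r ∧ G.dist o u = r + 1 ∧ G.dist x v ≤ δ then 1 else 0)

lemma coc_anti (o x : V) (r δ : ℕ) (u v : V) : coc G o x r δ v u = - coc G o x r δ u v := by
  unfold coc; ring

lemma coc_far (o x : V) (r δ : ℕ) {u v : V} (hu : δ < G.dist x u) (hv : δ < G.dist x v) :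
    coc G o x r δ u v = 0 := by
  unfold coc
  rw [if_neg (by omega), if_neg (by omega)]; rfl

lemma coc_low (o x : V) (r δ : ℕ) {u v : V} (hu : G.dist o u ≤ r) (hv : G.dist o v ≤ r) :
    coc G o x r δ u v = 0 := by
  unfold coc
  rw [if_neg (by omega), if_neg (by omega)]; rfl

lemma coc_high (o x : V) (r δ : ℕ) {u v : V} (hu : r < G.dist o u) (hv : r < G.dist o v) :
    coc G o x r δ u v = 0 := by
  unfold coc
  rw [if_neg (by omega), if_neg (by omega)]; rfl

lemma ws_far (hG : G.Connected) (o x : V) (r δ : ℕ) {u v : V} (w : G.Walk u v)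
    (h : δ + w.length < G.dist x u) : ws (coc G o x r δ) w = 0 := by
  induction w with
  | nil => rfl
  | @cons a b d hab p ih =>
    rw [Walk.length_cons] at h
    have := adj_dist hG x hab.symm
    rw [ws_cons, ih (by omega), coc_far o x r δ (by omega) (by omega)]; rfl

lemma ws_low (hG : G.Connected) (o x : V) (r δ : ℕ) {u v : V} (w : G.Walk u v)
    (h : G.dist o u + w.length ≤ r) : ws (coc G o x r δ) w = 0 := by
  induction w with
  | nil => rfl
  | @cons a b d hab p ih =>
    rw [Walk.length_cons] at h
    have := adj_dist hG o hab
    rw [ws_cons, ih (by omega), coc_low o x r δ (by omega) (by omega)]; rfl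

lemma ws_high (hG : G.Connected) (o x : V) (r δ : ℕ) {u v : V} (w : G.Walk u v)
    (h : r + w.length < G.dist o u) : ws (coc G o x r δ) w = 0 := by
  induction w with
  | nil => rfl
  | @cons a b d hab p ih =>
    rw [Walk.length_cons] at h
    have := adj_dist hG o hab.symm
    rw [ws_cons, ih (by omega), coc_high o x r δ (by omega) (by omega)]; rfl

lemma ws_near (hG : G.Connected) (o x : V) (r δ M : ℕ)
    (hgap : ∀ u, G.dist o u = r → G.dist x u ≤ M → G.dist x u ≤ δ) {u v : V} (w : G.Walk u v)
    (h : G.dist x u + w.length ≤ M) : ws (coc G o x r δ) w =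
      (if r < G.dist o v then 1 else 0) - (if r < G.dist o u then 1 else 0) := by
  induction w with
  | nil => simp
  | @cons a b d hab p ih =>
    rw [Walk.length_cons] at h
    have h1 := adj_dist hG x hab
    have h2 := adj_dist hG o hab
    have h3 := adj_dist hG o hab.symm
    have ga := hgap a
    have gb := hgap b
    rw [ws_cons, ih (by omega)]
    unfold coc
    split_ifs <;> omega

lemma del_walk_ws (o x : V) (r δ : ℕ) {u v : V} (w : (del G δ x).Walk u v) :
    ∃ p : G.Walk u v, ws (coc G o x r δ) p = 0 := by
  induction w with
  | nil => exact ⟨Walk.nil, rfl⟩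
  | @cons a b d hab p ih =>
    obtain ⟨q, hq⟩ := ih
    exact ⟨Walk.cons hab.1 q, by rw [ws_cons, hq, coc_far o x r δ hab.2.1 hab.2.2]; rfl⟩

/-- Long geodesic cycles from a local cut with a gap. -/
lemma cycle_of_gap [Finite V] (hG : G.Connected)
    (htrans : ∀ u v : V, ∃ φ : G ≃g G, φ u = v) (o o' x y : V) (r δ T : ℕ)
    (hr : r < G.dist o o') (hx : G.dist o x = r) (hy : G.dist o y = r + 1) (hxy : G.Adj x y)
    (hyo : G.dist y o' = G.dist o o' - (r + 1))
    (hgap : ∀ u, G.dist o u = r → G.dist x u ≤ δ + 2 * T → G.dist x u ≤ δ)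
    (h1 : 2 * δ < G.dist x o) (h2 : 2 * δ < G.dist x o') :
    ∃ (L : ℕ) (p : ℕ → V), T < L ∧
      ∀ i j, i ≤ j → j ≤ L → G.dist (p i) (p j) = min (j - i) (L - (j - i)) := by
  obtain ⟨w⟩ := no_separation hG htrans δ x o' o h2 h1
  obtain ⟨p, hp⟩ := del_walk_ws o x r δ w
  obtain ⟨a, ha⟩ := hG.exists_walk_length_eq_dist o x
  obtain ⟨b, hb⟩ := hG.exists_walk_length_eq_dist o' y
  refine exists_geodesic_cycle hG (coc G o x r δ) (coc_anti o x r δ) T ?_ o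
    (a.append (Walk.cons hxy (b.reverse.append p))) ?_
  · intro v w hw
    by_cases hv : G.dist x v ≤ δ + T
    · rw [ws_near hG o x r δ (δ + 2 * T) hgap w (by omega)]; simp
    · exact ws_far hG o x r δ w (by omega)
  · rw [ws_append, ws_cons, ws_append, ws_reverse _ (coc_anti o x r δ), hp,
      ws_low hG o x r δ a (by rw [dist_self]; omega),
      ws_high hG o x r δ b (by rw [hb, dist_comm, hyo]; omega)]
    unfold coc
    rw [if_pos ⟨hx, hy, by simp⟩, if_neg (by omega)]
    norm_num

lemma exists_level [Fintype V] (o : V) (q : ℕ) (hq : 0 < q) :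
    ∃ r, q ≤ r ∧ r < 2 * q ∧ q * {u | G.dist o u = r}.ncard ≤ Fintype.card V := by
  classical
  have := Finset.exists_card_fiber_le_of_card_le_nsmul (s := (Finset.univ : Finset V))
    (t := Finset.Ico q (2 * q)) (f := fun u => G.dist o u) (b := (Fintype.card V : ℚ) / q)
    (by rw [Finset.nonempty_Ico]; omega) (by
      have : (q : ℚ) ≠ 0 := by positivity
      simp only [Finset.card_univ, Nat.card_Ico, nsmul_eq_mul]
      rw [show 2 * q - q = q by omega]
      field_simp; rfl)
  obtain ⟨r, hr, h⟩ := this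
  rw [Finset.mem_Ico] at hr
  refine ⟨r, hr.1, hr.2, ?_⟩
  have hq' : (0 : ℚ) < q := by positivity
  rw [le_div_iff₀ hq'] at h
  have e : {u | G.dist o u = r}.ncard = (Finset.univ.filter (fun u => G.dist o u = r)).card := by
    rw [← Set.ncard_coe_finset]; simp
  rw [e, mul_comm]
  exact_mod_cast h

lemma exists_gap [Finite V] (S : Set V) (f : V → ℕ) (M : ℕ) :
    ∃ j ≤ S.ncard, ∀ u ∈ S, f u ≤ M * j + M → f u ≤ M * j := by
  by_contra hne
  push Not at hne
  obtain ⟨u₀, -⟩ := hne 0 (Nat.zero_le _)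
  have : Nonempty V := ⟨u₀⟩
  choose! g hg1 hg2 hg3 using hne
  have hinj : Set.InjOn g (Set.Iic S.ncard) := by
    intro i hi j hj hij
    have a1 := hg2 i hi
    have a2 := hg3 i hi
    have b1 := hg2 j hj
    have b2 := hg3 j hj
    rw [hij] at a1 a2
    by_contra hne
    rcases lt_or_gt_of_ne hne with h | h
    · have : M * (i + 1) ≤ M * j := Nat.mul_le_mul_left _ h
      rw [mul_add] at this; omega
    · have : M * (j + 1) ≤ M * i := Nat.mul_le_mul_left _ h
      rw [mul_add] at this; omega
  have h1 : (g '' Set.Iic S.ncard).ncard ≤ S.ncard :=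
    Set.ncard_le_ncard (by rintro _ ⟨i, hi, rfl⟩; exact hg1 i hi) (Set.toFinite _)
  rw [Set.InjOn.ncard_image hinj] at h1
  have h2 : (Set.Iic S.ncard).ncard = S.ncard + 1 := by
    rw [← Finset.coe_Iic, Set.ncard_coe_finset, Nat.card_Iic]
  omega

lemma long_cycle [Fintype V] (hG : G.Connected)
    (htrans : ∀ u v : V, ∃ φ : G ≃g G, φ u = v) (o o' : V) (q T : ℕ)
    (hq : 4 * q ≤ G.dist o o') (hT : 4 * T * Fintype.card V < q * q) :
    ∃ (L : ℕ) (p : ℕ → V), T < L ∧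
      ∀ i j, i ≤ j → j ≤ L → G.dist (p i) (p j) = min (j - i) (L - (j - i)) := by
  have hq0 : 0 < q := by
    rcases Nat.eq_zero_or_pos q with h | h
    · subst h; simp at hT
    · exact h
  obtain ⟨r, hr1, hr2, hr3⟩ := exists_level (G := G) o q hq0
  set S := {u | G.dist o u = r} with hS
  obtain ⟨γ, g0, g1, gadj, gd⟩ := exists_geodesic hG o o'
  obtain ⟨j, hj, hgap⟩ := exists_gap S (fun u => G.dist (γ r) u) (2 * T)
  have hδ : 2 * (2 * T * j) < q := by
    have h1 : 4 * T * S.ncard * q < q * q := by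
      calc 4 * T * S.ncard * q = 4 * T * (q * S.ncard) := by ring
        _ ≤ 4 * T * Fintype.card V := Nat.mul_le_mul_left _ hr3
        _ < _ := hT
    have h2 := lt_of_mul_lt_mul_right h1 (Nat.zero_le _)
    have h3 : 4 * T * j ≤ 4 * T * S.ncard := Nat.mul_le_mul_left _ hj
    have h4 : 2 * (2 * T * j) = 4 * T * j := by ring
    omega
  have d1 := gd 0 r (by omega) (by omega)
  have d2 := gd 0 (r + 1) (by omega) (by omega)
  have d3 := gd (r + 1) (G.dist o o') (by omega) (by omega)
  have d4 := gd r (G.dist o o') (by omega) (by omega)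
  rw [g0] at d1 d2
  rw [g1] at d3 d4
  refine cycle_of_gap hG htrans o o' (γ r) (γ (r + 1)) r (2 * T * j) T (by omega) d1 d2
    (gadj r (by omega)) d3 (fun u hu h => hgap u hu h) ?_ ?_
  · rw [dist_comm]; omega
  · omega

/-! ### Packing -/

lemma packing [Fintype V] (hG : G.Connected)
    (htrans : ∀ u v : V, ∃ φ : G ≃g G, φ u = v) (x : V) (s : ℕ) {ι : Type} (t : Finset ι)
    (y : ι → V) (hy : ∀ i ∈ t, ∀ j ∈ t, i ≠ j → 2 * s + 1 ≤ G.dist (y i) (y j)) (B : Set V)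
    (hB : ∀ i ∈ t, ∀ u, G.dist (y i) u ≤ s → u ∈ B) :
    t.card * {u | G.dist x u ≤ s}.ncard ≤ B.ncard := by
  classical
  have hball : ∀ z, {u | G.dist z u ≤ s}.ncard = {u | G.dist x u ≤ s}.ncard := by
    intro z
    obtain ⟨φ, hφ⟩ := htrans x z
    rw [← Set.ncard_image_of_injective {u | G.dist x u ≤ s} φ.injective]
    congr 1
    ext u
    constructor
    · intro hu
      refine ⟨φ.symm u, ?_, by simp⟩
      have := iso_dist hG φ x (φ.symm u)
      rw [hφ] at this
      simp at this hu ⊢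
      omega
    · rintro ⟨v, hv, rfl⟩
      have := iso_dist hG φ x v
      rw [hφ] at this
      simp at hv ⊢
      omega
  have e : ∀ z, {u | G.dist z u ≤ s}.ncard
      = (Finset.univ.filter (fun u => G.dist z u ≤ s)).card := by
    intro z
    rw [← Set.ncard_coe_finset]; simp
  have hsub : ((t.biUnion fun i => Finset.univ.filter (fun u => G.dist (y i) u ≤ s)) : Set V) ⊆ B := by
    intro u hu
    simp at hu
    obtain ⟨i, hi, h⟩ := hu
    exact hB i hi u h
  have := Set.ncard_le_ncard hsub (Set.toFinite _)
  rw [Set.ncard_coe_finset, Finset.card_biUnion] at this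
  · rw [Finset.sum_congr rfl (fun i _ => (e (y i)).symm.trans (hball (y i))),
      Finset.sum_const, smul_eq_mul] at this
    exact this
  · intro i hi j hj hij
    show Disjoint _ _
    rw [Finset.disjoint_left]
    intro u hu hu'
    simp at hu hu'
    have h1 := hy i hi j hj hij
    have h2 := hG.dist_triangle (u := y i) (v := u) (w := y j)
    rw [dist_comm (u := u)] at h2
    omega

/-- If some vertex is far from the geodesic cycle then balls grow by a factor four. -/
lemma four_balls [Fintype V] (hG : G.Connected)
    (htrans : ∀ u v : V, ∃ φ : G ≃g G, φ u = v) (x : V) (s L : ℕ) (p : ℕ → V)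
    (hL : 3 * (2 * s + 1) ≤ L)
    (hp : ∀ i j, i ≤ j → j ≤ L → G.dist (p i) (p j) = min (j - i) (L - (j - i)))
    (z : V) (hz : ∀ i < L, 2 * s + 1 ≤ G.dist z (p i)) :
    4 * {u | G.dist x u ≤ s}.ncard ≤ {u | G.dist x u ≤ 3 * s + 1}.ncard := by
  classical
  have hz' : ∃ z', ∃ i < L, G.dist z' (p i) = 2 * s + 1 ∧ ∀ j < L, 2 * s + 1 ≤ G.dist z' (p j) := by
    have hne : (Finset.range L).Nonempty := by
      rw [Finset.nonempty_range_iff]; omega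
    obtain ⟨i, hi, hmin⟩ := Finset.exists_min_image (Finset.range L) (fun i => G.dist z (p i)) hne
    rw [Finset.mem_range] at hi
    have hmin' : ∀ j < L, G.dist z (p i) ≤ G.dist z (p j) := fun j hj =>
      hmin j (Finset.mem_range.2 hj)
    obtain ⟨γ, g0, g1, -, gd⟩ := exists_geodesic hG z (p i)
    have hzi := hz i hi
    have e1 := gd (G.dist z (p i) - (2 * s + 1)) (G.dist z (p i)) (by omega) le_rfl
    have e2 := gd 0 (G.dist z (p i) - (2 * s + 1)) (by omega) (by omega)
    rw [g1] at e1
    rw [g0] at e2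
    refine ⟨γ (G.dist z (p i) - (2 * s + 1)), i, hi, by omega, ?_⟩
    intro j hj
    have := hG.dist_triangle (u := z) (v := γ (G.dist z (p i) - (2 * s + 1))) (w := p j)
    have := hmin' j hj
    omega
  obtain ⟨z', i, hi, hzi, hzall⟩ := hz'
  have hp' : ∀ i j, i < L → j < L → ∀ a, (a = i - j ∨ a = j - i) → 2 * s + 1 ≤ a →
      a + (2 * s + 1) ≤ L → 2 * s + 1 ≤ G.dist (p i) (p j) := by
    intro i j hi hj a ha h1 h2
    rcases le_total i j with h | h
    · rw [hp i j h hj.le]; omega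
    · rw [dist_comm, hp j i h hi.le]; omega
  have hp'' : ∀ i j, i < L → j < L → ∀ a, (a = i - j ∨ a = j - i) → 0 < a →
      (a = 2 * s + 1 ∨ a + (2 * s + 1) = L) → G.dist (p i) (p j) ≤ 2 * s + 1 := by
    intro i j hi hj a ha h0 h1
    rcases le_total i j with h | h
    · rw [hp i j h hj.le]; omega
    · rw [dist_comm, hp j i h hi.le]; omega
  obtain ⟨m, hm, hm1⟩ : ∃ m < L, (m = i + (2 * s + 1) ∨ m + L = i + (2 * s + 1)) := by
    by_cases h : i + (2 * s + 1) < L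
    · exact ⟨_, h, Or.inl rfl⟩
    · exact ⟨i + (2 * s + 1) - L, by omega, by omega⟩
  obtain ⟨l, hl, hl1⟩ : ∃ l < L, (i = l + (2 * s + 1) ∨ i + L = l + (2 * s + 1)) := by
    by_cases h : 2 * s + 1 ≤ i
    · exact ⟨i - (2 * s + 1), by omega, by omega⟩
    · exact ⟨i + L - (2 * s + 1), by omega, by omega⟩
  have a1 : 2 * s + 1 ≤ G.dist (p i) (p m) := by
    rcases hm1 with h | h
    · exact hp' i m hi hm (m - i) (by omega) (by omega) (by omega)
    · exact hp' i m hi hm (i - m) (by omega) (by omega) (by omega)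
  have a2 : 2 * s + 1 ≤ G.dist (p i) (p l) := by
    rcases hl1 with h | h
    · exact hp' i l hi hl (i - l) (by omega) (by omega) (by omega)
    · exact hp' i l hi hl (l - i) (by omega) (by omega) (by omega)
  have a3 : 2 * s + 1 ≤ G.dist (p m) (p l) := by
    rcases le_total m l with h | h
    · exact hp' m l hm hl (l - m) (by omega) (by omega) (by omega)
    · exact hp' m l hm hl (m - l) (by omega) (by omega) (by omega)
  have b1 : G.dist (p i) (p m) ≤ 2 * s + 1 := by
    rcases hm1 with h | h
    · exact hp'' i m hi hm (m - i) (by omega) (by omega) (by omega)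
    · exact hp'' i m hi hm (i - m) (by omega) (by omega) (by omega)
  have b2 : G.dist (p i) (p l) ≤ 2 * s + 1 := by
    rcases hl1 with h | h
    · exact hp'' i l hi hl (i - l) (by omega) (by omega) (by omega)
    · exact hp'' i l hi hl (l - i) (by omega) (by omega) (by omega)
  have z1 := hzall i hi
  have z2 := hzall m hm
  have z3 := hzall l hl
  have hbig : {u | G.dist (p i) u ≤ 3 * s + 1}.ncard ≤ {u | G.dist x u ≤ 3 * s + 1}.ncard := by
    have := packing hG htrans (p i) (3 * s + 1) ({()} : Finset Unit) (fun _ => x) (by simp)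
      {u | G.dist x u ≤ 3 * s + 1} (fun _ _ u hu => hu)
    simpa using this
  refine le_trans ?_ hbig
  have := packing hG htrans x s (Finset.univ : Finset (Fin 4)) ![p i, p m, p l, z'] ?_
    {u | G.dist (p i) u ≤ 3 * s + 1} ?_
  · simpa using this
  · intro a _ b _ hab
    fin_cases a <;> fin_cases b <;> simp at hab ⊢ <;>
      first | omega | (rw [dist_comm]; omega)
  · intro a _ u hu
    have t := hG.dist_triangle (u := p i) (v := (![p i, p m, p l, z'] : Fin 4 → V) a) (w := u)
    have : G.dist (p i) ((![p i, p m, p l, z'] : Fin 4 → V) a) ≤ 2 * s + 1 := by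
      fin_cases a <;> simp
      · exact b1
      · exact b2
      · rw [dist_comm]; omega
    show G.dist (p i) u ≤ 3 * s + 1
    omega

/-- Radii `s` with `2 s + 1 = 3 ^ k`. -/
def rad : ℕ → ℕ
  | 0 => 0
  | k + 1 => 3 * rad k + 1

lemma rad_eq (k : ℕ) : 2 * rad k + 1 = 3 ^ k := by
  induction k with
  | zero => rfl
  | succ k ih => rw [rad, pow_succ, ← ih]; ring

/-- The finitary main theorem. -/
lemma main_finite [Fintype V] (hG : G.Connected)
    (htrans : ∀ u v : V, ∃ φ : G ≃g G, φ u = v) (o o' : V) (q k : ℕ)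
    (hq : 4 * q ≤ G.dist o o') (hT : 16 * 3 ^ k * Fintype.card V < q * q)
    (hvol : 3 ^ k * Fintype.card V < 4 ^ k * G.dist o o') :
    ∃ (L : ℕ) (p : ℕ → V), 4 * 3 ^ k < L ∧
      (∀ i j, i ≤ j → j ≤ L → G.dist (p i) (p j) = min (j - i) (L - (j - i))) ∧
      ∀ z, ∃ i < L, G.dist z (p i) < 3 ^ k := by
  obtain ⟨L, p, hL, hp⟩ := long_cycle hG htrans o o' q (4 * 3 ^ k) hq
    (by rw [← mul_assoc]; exact hT)
  refine ⟨L, p, hL, hp, ?_⟩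
  by_contra hne
  push Not at hne
  obtain ⟨z, hz⟩ := hne
  have hgrow : ∀ j ≤ k, 4 ^ j ≤ {u | G.dist o u ≤ rad j}.ncard := by
    intro j
    induction j with
    | zero =>
      intro _
      rw [pow_zero, Nat.one_le_iff_ne_zero, Ne, Set.ncard_eq_zero (Set.toFinite _)]
      intro h
      have : o ∈ {u | G.dist o u ≤ rad 0} := by simp
      rw [h] at this
      exact this
    | succ j ih =>
      intro hj
      have h1 := ih (by omega)
      have hpow : 3 ^ j ≤ 3 ^ k := Nat.pow_le_pow_right (by norm_num) (by omega)
      have h2 := four_balls hG htrans o (rad j) L p (by rw [rad_eq]; omega) hp z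
        (fun i hi => by rw [rad_eq]; exact hpow.trans (hz i hi))
      rw [rad, pow_succ]
      omega
  obtain ⟨γ, g0, g1, gadj, gd⟩ := exists_geodesic hG o o'
  have hpos : 0 < 3 ^ k := by positivity
  have hpack := packing hG htrans o (rad k) (Finset.range (G.dist o o' / 3 ^ k + 1))
    (fun i => γ (3 ^ k * i)) ?_ Set.univ (fun _ _ _ _ => Set.mem_univ _)
  · rw [Finset.card_range, Set.ncard_univ, Nat.card_eq_fintype_card] at hpack
    have h1 := hgrow k le_rfl
    have h2 : G.dist o o' ≤ 3 ^ k * (G.dist o o' / 3 ^ k + 1) := (Nat.lt_mul_div_succ _ hpos).le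
    have h3 : 4 ^ k * G.dist o o' ≤ 3 ^ k * Fintype.card V := by
      calc 4 ^ k * G.dist o o' ≤ 4 ^ k * (3 ^ k * (G.dist o o' / 3 ^ k + 1)) :=
            Nat.mul_le_mul_left _ h2
        _ = 3 ^ k * ((G.dist o o' / 3 ^ k + 1) * 4 ^ k) := by ring
        _ ≤ 3 ^ k * ((G.dist o o' / 3 ^ k + 1) * {u | G.dist o u ≤ rad k}.ncard) := by gcongr
        _ ≤ _ := Nat.mul_le_mul_left _ hpack
    omega
  · have key : ∀ i j, i < j → j < G.dist o o' / 3 ^ k + 1 →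
        2 * rad k + 1 ≤ G.dist (γ (3 ^ k * i)) (γ (3 ^ k * j)) := by
      intro i j hij hj
      have e1 : 3 ^ k * j ≤ G.dist o o' :=
        (Nat.mul_le_mul_left _ (Nat.lt_succ_iff.1 hj)).trans (Nat.mul_div_le _ _)
      have e2 : 3 ^ k * (i + 1) ≤ 3 ^ k * j := Nat.mul_le_mul_left _ hij
      rw [mul_add] at e2
      rw [gd _ _ (by omega) e1, rad_eq]
      omega
    intro i hi j hj hij
    rw [Finset.mem_range] at hi hj
    rcases lt_or_gt_of_ne hij with h | h
    · exact key i j h hj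
    · rw [dist_comm]; exact key j i h hi

/-! ### Passing to the circle -/

lemma circle_norm (x : ℝ) (h0 : 0 ≤ x) (h2 : x ≤ 2) :
    ‖(x : AddCircle (2 : ℝ))‖ = min x (2 - x) := by
  rcases le_total x 1 with h | h
  · rw [(AddCircle.norm_coe_eq_abs_iff (p := (2 : ℝ)) (x := x) (by norm_num)).2]
    · rw [abs_of_nonneg h0, min_eq_left (by linarith)]
    · rw [abs_of_nonneg h0]; norm_num; exact h
  · have e : (x : AddCircle (2 : ℝ)) = ((x - 2 : ℝ) : AddCircle (2 : ℝ)) := by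
      rw [AddCircle.coe_sub, AddCircle.coe_period, sub_zero]
    rw [e, (AddCircle.norm_coe_eq_abs_iff (p := (2 : ℝ)) (x := x - 2) (by norm_num)).2]
    · rw [abs_of_nonpos (by linarith), min_eq_right (by linarith)]; ring
    · rw [abs_of_nonpos (by linarith)]; norm_num; linarith

lemma circle_dist (L : ℕ) (p : ℕ → V)
    (hp : ∀ i j, i ≤ j → j ≤ L → G.dist (p i) (p j) = min (j - i) (L - (j - i)))
    (i j : ℕ) (hi : i < L) (hj : j < L) :
    dist ((2 * i / L : ℝ) : AddCircle (2 : ℝ)) ((2 * j / L : ℝ) : AddCircle (2 : ℝ)) =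
      2 / L * G.dist (p i) (p j) := by
  wlog h : j ≤ i generalizing i j
  · rw [_root_.dist_comm, this j i hj hi (by omega), SimpleGraph.dist_comm]
  have hL : (0 : ℝ) < L := by exact_mod_cast (by omega : 0 < L)
  have h' : (j : ℝ) ≤ i := by exact_mod_cast h
  have hi' : (i : ℝ) ≤ L := by exact_mod_cast hi.le
  have hj' : (0 : ℝ) ≤ j := by positivity
  rw [dist_eq_norm, ← AddCircle.coe_sub, SimpleGraph.dist_comm, hp j i h hi.le]
  have e : (2 * i / L - 2 * j / L : ℝ) = 2 / L * (i - j) := by ring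
  rw [e, circle_norm]
  · rw [Nat.cast_min, Nat.cast_sub (by omega : i - j ≤ L), Nat.cast_sub h,
      mul_min_of_nonneg _ _ (by positivity)]
    congr 1
    field_simp
  · exact mul_nonneg (by positivity) (by linarith)
  · rw [div_mul_eq_mul_div, div_le_iff₀ hL]; linarith

lemma gh_map [Fintype V] (hG : G.Connected) (D K L : ℕ) (p : ℕ → V) (ε : ℝ)
    (hK : 1 ≤ K) (hKD : 4 * K ≤ D) (hε : 8 * K < ε * D)
    (hD : ∀ u v, G.dist u v ≤ D) (hD' : ∃ u v, G.dist u v = D) (hL : 4 * K < L)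
    (hp : ∀ i j, i ≤ j → j ≤ L → G.dist (p i) (p j) = min (j - i) (L - (j - i)))
    (hcov : ∀ z, ∃ i < L, G.dist z (p i) < K) :
    ∃ f : V → AddCircle (2 : ℝ),
      (∀ y, ∃ v, dist (f v) y < ε) ∧
      (∀ u v, |dist (f u) (f v) - (G.dist u v : ℝ) / (D : ℝ)| < ε) := by
  choose ix hix hixd using hcov
  have hLD : L ≤ 2 * D + 1 := by
    have h1 := hD (p 0) (p (L / 2))
    rw [hp 0 (L / 2) (by omega) (by omega)] at h1
    omega
  have hpp : ∀ i j, i < L → j < L → 2 * G.dist (p i) (p j) ≤ L := by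
    intro i j hi hj
    rcases le_total i j with h | h
    · rw [hp i j h hj.le]; omega
    · rw [SimpleGraph.dist_comm, hp j i h hi.le]; omega
  have hclose : ∀ u v, G.dist u v ≤ G.dist (p (ix u)) (p (ix v)) + 2 * K ∧
      G.dist (p (ix u)) (p (ix v)) ≤ G.dist u v + 2 * K := by
    intro u v
    have t1 := hG.dist_triangle (u := u) (v := p (ix u)) (w := v)
    have t2 := hG.dist_triangle (u := p (ix u)) (v := p (ix v)) (w := v)
    have t3 := hG.dist_triangle (u := p (ix u)) (v := u) (w := p (ix v))
    have t4 := hG.dist_triangle (u := u) (v := v) (w := p (ix v))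
    rw [SimpleGraph.dist_comm (u := p (ix v)) (v := v)] at t2
    rw [SimpleGraph.dist_comm (u := p (ix u)) (v := u)] at t3
    have h1 := hixd u
    have h2 := hixd v
    omega
  have hDL : 2 * D ≤ L + 4 * K := by
    obtain ⟨u, v, huv⟩ := hD'
    have h1 := (hclose u v).1
    have h2 := hpp _ _ (hix u) (hix v)
    omega
  have hDpos : (0 : ℝ) < D := by exact_mod_cast (by omega : 0 < D)
  have hLpos : (0 : ℝ) < L := by exact_mod_cast (by omega : 0 < L)
  have rK : (1 : ℝ) ≤ K := by exact_mod_cast hK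
  have rLD : (L : ℝ) ≤ 2 * D + 1 := by exact_mod_cast hLD
  have rDL : 2 * (D : ℝ) ≤ L + 4 * K := by exact_mod_cast hDL
  have rL : (D : ℝ) ≤ L := by exact_mod_cast (by omega : D ≤ L)
  have hε0 : 0 < ε := by
    by_contra h
    push Not at h
    have := mul_nonpos_of_nonpos_of_nonneg h hDpos.le
    linarith
  have hεL : 8 * K < ε * L := hε.trans_le (mul_le_mul_of_nonneg_left rL hε0.le)
  refine ⟨fun v => ((2 * (ix v) / L : ℝ) : AddCircle (2 : ℝ)), ?_, ?_⟩
  · intro y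
    have : Fact ((0 : ℝ) < 2) := ⟨by norm_num⟩
    obtain ⟨t, ht, rfl⟩ : ∃ t : ℝ, t ∈ Set.Ico (0 : ℝ) (0 + 2) ∧ (t : AddCircle (2 : ℝ)) = y := by
      have := AddCircle.coe_image_Ico_eq (2 : ℝ) 0
      have hy : y ∈ (Set.univ : Set (AddCircle (2 : ℝ))) := trivial
      rw [← this] at hy
      exact hy
    rw [zero_add] at ht
    set i := ⌊t * L / 2⌋₊ with hidef
    have hnn : 0 ≤ t * L / 2 := by have := ht.1; positivity
    have f1 : (i : ℝ) ≤ t * L / 2 := Nat.floor_le hnn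
    have f2 : t * L / 2 < i + 1 := Nat.lt_floor_add_one _
    have hi : i < L := by
      have : (i : ℝ) < L := by
        have := mul_lt_mul_of_pos_right ht.2 hLpos
        linarith
      exact_mod_cast this
    refine ⟨p i, ?_⟩
    have d1 := circle_dist (G := G) L p hp (ix (p i)) i (hix _) hi
    have d2 : (G.dist (p (ix (p i))) (p i) : ℝ) ≤ K := by
      have := hixd (p i)
      rw [SimpleGraph.dist_comm] at this
      exact_mod_cast this.le
    have d3 : dist ((2 * i / L : ℝ) : AddCircle (2 : ℝ)) (t : AddCircle (2 : ℝ)) ≤ 2 / L := by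
      rw [_root_.dist_comm, dist_eq_norm, ← AddCircle.coe_sub]
      have hx0 : 0 ≤ t - 2 * i / L := by
        rw [sub_nonneg, div_le_iff₀ hLpos]; linarith
      have hx1 : t - 2 * i / L ≤ 2 / L := by
        rw [sub_le_iff_le_add, ← add_div, le_div_iff₀ hLpos]; linarith
      rw [circle_norm _ hx0]
      · exact (min_le_left _ _).trans hx1
      · have : 0 ≤ 2 * (i : ℝ) / L := by positivity
        linarith [ht.2]
    have d4 : (2 : ℝ) / L * G.dist (p (ix (p i))) (p i) ≤ 2 / L * K :=
      mul_le_mul_of_nonneg_left d2 (by positivity)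
    calc _ ≤ _ := dist_triangle _ ((2 * i / L : ℝ) : AddCircle (2 : ℝ)) _
      _ ≤ 2 / L * K + 2 / L := by rw [d1]; linarith
      _ = (2 * K + 2) / L := by ring
      _ < ε := by rw [div_lt_iff₀ hLpos]; linarith
  · intro u v
    rw [circle_dist (G := G) L p hp _ _ (hix u) (hix v)]
    obtain ⟨c1, c2⟩ := hclose u v
    have c3 := hpp _ _ (hix u) (hix v)
    set a := G.dist (p (ix u)) (p (ix v))
    set b := G.dist u v
    have r1 : (b : ℝ) ≤ a + 2 * K := by exact_mod_cast c1
    have r2 : (a : ℝ) ≤ b + 2 * K := by exact_mod_cast c2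
    have r3 : 2 * (a : ℝ) ≤ L := by exact_mod_cast c3
    have ha0 : (0 : ℝ) ≤ a := by positivity
    have key : (2 / L * a - b / D : ℝ) = ((2 * a / L) * (2 * D - L) / 2 + (a - b)) / D := by
      field_simp; ring
    have hq1 : 2 * (a : ℝ) / L ≤ 1 := by rw [div_le_one hLpos]; exact r3
    have hq0 : 0 ≤ 2 * (a : ℝ) / L := by positivity
    set s := 2 * (a : ℝ) / L
    have m1 : s * (2 * D - L) ≤ 4 * K := by nlinarith
    have m2 : -(4 * K) ≤ s * (2 * D - L) := by nlinarith
    rw [key, abs_lt]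
    constructor
    · rw [lt_div_iff₀ hDpos]; linarith
    · rw [div_lt_iff₀ hDpos]; linarith

end CircleLimit

/-- **Theorem 4.** Let `(X_n)` be a sequence of finite connected vertex-transitive
graphs with `|X_n| → ∞` and `|X_n| / diam(X_n)^{2 - 1/log₃ 4} → 0`. Then the
rescaled spaces `X'_n` converge in the Gromov–Hausdorff distance to the circle
`ℝ/2ℤ` of circumference 2 (with its quotient metric). -/
theorem transitive_small_volume_scaling_limit_circle
    (V : ℕ → Type) (G : ∀ n, SimpleGraph (V n)) [∀ n, Fintype (V n)]
    (hconn : ∀ n, (G n).Connected)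
    (htrans : ∀ n, ∀ u v : V n, ∃ φ : G n ≃g G n, φ u = v)
    (hcard : Tendsto (fun n => Fintype.card (V n)) atTop atTop)
    (hvol : Tendsto
      (fun n => (Fintype.card (V n) : ℝ) /
        ((G n).diam : ℝ) ^ ((2 : ℝ) - 1 / Real.logb 3 4))
      atTop (nhds 0)) :
    GHConvergesTo V
      (fun n u v => ((G n).dist u v : ℝ) / ((G n).diam : ℝ))
      (fun x y : AddCircle (2 : ℝ) => dist x y) := by
  classical
  have hlog1 : 1 < Real.logb 3 4 := by
    rw [Real.lt_logb_iff_rpow_lt (by norm_num) (by norm_num)]; norm_num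
  set β : ℝ := 1 / Real.logb 3 4 with hβ
  have hβ0 : 0 < β := by positivity
  have hβ1 : β < 1 := by rw [hβ, div_lt_one (by linarith)]; exact hlog1
  have hα : 0 < 2 - β := by linarith
  have hNR : Tendsto (fun n => (Fintype.card (V n) : ℝ)) atTop atTop :=
    tendsto_natCast_atTop_atTop.comp hcard
  have hdpos : ∀ᶠ n in atTop, 0 < (G n).diam := by
    filter_upwards [hcard.eventually_ge_atTop 2] with n hn
    have : Nontrivial (V n) := Fintype.one_lt_card_iff_nontrivial.1 (by omega)
    exact Nat.pos_of_ne_zero (SimpleGraph.connected_iff_diam_ne_zero.1 (hconn n))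
  have hsmall : ∀ᶠ n in atTop,
      (Fintype.card (V n) : ℝ) < 1 / 2048 * ((G n).diam : ℝ) ^ (2 - β) := by
    filter_upwards [hvol.eventually_lt_const (show (0 : ℝ) < 1 / 2048 by norm_num), hdpos]
      with n hn hd
    have hd' : (0 : ℝ) < (G n).diam := by exact_mod_cast hd
    rwa [div_lt_iff₀ (Real.rpow_pos_of_pos hd' _)] at hn
  have hD : Tendsto (fun n => ((G n).diam : ℝ)) atTop atTop := by
    rw [tendsto_atTop]
    intro A
    filter_upwards [hsmall, hNR.eventually_ge_atTop ((max A 0) ^ (2 - β))] with n h1 h2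
    by_contra hlt
    push Not at hlt
    have h3 : ((G n).diam : ℝ) ^ (2 - β) ≤ (max A 0) ^ (2 - β) :=
      Real.rpow_le_rpow (by positivity) (hlt.le.trans (le_max_left _ _)) hα.le
    have h4 : (0 : ℝ) ≤ ((G n).diam : ℝ) ^ (2 - β) := by positivity
    linarith
  have hdecay : Tendsto (fun n => ((G n).diam : ℝ) ^ (-(1 - β))) atTop (nhds 0) :=
    (tendsto_rpow_neg_atTop (by linarith)).comp hD
  intro ε hε
  have hfin : ∀ᶠ n in atTop, ∃ f : V n → AddCircle (2 : ℝ),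
      (∀ y, ∃ v, dist (f v) y < ε) ∧
      (∀ u v, |dist (f u) (f v) - ((G n).dist u v : ℝ) / ((G n).diam : ℝ)| < ε) := by
    filter_upwards [hsmall, hD.eventually_ge_atTop 8,
      hdecay.eventually_lt_const (show (0 : ℝ) < min (ε / 8) (1 / 4) by positivity)]
      with n h1 h2 h3
    set D := (G n).diam with hDdef
    have hD0 : (0 : ℝ) < D := by linarith
    have hβD : (1 : ℝ) ≤ (D : ℝ) ^ β := Real.one_le_rpow (by linarith) hβ0.le
    obtain ⟨k, hk1, hk2⟩ := exists_nat_pow_near hβD (show (1 : ℝ) < 3 by norm_num)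
    have e1 : (D : ℝ) ^ β = (D : ℝ) ^ (-(1 - β)) * D := by
      rw [← Real.rpow_add_one hD0.ne']; congr 1; ring
    have e2 : (D : ℝ) ^ β * (D : ℝ) ^ (2 - β) = D ^ 2 := by
      rw [← Real.rpow_add hD0, show β + (2 - β) = ((2 : ℕ) : ℝ) by push_cast; ring,
        Real.rpow_natCast]
    have h4 : (D : ℝ) < 4 ^ (k + 1) := by
      have hl : Real.logb 3 4 ≠ 0 := by linarith
      have a1 : ((D : ℝ) ^ β) ^ Real.logb 3 4 = D := by
        rw [← Real.rpow_mul hD0.le, hβ, one_div, inv_mul_cancel₀ hl, Real.rpow_one]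
      have a2 : ((3 : ℝ) ^ (k + 1)) ^ Real.logb 3 4 = 4 ^ (k + 1) := by
        rw [← Real.rpow_natCast, ← Real.rpow_mul (by norm_num), mul_comm,
          Real.rpow_mul (by norm_num), Real.rpow_logb (by norm_num) (by norm_num) (by norm_num),
          Real.rpow_natCast]
      rw [← a1, ← a2]
      exact Real.rpow_lt_rpow (by positivity) hk2 (by linarith)
    have hne : Nonempty (V n) := (hconn n).nonempty
    obtain ⟨o, o', hoo⟩ := (G n).exists_dist_eq_diam
    have htop : (G n).ediam ≠ ⊤ := SimpleGraph.connected_iff_ediam_ne_top.1 (hconn n)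
    have hN0 : (0 : ℝ) ≤ Fintype.card (V n) := by positivity
    have hprod : (3 : ℝ) ^ k * Fintype.card (V n) ≤ 1 / 2048 * (D : ℝ) ^ 2 := by
      calc (3 : ℝ) ^ k * Fintype.card (V n)
          ≤ (D : ℝ) ^ β * (1 / 2048 * (D : ℝ) ^ (2 - β)) :=
            mul_le_mul hk1 h1.le hN0 (by positivity)
        _ = 1 / 2048 * ((D : ℝ) ^ β * (D : ℝ) ^ (2 - β)) := by ring
        _ = _ := by rw [e2]
    have hD8 : 8 ≤ D := by exact_mod_cast h2
    have hq : (D : ℝ) ≤ 8 * ((D / 4 : ℕ) : ℝ) := by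
      exact_mod_cast (by omega : D ≤ 8 * (D / 4))
    obtain ⟨L, p, hL, hp, hcov⟩ := CircleLimit.main_finite (hconn n) (htrans n) o o' (D / 4) k
      (by omega) (by
        have : (16 : ℝ) * 3 ^ k * Fintype.card (V n) < ((D / 4 : ℕ) : ℝ) * ((D / 4 : ℕ) : ℝ) := by
          nlinarith
        exact_mod_cast this) (by
        have : (3 : ℝ) ^ k * Fintype.card (V n) < 4 ^ k * D := by
          rw [pow_succ] at h4
          nlinarith
        rw [hoo]
        exact_mod_cast this)
    have h3a := h3.trans_le (min_le_left _ _)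
    have h3b := h3.trans_le (min_le_right _ _)
    have hka : (3 : ℝ) ^ k < ε / 8 * D :=
      (hk1.trans_eq e1).trans_lt (mul_lt_mul_of_pos_right h3a hD0)
    have hkb : (3 : ℝ) ^ k < 1 / 4 * D :=
      (hk1.trans_eq e1).trans_lt (mul_lt_mul_of_pos_right h3b hD0)
    have hkb' : 4 * 3 ^ k ≤ D := by
      have : (4 : ℝ) * 3 ^ k ≤ D := by linarith
      exact_mod_cast this
    exact CircleLimit.gh_map (hconn n) D (3 ^ k) L p ε (Nat.one_le_pow _ _ (by norm_num)) hkb'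
      (by push_cast; linarith) (fun u v => SimpleGraph.dist_le_diam htop) ⟨o, o', hoo⟩ hL hp hcov
  exact eventually_atTop.1 hfin
end

section
/- For every sequence of positive reals u(n) with u(n)/n² → ∞ there exist constants C ≥ 1 and K ≥ 0 and a sequence (X_n) of finite connected graphs, each (C,K)-roughly transitive, with diam(X_n) → ∞ and |X_n| ≤ u(diam(X_n)) for all sufficiently large n, such that no subsequence of the rescaled spaces X'_n converges in the Gromov–Hausdorff distance (to any compact metric space). -/
open Filter

namespace RTG

variable {V : Type}

/-- `v` and `w` are joined by a walk of length at most `k`. -/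
def Near (G : SimpleGraph V) (k : ℕ) (v w : V) : Prop := ∃ p : G.Walk v w, p.length ≤ k

lemma Near.refl (G : SimpleGraph V) (k : ℕ) (v : V) : Near G k v v := ⟨.nil, by simp⟩

lemma Near.symm {G : SimpleGraph V} {k : ℕ} {v w : V} (h : Near G k v w) : Near G k w v := by
  obtain ⟨p, hp⟩ := h
  exact ⟨p.reverse, by simpa using hp⟩

lemma Near.mono {G : SimpleGraph V} {k l : ℕ} {v w : V} (h : Near G k v w) (hkl : k ≤ l) :
    Near G l v w := by
  obtain ⟨p, hp⟩ := h
  exact ⟨p, hp.trans hkl⟩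

lemma Near.trans {G : SimpleGraph V} {k l : ℕ} {u v w : V} (h : Near G k u v)
    (h' : Near G l v w) : Near G (k + l) u w := by
  obtain ⟨p, hp⟩ := h
  obtain ⟨q, hq⟩ := h'
  exact ⟨p.append q, by rw [SimpleGraph.Walk.length_append]; omega⟩

lemma Near.of_adj {G : SimpleGraph V} {v w : V} (h : G.Adj v w) : Near G 1 v w :=
  ⟨h.toWalk, by simp⟩

lemma Near.dist_le {G : SimpleGraph V} {k : ℕ} {v w : V} (h : Near G k v w) :
    G.dist v w ≤ k := by
  obtain ⟨p, hp⟩ := h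
  exact (SimpleGraph.dist_le p).trans hp

lemma Near.of_conn {G : SimpleGraph V} (hG : G.Connected) (v w : V) :
    Near G (G.dist v w) v w := by
  obtain ⟨p, hp⟩ := hG.exists_walk_length_eq_dist v w
  exact ⟨p, hp.le⟩

lemma Near.map {G : SimpleGraph V} {c k : ℕ} {f : V → V}
    (hf : ∀ v w, G.Adj v w → Near G c (f v) (f w)) {v w : V} (h : Near G k v w) :
    Near G (c * k) (f v) (f w) := by
  obtain ⟨p, hp⟩ := h
  induction p generalizing k with
  | nil => exact Near.refl _ _ _
  | cons hadj p ih =>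
    rw [SimpleGraph.Walk.length_cons] at hp
    have h1 := (hf _ _ hadj).trans (ih (k := k - 1) (by omega))
    refine h1.mono ?_
    obtain ⟨l, rfl⟩ : ∃ l, k = l + 1 := ⟨k - 1, by omega⟩
    simp only [Nat.add_sub_cancel]
    rw [mul_add]; omega

/-- There is a coarse bi-Lipschitz self-map moving `x` near `y`. -/
def Rel (G : SimpleGraph V) (c : ℕ) (x y : V) : Prop :=
  ∃ f g : V → V, (∀ v w, G.Adj v w → Near G c (f v) (f w)) ∧
    (∀ v w, G.Adj v w → Near G c (g v) (g w)) ∧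
    (∀ v, Near G c (g (f v)) v) ∧ (∀ v, Near G c (f (g v)) v) ∧ Near G c (f x) y

lemma Rel.mono {G : SimpleGraph V} {c d : ℕ} {x y : V} (h : Rel G c x y) (hcd : c ≤ d) :
    Rel G d x y := by
  obtain ⟨f, g, h1, h2, h3, h4, h5⟩ := h
  exact ⟨f, g, fun v w a => (h1 v w a).mono hcd, fun v w a => (h2 v w a).mono hcd,
    fun v => (h3 v).mono hcd, fun v => (h4 v).mono hcd, h5.mono hcd⟩

lemma Rel.refl (G : SimpleGraph V) {c : ℕ} (hc : 1 ≤ c) (x : V) : Rel G c x x :=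
  ⟨id, id, fun _ _ a => (Near.of_adj a).mono hc, fun _ _ a => (Near.of_adj a).mono hc,
    fun _ => Near.refl _ _ _, fun _ => Near.refl _ _ _, Near.refl _ _ _⟩

lemma Rel.symm {G : SimpleGraph V} {c : ℕ} {x y : V} (h : Rel G c x y) :
    Rel G (c * c + c) y x := by
  obtain ⟨f, g, h1, h2, h3, h4, h5⟩ := h
  have hc : c ≤ c * c + c := by omega
  refine ⟨g, f, fun v w a => (h2 v w a).mono hc, fun v w a => (h1 v w a).mono hc,
    fun v => (h4 v).mono hc, fun v => (h3 v).mono hc, ?_⟩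
  exact (Near.map h2 h5.symm).trans (h3 x)

lemma Rel.trans {G : SimpleGraph V} {c d : ℕ} {x y z : V} (h : Rel G c x y) (h' : Rel G d y z) :
    Rel G (c * d + c + d) x z := by
  obtain ⟨f, g, h1, h2, h3, h4, h5⟩ := h
  obtain ⟨f', g', h1', h2', h3', h4', h5'⟩ := h'
  refine ⟨f' ∘ f, g ∘ g', fun v w a => ?_, fun v w a => ?_, fun v => ?_, fun v => ?_, ?_⟩
  · exact (Near.map h1' (h1 v w a)).mono (by rw [mul_comm d c]; omega)
  · exact (Near.map h2 (h2' v w a)).mono (by omega)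
  · exact ((Near.map h2 (h3' (f v))).trans (h3 v)).mono (by omega)
  · exact ((Near.map h1' (h4 (g' v))).trans (h4' v)).mono (by rw [mul_comm d c]; omega)
  · exact ((Near.map h1' h5).trans h5').mono (by rw [mul_comm d c]; omega)

lemma roughlyTransitive_of_rel {G : SimpleGraph V} (hG : G.Connected) {c : ℕ} (hc : 1 ≤ c)
    (h : ∀ x y, Rel G c x y) :
    RoughlyTransitive (c : ℝ) (2 * c + 2 : ℝ) (fun u v : V => (G.dist u v : ℝ)) := by
  classical
  intro x y
  obtain ⟨f, g, h1, h2, h3, h4, h5⟩ := h x y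
  have hc0 : (0 : ℝ) < c := by exact_mod_cast hc
  have hf' : ∀ v, G.dist (Function.update f x y v) (f v) ≤ c := by
    intro v
    by_cases hv : v = x
    · subst hv; simpa using h5.symm.dist_le
    · simp [Function.update_of_ne hv]
  set f' := Function.update f x y with hf'def
  have tri : ∀ a b d : V, G.dist a d ≤ G.dist a b + G.dist b d := fun a b d => hG.dist_triangle
  have hsymm : ∀ a b : V, G.dist a b = G.dist b a := fun a b => SimpleGraph.dist_comm
  refine ⟨f', ⟨fun v w => ?_, fun z => ⟨g z, ?_⟩⟩, by simp [hf'def]⟩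
  · have e1 := hf' v
    have e2 := hf' w
    have e3 := (Near.map h1 (Near.of_conn hG v w)).dist_le
    have e4 := (Near.map h2 (Near.of_conn hG (f v) (f w))).dist_le
    have e5 := (h3 v).dist_le
    have e6 := (h3 w).dist_le
    have t1 := tri (f' v) (f v) (f' w)
    have t2 := tri (f v) (f w) (f' w)
    have t3 := tri (f v) (f' v) (f w)
    have t4 := tri (f' v) (f' w) (f w)
    have t5 := tri v (g (f v)) w
    have t6 := tri (g (f v)) (g (f w)) w
    rw [hsymm (f w) (f' w)] at t2
    rw [hsymm (f v) (f' v)] at t3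
    rw [hsymm v (g (f v))] at t5
    constructor
    · have k1 : G.dist v w ≤ c * G.dist (f v) (f w) + 2 * c := by omega
      have k2 : G.dist (f v) (f w) ≤ G.dist (f' v) (f' w) + 2 * c := by omega
      have k1' : (G.dist v w : ℝ) ≤ c * G.dist (f v) (f w) + 2 * c := by exact_mod_cast k1
      have k2' : (G.dist (f v) (f w) : ℝ) ≤ G.dist (f' v) (f' w) + 2 * c := by exact_mod_cast k2
      rw [sub_le_iff_le_add, inv_mul_le_iff₀ hc0]
      nlinarith
    · have k1 : G.dist (f' v) (f' w) ≤ c * G.dist v w + 2 * c := by omega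
      have k1' : (G.dist (f' v) (f' w) : ℝ) ≤ c * G.dist v w + 2 * c := by exact_mod_cast k1
      linarith
  · have e1 := hf' (g z)
    have e2 := (h4 z).dist_le
    have t := tri (f' (g z)) (f (g z)) z
    have : G.dist (f' (g z)) z ≤ 2 * c := by omega
    have : (G.dist (f' (g z)) z : ℝ) ≤ 2 * c := by exact_mod_cast this
    linarith

/-- A coarse planar chart: `i` maps the open box of radius `R` into the graph. -/
structure Chart (G : SimpleGraph V) (R : ℤ) (i : ℤ → ℤ → V) : Prop where
  hor : ∀ a b, -R < a → a + 1 < R → -R < b → b < R → Near G 3 (i a b) (i (a + 1) b)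
  ver : ∀ a b, -R < a → a < R → -R < b → b + 1 < R → Near G 3 (i a b) (i a (b + 1))
  inj : ∀ a b a' b', -R < a → a < R → -R < b → b < R → -R < a' → a' < R → -R < b' → b' < R →
    i a b = i a' b' → a = a' ∧ b = b'
  nbr : ∀ a b w, -R + 1 < a → a < R - 1 → -R + 1 < b → b < R - 1 → G.Adj (i a b) w →
    ∃ a' b', a' ≤ a + 1 ∧ a ≤ a' + 1 ∧ b' ≤ b + 1 ∧ b ≤ b' + 1 ∧ w = i a' b'

lemma Chart.swap {G : SimpleGraph V} {R : ℤ} {i : ℤ → ℤ → V} (h : Chart G R i) :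
    Chart G R (fun a b => i b a) where
  hor a b h1 h2 h3 h4 := h.ver b a h3 h4 h1 h2
  ver a b h1 h2 h3 h4 := h.hor b a h3 h4 h1 h2
  inj a b a' b' h1 h2 h3 h4 h5 h6 h7 h8 e := (h.inj b a b' a' h3 h4 h1 h2 h7 h8 h5 h6 e).symm
  nbr a b w h1 h2 h3 h4 e := by
    obtain ⟨a', b', k⟩ := h.nbr b a w h3 h4 h1 h2 e
    exact ⟨b', a', by tauto⟩

lemma Chart.neg {G : SimpleGraph V} {R : ℤ} {i : ℤ → ℤ → V} (h : Chart G R i) :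
    Chart G R (fun a b => i (-a) b) where
  hor a b h1 h2 h3 h4 := by
    have := (h.hor (-(a + 1)) b (by omega) (by omega) h3 h4).symm
    simpa using this
  ver a b h1 h2 h3 h4 := h.ver (-a) b (by omega) (by omega) h3 h4
  inj a b a' b' h1 h2 h3 h4 h5 h6 h7 h8 e := by
    have := h.inj (-a) b (-a') b' (by omega) (by omega) h3 h4 (by omega) (by omega) h7 h8 e
    omega
  nbr a b w h1 h2 h3 h4 e := by
    obtain ⟨a', b', k1, k2, k3, k4, k5⟩ := h.nbr (-a) b w (by omega) (by omega) h3 h4 e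
    exact ⟨-a', b', by omega, by omega, k3, k4, by simpa using k5⟩

lemma Chart.shift {G : SimpleGraph V} {R : ℤ} {i : ℤ → ℤ → V} (h : Chart G R i) (x y r : ℤ)
    (hx : -R + r ≤ x) (hx' : x ≤ R - r) (hy : -R + r ≤ y) (hy' : y ≤ R - r) :
    Chart G r (fun a b => i (x + a) (y + b)) where
  hor a b h1 h2 h3 h4 := by
    have := h.hor (x + a) (y + b) (by omega) (by omega) (by omega) (by omega)
    rwa [add_assoc] at this
  ver a b h1 h2 h3 h4 := by
    have := h.ver (x + a) (y + b) (by omega) (by omega) (by omega) (by omega)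
    rwa [add_assoc y] at this
  inj a b a' b' h1 h2 h3 h4 h5 h6 h7 h8 e := by
    have := h.inj (x + a) (y + b) (x + a') (y + b') (by omega) (by omega) (by omega) (by omega)
      (by omega) (by omega) (by omega) (by omega) e
    omega
  nbr a b w h1 h2 h3 h4 e := by
    obtain ⟨a', b', k1, k2, k3, k4, k5⟩ := h.nbr (x + a) (y + b) w (by omega) (by omega)
      (by omega) (by omega) e
    exact ⟨a' - x, b' - y, by omega, by omega, by omega, by omega, by simpa using k5⟩

lemma Chart.hor_near {G : SimpleGraph V} {R : ℤ} {i : ℤ → ℤ → V} (h : Chart G R i) (k : ℕ) :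
    ∀ a a' b : ℤ, -R < a → a < R → -R < a' → a' < R → -R < b → b < R → a' ≤ a + k → a ≤ a' + k →
      Near G (3 * k) (i a b) (i a' b) := by
  induction k with
  | zero =>
    intro a a' b _ _ _ _ _ _ h1 h2
    obtain rfl : a = a' := by push_cast at h1 h2; omega
    exact Near.refl _ _ _
  | succ k ih =>
    intro a a' b h1 h2 h3 h4 h5 h6 h7 h8
    push_cast at h7 h8
    rcases lt_trichotomy a a' with hlt | heq | hgt
    · exact ((h.hor a b h1 (by omega) h5 h6).trans (ih (a + 1) a' b (by omega) (by omega) h3 h4 h5 h6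
        (by omega) (by omega))).mono (by omega)
    · subst heq; exact Near.refl _ _ _
    · have := h.hor (a - 1) b (by omega) (by omega) h5 h6
      rw [sub_add_cancel] at this
      exact (this.symm.trans (ih (a - 1) a' b (by omega) (by omega) h3 h4 h5 h6
        (by omega) (by omega))).mono (by omega)

lemma Chart.near {G : SimpleGraph V} {R : ℤ} {i : ℤ → ℤ → V} (h : Chart G R i) (k l : ℕ)
    (a a' b b' : ℤ) (h1 : -R < a) (h2 : a < R) (h3 : -R < a') (h4 : a' < R)
    (h5 : -R < b) (h6 : b < R) (h7 : -R < b') (h8 : b' < R) (h9 : a' ≤ a + k) (h10 : a ≤ a' + k)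
    (h11 : b' ≤ b + l) (h12 : b ≤ b' + l) :
      Near G (3 * k + 3 * l) (i a b) (i a' b') :=
  (h.hor_near k a a' b h1 h2 h3 h4 h5 h6 h9 h10).trans
    (h.swap.hor_near l b b' a' h5 h6 h7 h8 h3 h4 h11 h12)

open Classical in
/-- Transport of a self-map `(a, b) ↦ (F a b, b)` of the box through a chart. -/
noncomputable def lift (R : ℤ) (i : ℤ → ℤ → V) (F : ℤ → ℤ → ℤ) (v : V) : V :=
  if h : ∃ p : ℤ × ℤ, -R < p.1 ∧ p.1 < R ∧ -R < p.2 ∧ p.2 < R ∧ v = i p.1 p.2 then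
    i (F h.choose.1 h.choose.2) h.choose.2 else v

lemma Chart.lift_apply {G : SimpleGraph V} {R : ℤ} {i : ℤ → ℤ → V} (h : Chart G R i)
    (F : ℤ → ℤ → ℤ) (a b : ℤ) (h1 : -R < a) (h2 : a < R) (h3 : -R < b) (h4 : b < R) :
    lift R i F (i a b) = i (F a b) b := by
  have hex : ∃ p : ℤ × ℤ, -R < p.1 ∧ p.1 < R ∧ -R < p.2 ∧ p.2 < R ∧ i a b = i p.1 p.2 :=
    ⟨(a, b), h1, h2, h3, h4, rfl⟩
  unfold lift
  rw [dif_pos hex]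
  obtain ⟨k1, k2, k3, k4, k5⟩ := hex.choose_spec
  obtain ⟨e1, e2⟩ := h.inj _ _ _ _ h1 h2 h3 h4 k1 k2 k3 k4 k5
  rw [← e1, ← e2]

lemma lift_of_not (R : ℤ) (i : ℤ → ℤ → V) (F : ℤ → ℤ → ℤ) (v : V)
    (h : ¬ ∃ a b : ℤ, -R < a ∧ a < R ∧ -R < b ∧ b < R ∧ v = i a b) : lift R i F v = v := by
  unfold lift
  rw [dif_neg]
  rintro ⟨p, hp⟩
  exact h ⟨p.1, p.2, hp⟩

/-- Admissible horizontal box maps. -/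
structure Good (R : ℤ) (F : ℤ → ℤ → ℤ) : Prop where
  lip : ∀ a b a' b' : ℤ, a' ≤ a + 1 → a ≤ a' + 1 → b' ≤ b + 1 → b ≤ b' + 1 →
    F a' b' ≤ F a b + 4 ∧ F a b ≤ F a' b' + 4
  out : ∀ a b : ℤ, (a ≤ -R + 1 ∨ R - 1 ≤ a ∨ b ≤ -R + 1 ∨ R - 1 ≤ b) → F a b = a
  box : ∀ a b : ℤ, -R < a → a < R → -R < F a b ∧ F a b < R

lemma Chart.lift_lip {G : SimpleGraph V} {R : ℤ} {i : ℤ → ℤ → V} (h : Chart G R i)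
    {F : ℤ → ℤ → ℤ} (hF : Good R F) (v w : V) (hvw : G.Adj v w) :
    Near G 15 (lift R i F v) (lift R i F w) := by
  -- the case of an inner vertex
  have key : ∀ v w : V, G.Adj v w →
      (∃ a b : ℤ, -R + 1 < a ∧ a < R - 1 ∧ -R + 1 < b ∧ b < R - 1 ∧ v = i a b) →
      Near G 15 (lift R i F v) (lift R i F w) := by
    rintro v w hvw ⟨a, b, h1, h2, h3, h4, rfl⟩
    obtain ⟨a', b', k1, k2, k3, k4, rfl⟩ := h.nbr a b w h1 h2 h3 h4 hvw
    rw [h.lift_apply F a b (by omega) (by omega) (by omega) (by omega),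
      h.lift_apply F a' b' (by omega) (by omega) (by omega) (by omega)]
    have l := hF.lip a b a' b' k1 k2 k3 k4
    have b1 := hF.box a b (by omega) (by omega)
    have b2 := hF.box a' b' (by omega) (by omega)
    exact h.near 4 1 _ _ _ _ b1.1 b1.2 b2.1 b2.2 (by omega) (by omega) (by omega) (by omega)
      (by push_cast; omega) (by push_cast; omega) (by push_cast; omega) (by push_cast; omega)
  have fix : ∀ v : V,
      (¬ ∃ a b : ℤ, -R + 1 < a ∧ a < R - 1 ∧ -R + 1 < b ∧ b < R - 1 ∧ v = i a b) →
      lift R i F v = v := by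
    intro v hv
    by_cases hb : ∃ a b : ℤ, -R < a ∧ a < R ∧ -R < b ∧ b < R ∧ v = i a b
    · obtain ⟨a, b, h1, h2, h3, h4, rfl⟩ := hb
      rw [h.lift_apply F a b h1 h2 h3 h4, hF.out a b]
      by_contra hcon
      exact hv ⟨a, b, by omega, by omega, by omega, by omega, rfl⟩
    · exact lift_of_not R i F v hb
  by_cases hv : ∃ a b : ℤ, -R + 1 < a ∧ a < R - 1 ∧ -R + 1 < b ∧ b < R - 1 ∧ v = i a b
  · exact key v w hvw hv
  by_cases hw : ∃ a b : ℤ, -R + 1 < a ∧ a < R - 1 ∧ -R + 1 < b ∧ b < R - 1 ∧ w = i a b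
  · exact (key w v hvw.symm hw).symm
  rw [fix v hv, fix w hw]
  exact (Near.of_adj hvw).mono (by omega)

lemma Chart.lift_inv {G : SimpleGraph V} {R : ℤ} {i : ℤ → ℤ → V} (h : Chart G R i)
    {F F' : ℤ → ℤ → ℤ} (hF : Good R F) (hF' : Good R F')
    (hinv : ∀ a b, F' (F a b) b ≤ a + 4 ∧ a ≤ F' (F a b) b + 4) (v : V) :
    Near G 15 (lift R i F' (lift R i F v)) v := by
  by_cases hb : ∃ a b : ℤ, -R < a ∧ a < R ∧ -R < b ∧ b < R ∧ v = i a b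
  · obtain ⟨a, b, h1, h2, h3, h4, rfl⟩ := hb
    have b1 := hF.box a b h1 h2
    have b2 := hF'.box _ b b1.1 b1.2
    have l := hinv a b
    rw [h.lift_apply F a b h1 h2 h3 h4, h.lift_apply F' _ b b1.1 b1.2 h3 h4]
    exact h.near 4 1 _ _ _ _ b2.1 b2.2 h1 h2 h3 h4 h3 h4
      (by push_cast; omega) (by push_cast; omega) (by push_cast; omega) (by push_cast; omega)
  · rw [lift_of_not R i F v hb, lift_of_not R i F' v hb]
    exact Near.refl _ _ _

/-- The shear pushing the origin to `(d, 0)`, supported in a diamond of radius `2 d`. -/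
def push (d a b : ℤ) : ℤ := a + max 0 (2 * d - max a (-a) - max b (-b)) / 2

/-- A coarse inverse of `push`. -/
def pull (d a b : ℤ) : ℤ :=
  if 2 * d - max b (-b) ≤ max a (-a) then a
  else if 0 ≤ 2 * a - (2 * d - max b (-b)) then 2 * a - (2 * d - max b (-b))
  else (2 * a - (2 * d - max b (-b))) / 3

lemma good_push (R d : ℤ) (hd : 0 ≤ d) (hR : 2 * d + 4 ≤ R) : Good R (push d) where
  lip a b a' b' h1 h2 h3 h4 := by unfold push; omega
  out a b h := by unfold push; omega
  box a b h1 h2 := by unfold push; omega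

lemma good_pull (R d : ℤ) (hd : 0 ≤ d) (hR : 2 * d + 4 ≤ R) : Good R (pull d) where
  lip a b a' b' h1 h2 h3 h4 := by unfold pull; split_ifs <;> omega
  out a b h := by unfold pull; split_ifs <;> omega
  box a b h1 h2 := by unfold pull; split_ifs <;> omega

lemma Chart.move {G : SimpleGraph V} {R : ℤ} {i : ℤ → ℤ → V} (h : Chart G R i) (d : ℤ)
    (hd : 0 ≤ d) (hR : 2 * d + 4 ≤ R) : Rel G 15 (i 0 0) (i d 0) := by
  have g1 := good_push R d hd hR
  have g2 := good_pull R d hd hR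
  refine ⟨lift R i (push d), lift R i (pull d), h.lift_lip g1, h.lift_lip g2,
    h.lift_inv g1 g2 ?_, h.lift_inv g2 g1 ?_, ?_⟩
  · intro a b; unfold push pull; split_ifs <;> omega
  · intro a b; unfold push pull; split_ifs <;> omega
  · rw [h.lift_apply _ 0 0 (by omega) (by omega) (by omega) (by omega)]
    have : push d 0 0 = d := by unfold push; omega
    rw [this]
    exact Near.refl _ _ _

/-- Constants for iterated moves. -/
def cst : ℕ → ℕ
  | 0 => 1
  | k + 1 => 15 * cst k + 15 + cst k

lemma Chart.move_hor {G : SimpleGraph V} {S : ℤ} {i : ℤ → ℤ → V} (h : Chart G (64 * S) i)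
    (hS : 1 ≤ S) (k : ℕ) : ∀ a a' b : ℤ, -(56 * S) ≤ a → a ≤ 56 * S → -(56 * S) ≤ a' →
      a' ≤ 56 * S → -(56 * S) ≤ b → b ≤ 56 * S → a' ≤ a + k * S → a ≤ a' + k * S →
      Rel G (cst k) (i a b) (i a' b) := by
  induction k with
  | zero =>
    intro a a' b _ _ _ _ _ _ h1 h2
    obtain rfl : a = a' := by push_cast at h1 h2; omega
    exact Rel.refl _ (by simp [cst]) _
  | succ k ih =>
    intro a a' b h1 h2 h3 h4 h5 h6 h7 h8
    have hsh := h.shift a b (8 * S) (by omega) (by omega) (by omega) (by omega)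
    push_cast at h7 h8
    rw [add_mul, one_mul] at h7 h8
    have hk : 0 ≤ (k : ℤ) * S := by positivity
    -- first step
    obtain ⟨t, ht1, ht2, ht3, ht4, ht5, ht6⟩ : ∃ t : ℤ, -S ≤ t ∧ t ≤ S ∧ -(56 * S) ≤ a + t ∧
        a + t ≤ 56 * S ∧ a' ≤ a + t + k * S ∧ a + t ≤ a' + k * S := by
      generalize (k : ℤ) * S = q at *
      refine ⟨max (-S) (min S (a' - a)), ?_⟩
      omega
    have step : Rel G 15 (i a b) (i (a + t) b) := by
      rcases le_total 0 t with h0 | h0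
      · have := hsh.move t h0 (by omega)
        simpa using this
      · have := hsh.neg.move (-t) (by omega) (by omega)
        simpa using this
    exact step.trans (ih (a + t) a' b ht3 ht4 h3 h4 h5 h6 ht5 ht6)

/-- Constant for arbitrary moves inside the core of a chart. -/
def bigc : ℕ := cst 112 * cst 112 + cst 112 + cst 112

lemma Chart.core {G : SimpleGraph V} {S : ℤ} {i : ℤ → ℤ → V} (h : Chart G (64 * S) i)
    (hS : 1 ≤ S) (a a' b b' : ℤ) (h1 : -(56 * S) ≤ a) (h2 : a ≤ 56 * S) (h3 : -(56 * S) ≤ a')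
    (h4 : a' ≤ 56 * S) (h5 : -(56 * S) ≤ b) (h6 : b ≤ 56 * S) (h7 : -(56 * S) ≤ b')
    (h8 : b' ≤ 56 * S) : Rel G bigc (i a b) (i a' b') :=
  (h.move_hor hS 112 a a' b h1 h2 h3 h4 h5 h6 (by push_cast; omega) (by push_cast; omega)).trans
    (h.swap.move_hor hS 112 b b' a' h5 h6 h7 h8 h3 h4 (by push_cast; omega) (by push_cast; omega))

end RTG
namespace RTG

/-- Vertices: lamp configuration, slot, horizontal offset in the slot, vertical coordinate. -/
abbrev VV (m N : ℕ) : Type := (ZMod m → ZMod 2) × ZMod m × Fin N × Fin (2 * N)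

/-- Elementary oriented steps: moving right, or moving up; crossing the seam toggles a lamp. -/
def Step (m N : ℕ) (v w : VV m N) : Prop :=
  (w.1 = v.1 ∧ w.2.2.2 = v.2.2.2 ∧
    ((w.2.1 = v.2.1 ∧ w.2.2.1.val = v.2.2.1.val + 1) ∨
      (w.2.1 = v.2.1 + 1 ∧ v.2.2.1.val + 1 = N ∧ w.2.2.1.val = 0))) ∨
  (w.2.1 = v.2.1 ∧ w.2.2.1 = v.2.2.1 ∧
    ((w.1 = v.1 ∧ w.2.2.2.val = v.2.2.2.val + 1) ∨
      (w.1 = v.1 + Pi.single v.2.1 1 ∧ v.2.2.2.val + 1 = 2 * N ∧ w.2.2.2.val = 0)))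

/-- The lamplighter surface graph. -/
def GG (m N : ℕ) : SimpleGraph (VV m N) := SimpleGraph.fromRel (Step m N)

lemma near_of_step {m N : ℕ} {v w : VV m N} (h : Step m N v w) : Near (GG m N) 1 v w := by
  by_cases e : v = w
  · subst e; exact Near.refl _ _ _
  · exact Near.of_adj ((SimpleGraph.fromRel_adj _ _ _).2 ⟨e, Or.inl h⟩)

lemma step_of_adj {m N : ℕ} {v w : VV m N} (h : (GG m N).Adj v w) :
    Step m N v w ∨ Step m N w v := ((SimpleGraph.fromRel_adj _ _ _).1 h).2

/-- Integers to `Fin n`. -/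
def fz (n : ℕ) [NeZero n] (x : ℤ) : Fin n :=
  ⟨(x % n).toNat, by
    have := NeZero.pos n
    have h1 := Int.emod_lt_of_pos x (b := (n : ℤ)) (by omega)
    have h2 := Int.emod_nonneg x (b := (n : ℤ)) (by omega)
    omega⟩

lemma fz_val (n : ℕ) [NeZero n] (x : ℤ) (h0 : 0 ≤ x) (h1 : x < n) :
    ((fz n x).val : ℤ) = x := by
  simp only [fz, Int.emod_eq_of_lt h0 h1]
  omega

lemma eq_fz (n : ℕ) [NeZero n] (z : Fin n) (x : ℤ) (h : (z.val : ℤ) = x) : z = fz n x := by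
  apply Fin.ext
  have := fz_val n x (by omega) (by have := z.isLt; omega)
  omega

section concrete
variable {m N : ℕ} [NeZero N]

/-- Points with integer coordinates. -/
def P (w : ZMod m → ZMod 2) (j : ZMod m) (x y : ℤ) : VV m N := (w, j, fz N x, fz (2 * N) y)

/-- The elementary lamp. -/
def lamp (j : ZMod m) : ZMod m → ZMod 2 := Pi.single j 1

lemma lamp_add_lamp (w : ZMod m → ZMod 2) (j : ZMod m) : w + lamp j + lamp j = w := by
  rw [add_assoc, CharTwo.add_self_eq_zero, add_zero]

lemma exists_P (v : VV m N) : ∃ (w : ZMod m → ZMod 2) (j : ZMod m) (x y : ℤ), 0 ≤ x ∧ x < N ∧ 0 ≤ y ∧ y < 2 * N ∧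
    v = P w j x y := by
  obtain ⟨w, j, x, y⟩ := v
  refine ⟨w, j, x.val, y.val, by omega, by omega, by omega, by omega, ?_⟩
  simp only [P]
  rw [← eq_fz N x _ rfl, ← eq_fz (2 * N) y _ rfl]

lemma P_inj {w w' : ZMod m → ZMod 2} {j j' : ZMod m} {x x' y y' : ℤ} (h1 : 0 ≤ x) (h2 : x < N)
    (h3 : 0 ≤ y) (h4 : y < 2 * N) (h1' : 0 ≤ x') (h2' : x' < N)
    (h3' : 0 ≤ y') (h4' : y' < 2 * N) (h : (P w j x y : VV m N) = P w' j' x' y') :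
    w = w' ∧ j = j' ∧ x = x' ∧ y = y' := by
  simp only [P, Prod.mk.injEq] at h
  obtain ⟨e1, e2, e3, e4⟩ := h
  refine ⟨e1, e2, ?_, ?_⟩
  · rw [← fz_val N x h1 h2, e3, fz_val N x' h1' h2']
  · rw [← fz_val (2 * N) y h3 (by push_cast; omega), e4, fz_val (2 * N) y' h3' (by push_cast; omega)]

lemma P_right (w : ZMod m → ZMod 2) (j : ZMod m) (x y : ℤ) (h1 : 0 ≤ x) (h2 : x + 1 < N) :
    Near (GG m N) 1 (P w j x y) (P w j (x + 1) y) := by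
  apply near_of_step
  left
  refine ⟨rfl, rfl, Or.inl ⟨rfl, ?_⟩⟩
  have a := fz_val N x h1 (by omega)
  have b := fz_val N (x + 1) (by omega) h2
  simp only [P]; omega

lemma P_right' (w : ZMod m → ZMod 2) (j : ZMod m) (y : ℤ) :
    Near (GG m N) 1 (P w j (N - 1) y) (P w (j + 1) 0 y) := by
  have := NeZero.pos N
  apply near_of_step
  left
  refine ⟨rfl, rfl, Or.inr ⟨rfl, ?_, ?_⟩⟩
  · have a := fz_val N (N - 1) (by omega) (by omega)
    simp only [P]; omega
  · have b := fz_val N 0 (by omega) (by omega)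
    simp only [P]; omega

lemma P_up (w : ZMod m → ZMod 2) (j : ZMod m) (x y : ℤ) (h1 : 0 ≤ y) (h2 : y + 1 < 2 * N) :
    Near (GG m N) 1 (P w j x y) (P w j x (y + 1)) := by
  apply near_of_step
  right
  refine ⟨rfl, rfl, Or.inl ⟨rfl, ?_⟩⟩
  have a := fz_val (2 * N) y h1 (by push_cast; omega)
  have b := fz_val (2 * N) (y + 1) (by omega) (by push_cast; omega)
  simp only [P]; omega

lemma P_up' (w : ZMod m → ZMod 2) (j : ZMod m) (x : ℤ) :
    Near (GG m N) 1 (P w j x (2 * N - 1)) (P (w + lamp j) j x 0) := by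
  have := NeZero.pos N
  apply near_of_step
  right
  refine ⟨rfl, rfl, Or.inr ⟨rfl, ?_, ?_⟩⟩
  · have a := fz_val (2 * N) (2 * N - 1) (by omega) (by push_cast; omega)
    simp only [P]; omega
  · have b := fz_val (2 * N) 0 (by omega) (by push_cast; omega)
    simp only [P]; omega

lemma P_nbr (w : ZMod m → ZMod 2) (j : ZMod m) (x y : ℤ) (h1 : 0 ≤ x) (h2 : x < N)
    (h3 : 0 ≤ y) (h4 : y < 2 * N) (v : VV m N) (h : (GG m N).Adj (P w j x y) v) :
    (x + 1 < N ∧ v = P w j (x + 1) y) ∨ (x + 1 = N ∧ v = P w (j + 1) 0 y) ∨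
    (0 < x ∧ v = P w j (x - 1) y) ∨ (x = 0 ∧ v = P w (j - 1) (N - 1) y) ∨
    (y + 1 < 2 * N ∧ v = P w j x (y + 1)) ∨ (y + 1 = 2 * N ∧ v = P (w + lamp j) j x 0) ∨
    (0 < y ∧ v = P w j x (y - 1)) ∨ (y = 0 ∧ v = P (w + lamp j) j x (2 * N - 1)) := by
  have hx := fz_val N x h1 h2
  have hy := fz_val (2 * N) y h3 (by push_cast; omega)
  obtain ⟨w', j', x', y'⟩ := v
  have lx := x'.isLt
  have ly := y'.isLt
  rcases step_of_adj h with h | h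
  · rcases h with ⟨e1, e2, ⟨e3, e4⟩ | ⟨e3, e4, e5⟩⟩ | ⟨e1, e2, ⟨e3, e4⟩ | ⟨e3, e4, e5⟩⟩ <;>
      simp only [P] at e1 e2 e3 e4 <;> subst e1 e2 e3
    · left
      refine ⟨by omega, ?_⟩
      rw [eq_fz N x' (x + 1) (by omega)]; rfl
    · right; left
      simp only at e5
      refine ⟨by omega, ?_⟩
      rw [eq_fz N x' 0 (by omega)]; rfl
    · right; right; right; right; left
      refine ⟨by omega, ?_⟩
      rw [eq_fz _ y' (y + 1) (by omega)]; rfl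
    · right; right; right; right; right; left
      simp only at e5
      refine ⟨by omega, ?_⟩
      rw [eq_fz _ y' 0 (by omega)]; rfl
  · rcases h with ⟨e1, e2, ⟨e3, e4⟩ | ⟨e3, e4, e5⟩⟩ | ⟨e1, e2, ⟨e3, e4⟩ | ⟨e3, e4, e5⟩⟩ <;>
      simp only [P] at e1 e2 e3 e4
    · subst e1 e2 e3
      right; right; left
      refine ⟨by omega, ?_⟩
      rw [eq_fz N x' (x - 1) (by omega)]; rfl
    · subst e1 e2 e3
      right; right; right; left
      simp only [P] at e5
      refine ⟨by omega, ?_⟩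
      rw [eq_fz N x' (N - 1) (by omega)]
      simp [P]
    · subst e1 e2 e3
      right; right; right; right; right; right; left
      refine ⟨by omega, ?_⟩
      rw [eq_fz _ y' (y - 1) (by omega)]; rfl
    · subst e1 e2
      right; right; right; right; right; right; right
      simp only [P] at e5
      refine ⟨by omega, ?_⟩
      rw [eq_fz _ y' (2 * N - 1) (by omega), e3]
      have := lamp_add_lamp w' j
      unfold lamp at this
      simp [P, lamp, this]

/-- Points with signed horizontal coordinate relative to slot `j`. -/
def Q (w : ZMod m → ZMod 2) (j : ZMod m) (x y : ℤ) : VV m N :=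
  if 0 ≤ x then P w j x y else P w (j - 1) (x + N) y

/-- The slot of a signed coordinate. -/
def slot (j : ZMod m) (x : ℤ) : ZMod m := if 0 ≤ x then j else j - 1

lemma Q_right (w : ZMod m → ZMod 2) (j : ZMod m) (x y : ℤ) (h1 : -N ≤ x) (h2 : x + 1 < N) :
    Near (GG m N) 1 (Q w j x y) (Q w j (x + 1) y) := by
  unfold Q
  rcases lt_trichotomy x (-1) with h | h | h
  · rw [if_neg (by omega), if_neg (by omega)]
    have := P_right (N := N) w (j - 1) (x + N) y (by omega) (by omega)
    rwa [add_right_comm] at this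
  · subst h
    rw [if_neg (by omega), if_pos (by omega)]
    have := P_right' (N := N) w (j - 1) y
    rw [sub_add_cancel] at this
    rwa [neg_add_eq_sub, show (-1 + 1 : ℤ) = 0 by norm_num]
  · rw [if_pos (by omega), if_pos (by omega)]
    exact P_right w j x y (by omega) h2

lemma Q_up (w : ZMod m → ZMod 2) (j : ZMod m) (x y : ℤ) (h1 : 0 ≤ y) (h2 : y + 1 < 2 * N) :
    Near (GG m N) 1 (Q w j x y) (Q w j x (y + 1)) := by
  unfold Q
  split_ifs
  · exact P_up _ _ _ _ h1 h2
  · exact P_up _ _ _ _ h1 h2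

lemma Q_up' (w : ZMod m → ZMod 2) (j : ZMod m) (x : ℤ) :
    Near (GG m N) 1 (Q w j x (2 * N - 1)) (Q (w + lamp (slot j x)) j x 0) := by
  unfold Q slot
  split_ifs
  · exact P_up' _ _ _
  · exact P_up' _ _ _

lemma Q_nbr (w : ZMod m → ZMod 2) (j : ZMod m) (x y : ℤ) (h1 : -N < x) (h2 : x + 1 < N)
    (h3 : 0 ≤ y) (h4 : y < 2 * N) (v : VV m N) (h : (GG m N).Adj (Q w j x y) v) :
    v = Q w j (x + 1) y ∨ v = Q w j (x - 1) y ∨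
    (y + 1 < 2 * N ∧ v = Q w j x (y + 1)) ∨
    (y + 1 = 2 * N ∧ v = Q (w + lamp (slot j x)) j x 0) ∨
    (0 < y ∧ v = Q w j x (y - 1)) ∨
    (y = 0 ∧ v = Q (w + lamp (slot j x)) j x (2 * N - 1)) := by
  unfold Q slot at *
  by_cases hx : 0 ≤ x
  · simp only [if_pos hx] at h ⊢
    rcases P_nbr w j x y hx (by omega) h3 h4 v h with h | h | h | h | h | h | h | h
    · left; rw [if_pos (by omega)]; exact h.2
    · omega
    · right; left; rw [if_pos (by omega)]; exact h.2
    · right; left; rw [if_neg (by omega), h.2, h.1]; congr 1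
    · simp [h]
    · simp [h]
    · simp [h]
    · simp [h]
  · simp only [if_neg hx] at h ⊢
    rcases P_nbr w (j - 1) (x + N) y (by omega) (by omega) h3 h4 v h with
      h | h | h | h | h | h | h | h
    · left; rw [if_neg (by omega), h.2, add_right_comm]
    · left; rw [if_pos (by omega), h.2, sub_add_cancel]; congr 1; omega
    · right; left; rw [if_neg (by omega), h.2]; congr 1; ring
    · omega
    · simp [h]
    · simp [h]
    · simp [h]
    · simp [h]

lemma Q_inj (hm : 1 < m) {w w' : ZMod m → ZMod 2} {j : ZMod m} {x x' y y' : ℤ} (h1 : -N ≤ x)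
    (h2 : x < N) (h3 : 0 ≤ y) (h4 : y < 2 * N) (h1' : -N ≤ x') (h2' : x' < N)
    (h3' : 0 ≤ y') (h4' : y' < 2 * N) (h : (Q w j x y : VV m N) = Q w' j x' y') :
    w = w' ∧ x = x' ∧ y = y' := by
  have : Fact (1 < m) := ⟨hm⟩
  have hj : j - 1 ≠ j := by simp
  unfold Q at h
  split_ifs at h
  · have := P_inj (by omega) (by omega) (by omega) (by omega) (by omega) (by omega) (by omega)
      (by omega) h
    tauto
  · have := P_inj (by omega) (by omega) (by omega) (by omega) (by omega) (by omega) (by omega)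
      (by omega) h
    exact absurd this.2.1.symm hj
  · have := P_inj (by omega) (by omega) (by omega) (by omega) (by omega) (by omega) (by omega)
      (by omega) h
    exact absurd this.2.1 hj
  · have := P_inj (by omega) (by omega) (by omega) (by omega) (by omega) (by omega) (by omega)
      (by omega) h
    exact ⟨this.1, by omega, this.2.2.2⟩

/-- The flat chart, centred far from the seam. -/
lemma chartF (hm : 1 < m) (w : ZMod m → ZMod 2) (j : ZMod m) :
    Chart (GG m N) N (fun a b => Q w j a (N + b)) where
  hor a b h1 h2 h3 h4 := (Q_right w j a (N + b) (by omega) h2).mono (by omega)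
  ver a b h1 h2 h3 h4 := by
    have := (Q_up (N := N) w j a (N + b) (by omega) (by omega)).mono (show 1 ≤ 3 by omega)
    rwa [add_assoc] at this
  inj a b a' b' h1 h2 h3 h4 h5 h6 h7 h8 e := by
    have := Q_inj hm (by omega) (by omega) (by omega) (by omega) (by omega) (by omega) (by omega)
      (by omega) e
    omega
  nbr a b v h1 h2 h3 h4 e := by
    rcases Q_nbr w j a (N + b) (by omega) (by omega) (by omega) (by omega) v e with
      h | h | h | h | h | h
    · exact ⟨a + 1, b, by omega, by omega, by omega, by omega, h⟩
    · exact ⟨a - 1, b, by omega, by omega, by omega, by omega, h⟩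
    · exact ⟨a, b + 1, by omega, by omega, by omega, by omega, by rw [h.2, add_assoc]⟩
    · omega
    · exact ⟨a, b - 1, by omega, by omega, by omega, by omega, by rw [h.2, add_sub_assoc]⟩
    · omega

/-- Folded coordinate. -/
def fold (a : ℤ) : ℤ := if 0 ≤ a then a else -1 - a

/-- The chart around a branch point: four half planes as four quadrants. -/
def chS (w : ZMod m → ZMod 2) (j : ZMod m) (a b : ℤ) : VV m N :=
  Q (w + (if 0 ≤ a then 0 else lamp (j - 1)) + (if 0 ≤ b then 0 else lamp j)) j
    (fold a - fold b)
    (if (0 ≤ a ↔ 0 ≤ b) then min (fold a) (fold b) else 2 * N - 1 - min (fold a) (fold b))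

lemma Q_diag (w : ZMod m → ZMod 2) (j : ZMod m) (p : Prop) [Decidable p] (x x' t t' : ℤ)
    (h1 : -N ≤ x) (h2 : x < N) (h3 : -N ≤ x') (h4 : x' < N) (h5 : 0 ≤ t) (h6 : t < 2 * N)
    (h7 : 0 ≤ t') (h8 : t' < 2 * N) (h9 : x ≤ x' + 1) (h10 : x' ≤ x + 1) (h11 : t ≤ t' + 1)
    (h12 : t' ≤ t + 1) :
    Near (GG m N) 3 (Q w j x (if p then t else 2 * N - 1 - t))
      (Q w j x' (if p then t' else 2 * N - 1 - t')) := by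
  have hor : ∀ y : ℤ, Near (GG m N) 1 (Q w j x y) (Q w j x' y) := by
    intro y
    obtain rfl | rfl | rfl : x' = x ∨ x' = x + 1 ∨ x = x' + 1 := by omega
    · exact Near.refl _ _ _
    · exact Q_right _ _ _ _ h1 h4
    · exact (Q_right _ _ _ _ h3 h2).symm
  have ver : ∀ y y' : ℤ, 0 ≤ y → y < 2 * N → 0 ≤ y' → y' < 2 * N → y' ≤ y + 1 → y ≤ y' + 1 →
      Near (GG m N) 1 (Q w j x' y) (Q w j x' y') := by
    intro y y' a1 a2 a3 a4 a5 a6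
    obtain rfl | rfl | rfl : y' = y ∨ y' = y + 1 ∨ y = y' + 1 := by omega
    · exact Near.refl _ _ _
    · exact Q_up _ _ _ _ a1 a4
    · exact (Q_up _ _ _ _ a3 a2).symm
  refine ((hor _).trans (ver _ _ ?_ ?_ ?_ ?_ ?_ ?_)).mono (show 1 + 1 ≤ 3 by omega) <;>
    split_ifs <;> omega

lemma chS_hor (w : ZMod m → ZMod 2) (j : ZMod m) (a b : ℤ) (h1 : -N < a) (h2 : a + 1 < N)
    (h3 : -N < b) (h4 : b < N) : Near (GG m N) 3 (chS w j a b) (chS w j (a + 1) b) := by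
  unfold chS
  by_cases ha : a = -1
  · subst ha
    have f0 : fold (-1) = 0 := by simp [fold]
    have f1 : fold (-1 + 1) = 0 := by simp [fold]
    rw [f0, f1, if_neg (show ¬ (0 : ℤ) ≤ -1 by omega), if_pos (show (0 : ℤ) ≤ -1 + 1 by omega)]
    have hb : 0 ≤ fold b ∧ fold b < N := by unfold fold; split_ifs <;> omega
    have hmin : min 0 (fold b) = 0 := by omega
    rw [hmin, zero_sub, add_zero]
    -- crossing at negative abscissa
    have cr : ∀ W : ZMod m → ZMod 2, ∀ x : ℤ, x < 0 →
        Near (GG m N) 1 (Q (W + lamp (j - 1)) j x 0) (Q W j x (2 * N - 1)) := by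
      intro W x hx
      have := (Q_up' (N := N) W j x).symm
      rwa [slot, if_neg (by omega)] at this
    have cr2 : ∀ W : ZMod m → ZMod 2, ∀ x : ℤ, x ≤ 0 → -N < x →
        Near (GG m N) 3 (Q (W + lamp (j - 1)) j x 0) (Q W j x (2 * N - 1)) := by
      intro W x hx hN
      rcases lt_or_ge x 0 with hx' | hx'
      · exact (cr W x hx').mono (by omega)
      · obtain rfl : x = 0 := by omega
        have r : ∀ (W : ZMod m → ZMod 2) (y : ℤ),
            Near (GG m N) 1 (Q W j (-1) y) (Q W j 0 y) := by
          intro W y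
          have := Q_right (N := N) W j (-1) y (by omega) (by omega)
          rwa [show (-1 + 1 : ℤ) = 0 by norm_num] at this
        exact ((r _ _).symm.trans (cr W (-1) (by omega))).trans (r _ _)
    by_cases hb0 : 0 ≤ b
    · simp only [hb0, if_true, add_zero]
      have := (cr2 (w + lamp (j - 1)) (-fold b) (by omega) (by omega)).symm
      rw [lamp_add_lamp] at this
      simpa using this
    · simp only [hb0, if_false]
      have := cr2 (w + lamp j) (-fold b) (by omega) (by omega)
      rw [add_right_comm] at this
      simpa using this
  · have e : (0 ≤ a + 1) = (0 ≤ a) := by apply propext; omega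
    simp only [e]
    have hb : 0 ≤ fold b ∧ fold b < N := by unfold fold; split_ifs <;> omega
    have ha : 0 ≤ fold a ∧ fold a < N := by unfold fold; split_ifs <;> omega
    have ha' : 0 ≤ fold (a + 1) ∧ fold (a + 1) < N := by unfold fold; split_ifs <;> omega
    have hd : fold (a + 1) ≤ fold a + 1 ∧ fold a ≤ fold (a + 1) + 1 := by
      unfold fold; split_ifs <;> omega
    apply Q_diag <;> omega

lemma chS_ver (w : ZMod m → ZMod 2) (j : ZMod m) (a b : ℤ) (h1 : -N < a) (h2 : a < N)
    (h3 : -N < b) (h4 : b + 1 < N) : Near (GG m N) 3 (chS w j a b) (chS w j a (b + 1)) := by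
  unfold chS
  by_cases hb : b = -1
  · subst hb
    have f0 : fold (-1) = 0 := by simp [fold]
    have f1 : fold (-1 + 1) = 0 := by simp [fold]
    rw [f0, f1, if_neg (show ¬ (0 : ℤ) ≤ -1 by omega), if_pos (show (0 : ℤ) ≤ -1 + 1 by omega)]
    have hb : 0 ≤ fold a ∧ fold a < N := by unfold fold; split_ifs <;> omega
    have hmin : min (fold a) 0 = 0 := by omega
    rw [hmin, sub_zero, add_zero]
    have cr : ∀ W : ZMod m → ZMod 2, ∀ x : ℤ, 0 ≤ x →
        Near (GG m N) 3 (Q (W + lamp j) j x 0) (Q W j x (2 * N - 1)) := by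
      intro W x hx
      have := (Q_up' (N := N) W j x).symm.mono (show 1 ≤ 3 by omega)
      rwa [slot, if_pos (by omega)] at this
    by_cases hb0 : 0 ≤ a
    · simp only [hb0, if_true, add_zero]
      have := (cr (w + lamp j) (fold a) (by omega)).symm
      rw [lamp_add_lamp] at this
      simpa using this
    · simp only [hb0, if_false]
      have := cr (w + lamp (j - 1)) (fold a) (by omega)
      simpa using this
  · have e : (0 ≤ b + 1) = (0 ≤ b) := by apply propext; omega
    simp only [e]
    have hb : 0 ≤ fold b ∧ fold b < N := by unfold fold; split_ifs <;> omega
    have ha : 0 ≤ fold a ∧ fold a < N := by unfold fold; split_ifs <;> omega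
    have ha' : 0 ≤ fold (b + 1) ∧ fold (b + 1) < N := by unfold fold; split_ifs <;> omega
    have hd : fold (b + 1) ≤ fold b + 1 ∧ fold b ≤ fold (b + 1) + 1 := by
      unfold fold; split_ifs <;> omega
    apply Q_diag <;> omega

lemma lamp_self (j : ZMod m) : lamp j j = 1 := by simp [lamp]

lemma lamp_ne {j k : ZMod m} (h : k ≠ j) : lamp j k = 0 := by simp [lamp, h]

lemma chS_inj (hm : 1 < m) (w : ZMod m → ZMod 2) (j : ZMod m) (a b a' b' : ℤ) (h1 : -N < a)
    (h2 : a < N) (h3 : -N < b) (h4 : b < N) (h1' : -N < a')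
    (h2' : a' < N) (h3' : -N < b') (h4' : b' < N) (h : (chS w j a b : VV m N) = chS w j a' b') :
    a = a' ∧ b = b' := by
  have : Fact (1 < m) := ⟨hm⟩
  have hj : j - 1 ≠ j := by simp
  unfold chS at h
  have r : ∀ a : ℤ, -N < a → a < N → 0 ≤ fold a ∧ fold a < N := by
    intro a _ _; unfold fold; split_ifs <;> omega
  have ra := r a h1 h2
  have rb := r b h3 h4
  have ra' := r a' h1' h2'
  have rb' := r b' h3' h4'
  obtain ⟨e1, e2, e3⟩ := Q_inj hm (by omega) (by omega) (by split_ifs <;> omega)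
    (by split_ifs <;> omega) (by omega) (by omega) (by split_ifs <;> omega)
    (by split_ifs <;> omega) h
  rw [add_assoc, add_assoc] at e1
  have e1 := add_left_cancel e1
  have sb : 0 ≤ b ↔ 0 ≤ b' := by
    have := congrFun e1 j
    by_cases q1 : 0 ≤ a <;> by_cases q2 : 0 ≤ b <;> by_cases q3 : 0 ≤ a' <;>
      by_cases q4 : 0 ≤ b' <;> simp [q1, q2, q3, q4, lamp_self, lamp_ne hj.symm] at this ⊢
  have sa : 0 ≤ a ↔ 0 ≤ a' := by
    have := congrFun e1 (j - 1)
    by_cases q1 : 0 ≤ a <;> by_cases q2 : 0 ≤ b <;> by_cases q3 : 0 ≤ a' <;>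
      by_cases q4 : 0 ≤ b' <;> simp [q1, q2, q3, q4, lamp_self, lamp_ne hj] at this ⊢
  unfold fold at e2 e3
  by_cases q1 : 0 ≤ a <;> by_cases q2 : 0 ≤ b <;>
    simp only [q1, q2, ← sa, ← sb, if_true, if_false, iff_true, iff_false, true_iff,
      not_true, not_false_iff] at e2 e3 <;> omega

/-- Unfolding of a folded coordinate with a sign. -/
def unf (p : Prop) [Decidable p] (t : ℤ) : ℤ := if p then t else -1 - t

lemma unf_nonneg (p : Prop) [Decidable p] (t : ℤ) (ht : 0 ≤ t) : (0 ≤ unf p t) = p := by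
  unfold unf; split_ifs with h <;> simp only [h, eq_iff_iff, iff_true, iff_false] <;> omega

lemma fold_unf (p : Prop) [Decidable p] (t : ℤ) (ht : 0 ≤ t) : fold (unf p t) = t := by
  unfold fold unf; split_ifs <;> omega

lemma unf_fold (a : ℤ) : unf (0 ≤ a) (fold a) = a := by
  unfold fold unf; split_ifs <;> omega

lemma chS_unf (w : ZMod m → ZMod 2) (j : ZMod m) (p q : Prop) [Decidable p] [Decidable q]
    (s t : ℤ) (hs : 0 ≤ s) (ht : 0 ≤ t) :
    (chS w j (unf p s) (unf q t) : VV m N) =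
      Q (w + (if p then 0 else lamp (j - 1)) + (if q then 0 else lamp j)) j (s - t)
        (if (p ↔ q) then min s t else 2 * N - 1 - min s t) := by
  unfold chS
  simp only [unf_nonneg p s hs, unf_nonneg q t ht, fold_unf p s hs, fold_unf q t ht]

lemma unf_close (p : Prop) [Decidable p] (s s' : ℤ) (h1 : s' ≤ s + 1) (h2 : s ≤ s' + 1) :
    unf p s' ≤ unf p s + 1 ∧ unf p s ≤ unf p s' + 1 := by
  unfold unf; split_ifs <;> omega

lemma chS_nbr_aux (w : ZMod m → ZMod 2) (j : ZMod m) (p q : Prop) [Decidable p] [Decidable q]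
    (s t : ℤ) (v : VV m N) (hs : 0 ≤ s ∧ s + 1 < N) (ht : 0 ≤ t ∧ t + 1 < N)
    (h : (GG m N).Adj (chS w j (unf p s) (unf q t)) v) :
    ∃ a' b', a' ≤ unf p s + 1 ∧ unf p s ≤ a' + 1 ∧ b' ≤ unf q t + 1 ∧ unf q t ≤ b' + 1 ∧
      v = chS w j a' b' := by
  rw [chS_unf w j p q s t hs.1 ht.1] at h
  -- moves inside the same half plane
  have inside : ∀ s' t' : ℤ, 0 ≤ s' → 0 ≤ t' → s' ≤ s + 1 → s ≤ s' + 1 → t' ≤ t + 1 → t ≤ t' + 1 →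
      v = Q (w + (if p then 0 else lamp (j - 1)) + (if q then 0 else lamp j)) j (s' - t')
        (if (p ↔ q) then min s' t' else 2 * N - 1 - min s' t') →
      ∃ a' b', a' ≤ unf p s + 1 ∧ unf p s ≤ a' + 1 ∧ b' ≤ unf q t + 1 ∧ unf q t ≤ b' + 1 ∧
        v = chS w j a' b' := by
    intro s' t' g1 g2 g3 g4 g5 g6 g7
    have u1 := unf_close p s s' g3 g4
    have u2 := unf_close q t t' g5 g6
    exact ⟨unf p s', unf q t', u1.1, u1.2, u2.1, u2.2, by rw [chS_unf w j p q s' t' g1 g2]; exact g7⟩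
  -- crossing the seam
  have cross : min s t = 0 →
      v = Q (w + (if p then 0 else lamp (j - 1)) + (if q then 0 else lamp j) +
        lamp (slot j (s - t))) j (s - t) (if (p ↔ q) then 2 * N - 1 else 0) →
      ∃ a' b', a' ≤ unf p s + 1 ∧ unf p s ≤ a' + 1 ∧ b' ≤ unf q t + 1 ∧ unf q t ≤ b' + 1 ∧
        v = chS w j a' b' := by
    intro hmin hv
    by_cases hst : 0 ≤ s - t
    · have t0 : t = 0 := by omega
      have u2 : unf (¬ q) t ≤ unf q t + 1 ∧ unf q t ≤ unf (¬ q) t + 1 := by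
        unfold unf; split_ifs <;> omega
      refine ⟨unf p s, unf (¬ q) t, by omega, by omega, u2.1, u2.2, ?_⟩
      rw [chS_unf w j p (¬ q) s t hs.1 ht.1, hv, hmin, slot, if_pos hst]
      by_cases hp : p <;> by_cases hq : q <;> simp [hp, hq, lamp_add_lamp]
      all_goals rw [add_assoc, CharTwo.add_self_eq_zero, add_zero]
    · have s0 : s = 0 := by omega
      have u2 : unf (¬ p) s ≤ unf p s + 1 ∧ unf p s ≤ unf (¬ p) s + 1 := by
        unfold unf; split_ifs <;> omega
      refine ⟨unf (¬ p) s, unf q t, u2.1, u2.2, by omega, by omega, ?_⟩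
      rw [chS_unf w j (¬ p) q s t hs.1 ht.1, hv, hmin, slot, if_neg hst]
      by_cases hp : p <;> by_cases hq : q <;>
        simp [hp, hq, lamp_add_lamp, add_right_comm w (lamp j) (lamp (j - 1)),
          add_right_comm (w + lamp (j - 1)) (lamp j) (lamp (j - 1))]
  rcases Q_nbr _ j (s - t) _ (by omega) (by omega) (by split_ifs <;> omega)
    (by split_ifs <;> omega) v h with h | h | h | h | h | h
  · by_cases hst : t ≤ s
    · refine inside (s + 1) t (by omega) (by omega) (by omega) (by omega) (by omega) (by omega) ?_
      rw [h, show min (s + 1) t = min s t by omega, show s + 1 - t = s - t + 1 by omega]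
    · refine inside s (t - 1) (by omega) (by omega) (by omega) (by omega) (by omega) (by omega) ?_
      rw [h, show min s (t - 1) = min s t by omega, show s - (t - 1) = s - t + 1 by omega]
  · by_cases hst : s ≤ t
    · refine inside s (t + 1) (by omega) (by omega) (by omega) (by omega) (by omega) (by omega) ?_
      rw [h, show min s (t + 1) = min s t by omega, show s - (t + 1) = s - t - 1 by omega]
    · refine inside (s - 1) t (by omega) (by omega) (by omega) (by omega) (by omega) (by omega) ?_
      rw [h, show min (s - 1) t = min s t by omega, show s - 1 - t = s - t - 1 by omega]
  · by_cases hpq : (p ↔ q)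
    · rw [if_pos hpq] at h
      refine inside (s + 1) (t + 1) (by omega) (by omega) (by omega) (by omega) (by omega)
        (by omega) ?_
      rw [h.2, if_pos hpq, show min (s + 1) (t + 1) = min s t + 1 by omega,
        show s + 1 - (t + 1) = s - t by omega]
    · rw [if_neg hpq] at h
      refine inside (s - 1) (t - 1) (by omega) (by omega) (by omega) (by omega) (by omega)
        (by omega) ?_
      rw [h.2, if_neg hpq, show min (s - 1) (t - 1) = min s t - 1 by omega,
        show s - 1 - (t - 1) = s - t by omega]
      congr 1; omega
  · by_cases hpq : (p ↔ q)
    · rw [if_pos hpq] at h; omega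
    · rw [if_neg hpq] at h
      refine cross (by omega) ?_
      rw [h.2, if_neg hpq]
  · by_cases hpq : (p ↔ q)
    · rw [if_pos hpq] at h
      refine inside (s - 1) (t - 1) (by omega) (by omega) (by omega) (by omega) (by omega)
        (by omega) ?_
      rw [h.2, if_pos hpq, show min (s - 1) (t - 1) = min s t - 1 by omega,
        show s - 1 - (t - 1) = s - t by omega]
    · rw [if_neg hpq] at h
      refine inside (s + 1) (t + 1) (by omega) (by omega) (by omega) (by omega) (by omega)
        (by omega) ?_
      rw [h.2, if_neg hpq, show min (s + 1) (t + 1) = min s t + 1 by omega,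
        show s + 1 - (t + 1) = s - t by omega]
      congr 1; omega
  · by_cases hpq : (p ↔ q)
    · rw [if_pos hpq] at h
      refine cross (by omega) ?_
      rw [h.2, if_pos hpq]
    · rw [if_neg hpq] at h; omega

lemma chS_nbr (w : ZMod m → ZMod 2) (j : ZMod m) (a b : ℤ) (v : VV m N) (h1 : -N + 1 < a)
    (h2 : a < N - 1) (h3 : -N + 1 < b) (h4 : b < N - 1) (h : (GG m N).Adj (chS w j a b) v) :
    ∃ a' b', a' ≤ a + 1 ∧ a ≤ a' + 1 ∧ b' ≤ b + 1 ∧ b ≤ b' + 1 ∧ v = chS w j a' b' := by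
  have hs : 0 ≤ fold a ∧ fold a + 1 < N := by unfold fold; split_ifs <;> omega
  have ht : 0 ≤ fold b ∧ fold b + 1 < N := by unfold fold; split_ifs <;> omega
  have := chS_nbr_aux w j (0 ≤ a) (0 ≤ b) (fold a) (fold b) v hs ht
    (by rw [unf_fold, unf_fold]; exact h)
  rwa [unf_fold, unf_fold] at this

/-- The branched chart. -/
lemma chartS (hm : 1 < m) (w : ZMod m → ZMod 2) (j : ZMod m) :
    Chart (GG m N) N (chS w j) where
  hor a b h1 h2 h3 h4 := chS_hor w j a b h1 h2 h3 h4
  ver a b h1 h2 h3 h4 := chS_ver w j a b h1 h2 h3 h4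
  inj a b a' b' h1 h2 h3 h4 h5 h6 h7 h8 e := chS_inj hm w j a b a' b' h1 h2 h3 h4 h5 h6 h7 h8 e
  nbr a b v h1 h2 h3 h4 e := chS_nbr w j a b v h1 h2 h3 h4 e

lemma Chart.core' {V : Type} {G : SimpleGraph V} {R S : ℤ} {i : ℤ → ℤ → V} (h : Chart G R i)
    (hR : R = 64 * S) (hS : 1 ≤ S) (a a' b b' : ℤ) (h1 : -(56 * S) ≤ a) (h2 : a ≤ 56 * S)
    (h3 : -(56 * S) ≤ a') (h4 : a' ≤ 56 * S) (h5 : -(56 * S) ≤ b) (h6 : b ≤ 56 * S)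
    (h7 : -(56 * S) ≤ b') (h8 : b' ≤ 56 * S) : Rel G bigc (i a b) (i a' b') := by
  subst hR
  exact h.core hS a a' b b' h1 h2 h3 h4 h5 h6 h7 h8

lemma relF (hm : 1 < m) {S : ℤ} (hN : (N : ℤ) = 64 * S) (hS : 1 ≤ S) (w : ZMod m → ZMod 2)
    (j : ZMod m) (x y x' y' : ℤ) (h1 : -(56 * S) ≤ x) (h2 : x ≤ 56 * S)
    (h3 : -(56 * S) ≤ x') (h4 : x' ≤ 56 * S) (h5 : 8 * S ≤ y) (h6 : y ≤ 120 * S)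
    (h7 : 8 * S ≤ y') (h8 : y' ≤ 120 * S) :
    Rel (GG m N) bigc (Q w j x y) (Q w j x' y') := by
  have := (chartF (N := N) hm w j).core' hN hS x x' (y - N) (y' - N) h1 h2 h3 h4 (by omega)
    (by omega) (by omega) (by omega)
  simpa using this

lemma relS1 (hm : 1 < m) {S : ℤ} (hN : (N : ℤ) = 64 * S) (hS : 1 ≤ S) (w : ZMod m → ZMod 2)
    (j : ZMod m) (x y : ℤ) (h1 : -(32 * S) ≤ x) (h2 : x ≤ 32 * S)
    (h3 : 0 ≤ y) (h4 : y ≤ 8 * S) :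
    Rel (GG m N) bigc (Q w j x y) (Q w j 0 (32 * S)) := by
  have := (chartS (N := N) hm w j).core' hN hS (unf True (y + max x 0)) (unf True (32 * S))
    (unf True (y + max (-x) 0)) (unf True (32 * S)) (by simp only [unf, if_true]; omega)
    (by simp only [unf, if_true]; omega) (by simp only [unf, if_true]; omega)
    (by simp only [unf, if_true]; omega) (by simp only [unf, if_true]; omega)
    (by simp only [unf, if_true]; omega) (by simp only [unf, if_true]; omega)
    (by simp only [unf, if_true]; omega)
  rw [chS_unf _ _ _ _ _ _ (by omega) (by omega), chS_unf _ _ _ _ _ _ (by omega) (by omega)] at this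
  simp only [if_true, add_zero, iff_true] at this
  rwa [show y + max x 0 - (y + max (-x) 0) = x by omega,
    show min (y + max x 0) (y + max (-x) 0) = y by omega, sub_self, min_self] at this

lemma relS2 (hm : 1 < m) {S : ℤ} (hN : (N : ℤ) = 64 * S) (hS : 1 ≤ S) (w : ZMod m → ZMod 2)
    (j : ZMod m) (x y : ℤ) (h1 : -(32 * S) ≤ x) (h2 : x ≤ 32 * S)
    (h3 : 0 ≤ y) (h4 : y ≤ 8 * S) :
    Rel (GG m N) bigc (Q w j x (2 * N - 1 - y)) (Q w j 0 (2 * N - 1 - 32 * S)) := by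
  have := (chartS (N := N) hm (w + lamp j) j).core' hN hS (unf True (y + max x 0))
    (unf True (32 * S))
    (unf False (y + max (-x) 0)) (unf False (32 * S)) (by simp only [unf, if_true]; omega)
    (by simp only [unf, if_true]; omega) (by simp only [unf, if_true]; omega)
    (by simp only [unf, if_true]; omega) (by simp only [unf, if_false]; omega)
    (by simp only [unf, if_false]; omega) (by simp only [unf, if_false]; omega)
    (by simp only [unf, if_false]; omega)
  rw [chS_unf _ _ _ _ _ _ (by omega) (by omega), chS_unf _ _ _ _ _ _ (by omega) (by omega)] at this
  simp only [if_true, if_false, add_zero, true_iff, lamp_add_lamp] at this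
  rwa [show y + max x 0 - (y + max (-x) 0) = x by omega,
    show min (y + max x 0) (y + max (-x) 0) = y by omega, sub_self, min_self] at this

/-- The first combined constant. -/
def c1 : ℕ := bigc * bigc + bigc + bigc

lemma relQ (hm : 1 < m) {S : ℤ} (hN : (N : ℤ) = 64 * S) (hS : 1 ≤ S) (w : ZMod m → ZMod 2)
    (j : ZMod m) (x y : ℤ) (h1 : -(32 * S) ≤ x) (h2 : x ≤ 32 * S)
    (h3 : 0 ≤ y) (h4 : y < 2 * N) :
    Rel (GG m N) c1 (Q w j x y) (Q w j 0 N) := by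
  by_cases hy : y ≤ 8 * S
  · refine (relS1 hm hN hS w j x y h1 h2 h3 hy).trans
      (relF hm hN hS w j _ _ _ _ ?_ ?_ ?_ ?_ ?_ ?_ ?_ ?_) <;> omega
  · by_cases hy' : y ≤ 120 * S
    · refine (relF hm hN hS w j x y 0 N ?_ ?_ ?_ ?_ ?_ ?_ ?_ ?_).mono ?_
      all_goals first | omega | skip
      unfold c1; omega
    · have := relS2 (N := N) hm hN hS w j x (2 * N - 1 - y) h1 h2 (by omega) (by omega)
      rw [sub_sub_cancel] at this
      refine this.trans
        (relF hm hN hS w j _ _ _ _ ?_ ?_ ?_ ?_ ?_ ?_ ?_ ?_) <;> omega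

/-- Automorphisms. -/
def tau (σ : ZMod m → ZMod 2) (i : ZMod m) (v : VV m N) : VV m N :=
  (fun t => v.1 (t - i) + σ t, v.2.1 + i, v.2.2)

lemma tau_step (σ : ZMod m → ZMod 2) (i : ZMod m) (v w : VV m N) (h : Step m N v w) :
    Step m N (tau σ i v) (tau σ i w) := by
  rcases h with ⟨e1, e2, ⟨e3, e4⟩ | ⟨e3, e4, e5⟩⟩ | ⟨e1, e2, ⟨e3, e4⟩ | ⟨e3, e4, e5⟩⟩
  · exact Or.inl ⟨by simp [tau, e1], by simp [tau, e2], Or.inl ⟨by simp [tau, e3], by simp [tau, e4]⟩⟩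
  · exact Or.inl ⟨by simp [tau, e1], by simp [tau, e2],
      Or.inr ⟨by simp only [tau, e3]; ring, by simpa [tau] using e4, by simpa [tau] using e5⟩⟩
  · exact Or.inr ⟨by simp [tau, e1], by simp [tau, e2], Or.inl ⟨by simp [tau, e3], by simp [tau, e4]⟩⟩
  · refine Or.inr ⟨by simp [tau, e1], by simp [tau, e2],
      Or.inr ⟨?_, by simpa [tau] using e4, by simpa [tau] using e5⟩⟩
    funext t
    simp only [tau, e3, Pi.add_apply, Pi.single_apply, sub_eq_iff_eq_add]
    ring

lemma tau_near (σ : ZMod m → ZMod 2) (i : ZMod m) (v w : VV m N) (h : (GG m N).Adj v w) :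
    Near (GG m N) 1 (tau σ i v) (tau σ i w) := by
  rcases step_of_adj h with h | h
  · exact near_of_step (tau_step σ i v w h)
  · exact (near_of_step (tau_step σ i w v h)).symm

lemma tau_tau (σ : ZMod m → ZMod 2) (i : ZMod m) (v : VV m N) :
    tau (fun t => σ (t + i)) (-i) (tau σ i v) = v := by
  obtain ⟨w, j, x⟩ := v
  simp only [tau, Prod.mk.injEq, and_true, add_neg_cancel_right]
  funext t
  rw [sub_neg_eq_add, add_sub_cancel_right, add_assoc, CharTwo.add_self_eq_zero, add_zero]

lemma tau_tau' (σ : ZMod m → ZMod 2) (i : ZMod m) (v : VV m N) :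
    tau σ i (tau (fun t => σ (t + i)) (-i) v) = v := by
  obtain ⟨w, j, x⟩ := v
  simp only [tau, Prod.mk.injEq, and_true, neg_add_cancel_right]
  funext t
  rw [sub_neg_eq_add, sub_add_cancel, add_assoc, CharTwo.add_self_eq_zero, add_zero]

lemma rel_tau (w : ZMod m → ZMod 2) (j : ZMod m) (x y : ℤ) :
    Rel (GG m N) 1 (P w j x y) (P 0 0 x y) := by
  refine ⟨tau (fun t => w (t + j)) (-j), tau (fun t => w (t + -j + j)) (- -j),
    tau_near _ _, tau_near _ _, fun v => ?_, fun v => ?_, ?_⟩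
  · rw [tau_tau (fun t => w (t + j)) (-j) v]; exact Near.refl _ _ _
  · rw [tau_tau' (fun t => w (t + j)) (-j) v]; exact Near.refl _ _ _
  · have : (tau (fun t => w (t + j)) (-j) (P w j x y) : VV m N) = P 0 0 x y := by
      simp only [tau, P, Prod.mk.injEq, and_true, add_neg_cancel]
      funext t
      rw [sub_neg_eq_add, CharTwo.add_self_eq_zero]; rfl
    rw [this]; exact Near.refl _ _ _

/-- The second constant. -/
def c2 : ℕ := c1 * 1 + c1 + 1

lemma rel_base (hm : 1 < m) {S : ℤ} (hN : (N : ℤ) = 64 * S) (hS : 1 ≤ S) (v : VV m N) :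
    Rel (GG m N) c2 v (P 0 0 0 N) := by
  obtain ⟨w, j, x, y, h1, h2, h3, h4, rfl⟩ := exists_P v
  by_cases hx : x ≤ 32 * S
  · have := relQ (N := N) hm hN hS w j x y (by omega) hx h3 h4
    rw [Q, Q, if_pos h1, if_pos le_rfl] at this
    exact this.trans (rel_tau w j 0 N)
  · have := relQ (N := N) hm hN hS w (j + 1) (x - N) y (by omega) (by omega) h3 h4
    rw [Q, Q, if_neg (by omega), if_pos le_rfl, sub_add_cancel, add_sub_cancel_right] at this
    exact this.trans (rel_tau w (j + 1) 0 N)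

/-- The final constant. -/
def c3 : ℕ := c2 * (c2 * c2 + c2) + c2 + (c2 * c2 + c2)

lemma one_le_c3 : 1 ≤ c3 := by
  unfold c3 c2
  omega

lemma rel_all (hm : 1 < m) {S : ℤ} (hN : (N : ℤ) = 64 * S) (hS : 1 ≤ S) (v w : VV m N) :
    Rel (GG m N) c3 v w := (rel_base hm hN hS v).trans (rel_base hm hN hS w).symm

lemma near_vert (w : ZMod m → ZMod 2) (j : ZMod m) (x y : ℤ) (t : ℕ) (h1 : 0 ≤ y)
    (h2 : y + t < 2 * N) : Near (GG m N) t (P w j x y) (P w j x (y + t)) := by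
  induction t with
  | zero => simpa using Near.refl _ _ _
  | succ t ih =>
    push_cast at h2 ⊢
    rw [← add_assoc]
    exact (ih (by omega)).trans (P_up w j x (y + t) (by omega) (by omega))

lemma near_horiz (w : ZMod m → ZMod 2) (j : ZMod m) (x y : ℤ) (t : ℕ) (h1 : 0 ≤ x)
    (h2 : x + t < N) : Near (GG m N) t (P w j x y) (P w j (x + t) y) := by
  induction t with
  | zero => simpa using Near.refl _ _ _
  | succ t ih =>
    push_cast at h2 ⊢
    rw [← add_assoc]
    exact (ih (by omega)).trans (P_right w j (x + t) y (by omega) (by omega))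

lemma near_corner (w : ZMod m → ZMod 2) (j : ZMod m) (x y : ℤ) (h1 : 0 ≤ x) (h2 : x < N)
    (h3 : 0 ≤ y) (h4 : y < 2 * N) : Near (GG m N) (3 * N) (P w j x y) (P w j 0 0) := by
  have a := near_vert (N := N) w j x 0 y.toNat le_rfl (by omega)
  have b := near_horiz (N := N) w j 0 0 x.toNat le_rfl (by omega)
  rw [show (0 : ℤ) + y.toNat = y by omega] at a
  rw [show (0 : ℤ) + x.toNat = x by omega] at b
  exact (b.trans a).symm.mono (by omega)

lemma near_slot (w : ZMod m → ZMod 2) (j : ZMod m) :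
    Near (GG m N) N (P w j 0 0) (P w (j + 1) 0 0) := by
  have hN := NeZero.pos N
  have b := near_horiz (N := N) w j 0 0 (N - 1) le_rfl (by omega)
  rw [show (0 : ℤ) + (N - 1 : ℕ) = N - 1 by omega] at b
  exact (b.trans (P_right' w j 0)).mono (by omega)

lemma near_toggle (w : ZMod m → ZMod 2) (j : ZMod m) :
    Near (GG m N) (2 * N) (P w j 0 0) (P (w + lamp j) j 0 0) := by
  have hN := NeZero.pos N
  have b := near_vert (N := N) w j 0 0 (2 * N - 1) le_rfl (by omega)
  rw [show (0 : ℤ) + (2 * N - 1 : ℕ) = 2 * N - 1 by omega] at b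
  exact (b.trans (P_up' w j 0)).mono (by omega)

lemma near_slots (w : ZMod m → ZMod 2) (t : ℕ) :
    Near (GG m N) (t * N) (P w 0 0 0) (P w (t : ZMod m) 0 0) := by
  induction t with
  | zero => simpa using Near.refl _ _ _
  | succ t ih =>
    rw [Nat.cast_succ]
    exact (ih.trans (near_slot w t)).mono (by rw [Nat.succ_mul])

lemma near_sweep [NeZero m] (w σ : ZMod m → ZMod 2) (t : ℕ) (ht : t ≤ m) :
    Near (GG m N) (t * (3 * N)) (P w 0 0 0)
      (P (fun i => if i.val < t then σ i else w i) (t : ZMod m) 0 0) := by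
  induction t with
  | zero => simpa using Near.refl _ _ _
  | succ t ih =>
    have ih := ih (by omega)
    rw [Nat.cast_succ]
    set W : ZMod m → ZMod 2 := fun i => if i.val < t then σ i else w i with hW
    have hv : ((t : ZMod m)).val = t := ZMod.val_cast_of_lt (by omega)
    have hi : ∀ i : ZMod m, i.val = t → i = (t : ZMod m) := by
      intro i h; rw [← h, ZMod.natCast_zmod_val]
    have key : Near (GG m N) (2 * N) (P W (t : ZMod m) 0 0)
        (P (fun i => if i.val < t + 1 then σ i else w i) (t : ZMod m) 0 0) := by
      have two : ∀ a b : ZMod 2, a ≠ b → a + 1 = b := by decide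
      by_cases e : w (t : ZMod m) = σ (t : ZMod m)
      · have : W = fun i => if i.val < t + 1 then σ i else w i := by
          funext i
          simp only [hW]
          by_cases h : i.val = t
          · rw [if_neg (by omega), if_pos (by omega), hi i h, e]
          · by_cases h' : i.val < t
            · rw [if_pos h', if_pos (by omega)]
            · rw [if_neg h', if_neg (by omega)]
        rw [← this]; exact Near.refl _ _ _
      · have : W + lamp (t : ZMod m) = fun i => if i.val < t + 1 then σ i else w i := by
          funext i
          simp only [hW, Pi.add_apply]
          by_cases h : i.val = t
          · rw [if_neg (by omega), if_pos (by omega), hi i h, lamp_self, two _ _ e]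
          · rw [lamp_ne (by rintro rfl; exact h hv), add_zero]
            by_cases h' : i.val < t
            · rw [if_pos h', if_pos (by omega)]
            · rw [if_neg h', if_neg (by omega)]
        rw [← this]; exact near_toggle W t
    exact ((ih.trans key).trans (near_slot _ _)).mono (by nlinarith)

lemma near_all [NeZero m] (u v : VV m N) : Near (GG m N) (11 * (m * N)) u v := by
  have hm := NeZero.pos m
  have toBase : ∀ v : VV m N, Near (GG m N) (4 * (m * N)) v (P v.1 0 0 0) := by
    intro v
    obtain ⟨w, j, x, y, h1, h2, h3, h4, rfl⟩ := exists_P v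
    have a := near_corner (N := N) w j x y h1 h2 h3 h4
    have b := near_slots (N := N) w j.val
    rw [ZMod.natCast_zmod_val] at b
    have hj := ZMod.val_lt j
    refine (a.trans b.symm).mono ?_
    nlinarith
  have s := near_sweep (N := N) u.1 v.1 m le_rfl
  have e : (fun i : ZMod m => if i.val < m then v.1 i else u.1 i) = v.1 := by
    funext i; rw [if_pos (ZMod.val_lt i)]
  rw [e, ZMod.natCast_self] at s
  refine (((toBase u).trans s).trans (toBase v).symm).mono ?_
  nlinarith

lemma conn [NeZero m] : (GG m N).Connected := by
  refine (SimpleGraph.connected_iff _).2 ⟨fun u v => ?_, ⟨P 0 0 0 0⟩⟩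
  obtain ⟨p, -⟩ := near_all u v
  exact ⟨p⟩

lemma diam_le' [NeZero m] : (GG m N).diam ≤ 11 * (m * N) := by
  have : Nonempty (VV m N) := ⟨P 0 0 0 0⟩
  obtain ⟨u, v, h⟩ := (GG m N).exists_dist_eq_diam
  rw [← h]
  exact (near_all u v).dist_le

lemma dist_le_diam' [NeZero m] (u v : VV m N) : (GG m N).dist u v ≤ (GG m N).diam := by
  have : Nonempty (VV m N) := ⟨P 0 0 0 0⟩
  exact SimpleGraph.dist_le_diam (SimpleGraph.connected_iff_ediam_ne_top.1 conn)

lemma lip (Φ : VV m N → ℤ) (h : ∀ v w, Step m N v w → |Φ v - Φ w| ≤ 1) {n : ℕ} {v w : VV m N}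
    (hn : Near (GG m N) n v w) : |Φ v - Φ w| ≤ n := by
  obtain ⟨p, hp⟩ := hn
  induction p generalizing n with
  | nil => simp
  | cons hadj p ih =>
    rw [SimpleGraph.Walk.length_cons] at hp
    have i := ih (n := n - 1) (by omega)
    have key : ∀ a b : VV m N, (GG m N).Adj a b → |Φ a - Φ b| ≤ 1 := by
      intro a b hab
      rcases step_of_adj hab with q | q
      · exact h _ _ q
      · rw [abs_sub_comm]; exact h _ _ q
    have := key _ _ hadj
    rw [abs_le] at *
    omega

/-- Height function: distance to the middle half of the circle. -/
def ht (k : ℕ) (v : VV m N) : ℤ :=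
  max 0 (max (((k * N : ℕ) : ℤ) - (v.2.1.val * N + v.2.2.1.val : ℕ))
    ((v.2.1.val * N + v.2.2.1.val : ℕ) - ((3 * (k * N) : ℕ) : ℤ)))

/-- Signed potential. -/
def pot (k : ℕ) (j : ZMod m) (v : VV m N) : ℤ := if v.1 j = 1 then ht k v else - ht k v

lemma pot_lip [NeZero m] (k : ℕ) (hk : m = 4 * k) (j : ZMod m) (hj : k ≤ j.val)
    (hj' : j.val < 3 * k) (v w : VV m N) (h : Step m N v w) : |pot k j v - pot k j w| ≤ 1 := by
  have lv := ZMod.val_lt v.2.1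
  have hm := NeZero.pos m
  have red : v.1 j = w.1 j → |ht k v - ht k w| ≤ 1 → |pot k j v - pot k j w| ≤ 1 := by
    intro e h
    unfold pot
    rw [← e]
    rw [abs_le] at *
    split_ifs <;> omega
  rcases h with ⟨e1, e2, ⟨e3, e4⟩ | ⟨e3, e4, e5⟩⟩ | ⟨e1, e2, ⟨e3, e4⟩ | ⟨e3, e4, e5⟩⟩
  · refine red (by rw [e1]) ?_
    unfold ht
    rw [e3, abs_le]
    generalize v.2.1.val * N = A
    generalize k * N = B
    omega
  · refine red (by rw [e1]) ?_
    unfold ht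
    rw [e3, e5, abs_le]
    by_cases hl : v.2.1.val + 1 < m
    · have hz : (v.2.1 + 1).val = v.2.1.val + 1 := by
        have : ((v.2.1.val + 1 : ℕ) : ZMod m) = v.2.1 + 1 := by
          rw [Nat.cast_succ, ZMod.natCast_zmod_val]
        rw [← this, ZMod.val_cast_of_lt hl]
      rw [hz, add_one_mul v.2.1.val N]
      generalize v.2.1.val * N = A
      generalize k * N = B
      omega
    · have hz : (v.2.1 + 1).val = 0 := by
        have : ((v.2.1.val + 1 : ℕ) : ZMod m) = v.2.1 + 1 := by
          rw [Nat.cast_succ, ZMod.natCast_zmod_val]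
        rw [← this, show v.2.1.val + 1 = m by omega, ZMod.natCast_self, ZMod.val_zero]
      have hA : v.2.1.val * N + N = 4 * (k * N) := by
        rw [← Nat.succ_mul, show v.2.1.val.succ = 4 * k by omega, mul_assoc]
      rw [hz, zero_mul]
      generalize v.2.1.val * N = A at *
      generalize k * N = B at *
      omega
  · refine red (by rw [e3]) ?_
    unfold ht
    rw [e1, e2]; simp
  · by_cases hv : v.2.1 = j
    · have z : ∀ u : VV m N, u.2.1 = j → ht k u = 0 := by
        intro u hu
        unfold ht
        rw [hu]
        have a1 : k * N ≤ j.val * N := Nat.mul_le_mul_right _ hj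
        have a2 : (j.val + 1) * N ≤ (3 * k) * N := Nat.mul_le_mul_right _ hj'
        rw [Nat.succ_mul, mul_assoc] at a2
        have := u.2.2.1.isLt
        generalize j.val * N = A at *
        generalize k * N = B at *
        omega
      unfold pot
      rw [z v hv, z w (by rw [e1, hv])]
      simp
    · refine red ?_ ?_
      · rw [e3, Pi.add_apply, Pi.single_eq_of_ne (Ne.symm hv), add_zero]
      · unfold ht
        rw [e1, e2]; simp

lemma sep [NeZero m] (k : ℕ) (hk : m = 4 * k) (j j' : ZMod m) (hj : k ≤ j.val)
    (hj' : j.val < 3 * k) (hne : j ≠ j') :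
    2 * (k * N) ≤ (GG m N).dist (P (lamp j) 0 0 0) (P (lamp j') 0 0 0) := by
  have h := lip (N := N) (pot k j) (pot_lip k hk j hj hj')
    (Near.of_conn conn (P (lamp j) 0 0 0) (P (lamp j') 0 0 0))
  have hz : ∀ w : ZMod m → ZMod 2, ht k (P w 0 0 0 : VV m N) = k * N := by
    intro w
    have := fz_val N 0 le_rfl (by have := NeZero.pos N; omega)
    have hf : (fz N 0).val = 0 := by omega
    simp only [ht, P, ZMod.val_zero, hf]
    simp
    have : (0 : ℤ) ≤ (k : ℤ) * N := by positivity
    omega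
  have p1 : pot k j (P (lamp j) 0 0 0 : VV m N) = k * N := by
    rw [pot, if_pos (by simp [P, lamp_self]), hz]
  have p2 : pot k j (P (lamp j') 0 0 0 : VV m N) = -(k * N) := by
    rw [pot, if_neg (by simp [P, lamp_ne hne]), hz]
  rw [p1, p2, abs_le] at h
  have := h.2
  zify
  linarith

lemma card_VV [NeZero m] : Nat.card (VV m N) = 2 ^ m * (m * (N * (2 * N))) := by
  simp [VV, ZMod.card, Nat.card_eq_fintype_card]

lemma no_limit {Y : Type} [MetricSpace Y] [CompactSpace Y] {V : ℕ → Type}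
    (d : ∀ n, V n → V n → ℝ) (p : ∀ n, Fin (n + 1) → V n)
    (hp : ∀ n i i', i ≠ i' → 1 / 22 ≤ d n (p n i) (p n i')) :
    ¬ GHConvergesTo V d (fun x y : Y => dist x y) := by
  intro h
  obtain ⟨N₀, hN⟩ := h (1 / 100) (by norm_num)
  obtain ⟨t, -, ht, hc⟩ := (isCompact_univ (X := Y)).finite_cover_balls
    (show (0 : ℝ) < 1 / 100 by norm_num)
  obtain ⟨n, hn0, hn1⟩ : ∃ n, N₀ ≤ n ∧ ht.toFinset.card ≤ n :=
    ⟨max N₀ ht.toFinset.card, le_max_left _ _, le_max_right _ _⟩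
  obtain ⟨f, -, hf⟩ := hN n hn0
  have hex : ∀ i : Fin (n + 1), ∃ y ∈ ht.toFinset, dist (f (p n i)) y < 1 / 100 := by
    intro i
    have := hc (Set.mem_univ (f (p n i)))
    simp only [Set.mem_iUnion, Metric.mem_ball] at this
    obtain ⟨y, hy, hd⟩ := this
    exact ⟨y, by simpa using hy, hd⟩
  choose g hg hgd using hex
  obtain ⟨i, -, i', -, hne, he⟩ := Finset.exists_ne_map_eq_of_card_lt_of_maps_to
    (s := (Finset.univ : Finset (Fin (n + 1)))) (t := ht.toFinset) (f := g)
    (by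
      rw [Finset.card_univ, Fintype.card_fin]
      omega) (by intro i _; exact hg i)
  have a1 := hgd i
  have a2 := hgd i'
  rw [← he] at a2
  have a3 := dist_triangle_right (f (p n i)) (f (p n i')) (g i)
  have a4 := (abs_lt.1 (hf (p n i) (p n i'))).1
  simp only at a4
  have a5 := hp n i i' hne
  linarith

lemma sep_scaled [NeZero m] (k : ℕ) (hk : m = 4 * k) (j j' : ZMod m) (hj : k ≤ j.val)
    (hj' : j.val < 3 * k) (hne : j ≠ j') :
    (1 / 22 : ℝ) ≤ ((GG m N).dist (P (lamp j) 0 0 0) (P (lamp j') 0 0 0) : ℝ) /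
      ((GG m N).diam : ℝ) := by
  have h1 := sep (N := N) k hk j j' hj hj' hne
  have h2 := dist_le_diam' (N := N) (P (lamp j) 0 0 0) (P (lamp j') 0 0 0)
  have h3 := diam_le' (m := m) (N := N)
  have hm := NeZero.pos m
  have hN := NeZero.pos N
  have hpos : 0 < k * N := Nat.mul_pos (by omega) hN
  have e : m * N = 4 * (k * N) := by rw [hk, mul_assoc]
  have hd : (0 : ℝ) < (GG m N).diam := by
    have : 0 < (GG m N).diam := by omega
    exact_mod_cast this
  rw [le_div_iff₀ hd]
  have : (GG m N).diam ≤ 22 * (GG m N).dist (P (lamp j) 0 0 0) (P (lamp j') 0 0 0) := by omega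
  have : ((GG m N).diam : ℝ) ≤ 22 * (GG m N).dist (P (lamp j) 0 0 0) (P (lamp j') 0 0 0) := by
    exact_mod_cast this
  linarith

/-- The test points. -/
def tp (k : ℕ) (i : ℕ) : ZMod m := ((k + i : ℕ) : ZMod m)

lemma tp_val (k : ℕ) (hk : m = 4 * k) (i : ℕ) (hi : i < 2 * k) :
    (tp k i : ZMod m).val = k + i := ZMod.val_cast_of_lt (by omega)

lemma le_diam [NeZero m] (k : ℕ) (hk : m = 4 * k) : 2 * (k * N) ≤ (GG m N).diam := by
  have hm := NeZero.pos m
  have v0 := tp_val (m := m) k hk 0 (by omega)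
  have v1 := tp_val (m := m) k hk 1 (by omega)
  refine (sep (N := N) k hk (tp k 0) (tp k 1) (by omega) (by omega) ?_).trans (dist_le_diam' _ _)
  intro e
  rw [e] at v0
  omega

end concrete

end RTG

/-- **Theorem 5.** For every sequence of positive reals `u(n)` with `u(n)/n² → ∞`,
there are constants `C ≥ 1`, `K ≥ 0` and a sequence `(X_n)` of finite connected
`(C,K)`-roughly transitive graphs with `diam(X_n) → ∞` and `|X_n| ≤ u(diam X_n)`
for all large `n`, such that no subsequence of the rescaled spaces `X'_n`
converges in the Gromov–Hausdorff distance to any compact metric space. -/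
theorem roughly_transitive_without_scaling_limit
    (u : ℕ → ℝ) (hu_pos : ∀ n, 0 < u n)
    (hu : Tendsto (fun n => u n / (n : ℝ) ^ 2) atTop atTop) :
    ∃ (C K : ℝ), 1 ≤ C ∧ 0 ≤ K ∧
      ∃ (V : ℕ → Type) (G : ∀ n, SimpleGraph (V n)) (_ : ∀ n, Fintype (V n)),
        (∀ n, (G n).Connected) ∧
        (∀ n, RoughlyTransitive C K (fun u v : V n => ((G n).dist u v : ℝ))) ∧
        Tendsto (fun n => (G n).diam) atTop atTop ∧
        (∀ᶠ n in atTop, (Nat.card (V n) : ℝ) ≤ u ((G n).diam)) ∧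
        ∀ φ : ℕ → ℕ, StrictMono φ →
          ∀ (Y : Type) (_ : MetricSpace Y), CompactSpace Y →
            ¬ GHConvergesTo (fun k => V (φ k))
                (fun k u v => ((G (φ k)).dist u v : ℝ) / ((G (φ k)).diam : ℝ))
                (fun x y : Y => dist x y) := by
  have hD : ∀ n : ℕ, ∃ D0 : ℕ, ∀ D, D0 ≤ D →
      (2 : ℝ) ^ (4 * (n + 1)) * 8 ≤ u D / (D : ℝ) ^ 2 := fun n =>
    eventually_atTop.1 (hu.eventually_ge_atTop ((2 : ℝ) ^ (4 * (n + 1)) * 8))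
  choose D0 hD0 using hD
  -- the sizes
  let S : ℕ → ℕ := fun n => D0 n + n + 1
  have hS : ∀ n, S n = D0 n + n + 1 := fun n => rfl
  let M : ℕ → ℕ := fun n => 64 * S n
  have hMz : ∀ n, NeZero (M n) := fun n => ⟨by simp only [M, hS]; omega⟩
  have hmz : ∀ n : ℕ, NeZero (4 * (n + 1)) := fun n => ⟨by omega⟩
  have hcast : ∀ n, ((M n : ℕ) : ℤ) = 64 * (S n : ℤ) := by intro n; simp [M]
  have hS1 : ∀ n, (1 : ℤ) ≤ S n := by intro n; have := hS n; omega
  have hdiam : ∀ n, 2 * ((n + 1) * M n) ≤ (RTG.GG (4 * (n + 1)) (M n)).diam := fun n =>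
    RTG.le_diam (n + 1) rfl
  have hMle : ∀ n, S n ≤ 2 * ((n + 1) * M n) := by
    intro n
    have : M n ≤ (n + 1) * M n := Nat.le_mul_of_pos_left _ (by omega)
    have : M n = 64 * S n := rfl
    omega
  refine ⟨RTG.c3, 2 * RTG.c3 + 2, by exact_mod_cast RTG.one_le_c3, by positivity,
    fun n => RTG.VV (4 * (n + 1)) (M n), fun n => RTG.GG (4 * (n + 1)) (M n),
    fun n => inferInstance, fun n => RTG.conn, fun n => ?_, ?_, ?_, ?_⟩
  · exact RTG.roughlyTransitive_of_rel RTG.conn RTG.one_le_c3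
      (RTG.rel_all (by omega) (hcast n) (hS1 n))
  · refine tendsto_atTop_mono (fun n => ?_) tendsto_id
    have a := hdiam n
    have b := hMle n
    have c := hS n
    simp only [id]
    omega
  · refine Eventually.of_forall fun n => ?_
    have a := hdiam n
    have b := hMle n
    have c := hS n
    have k := hD0 n _ (show D0 n ≤ (RTG.GG (4 * (n + 1)) (M n)).diam by omega)
    have hpos : 0 < (RTG.GG (4 * (n + 1)) (M n)).diam := by omega
    simp only [RTG.card_VV]
    generalize (RTG.GG (4 * (n + 1)) (M n)).diam = D at *
    have hposR : (0 : ℝ) < (D : ℝ) ^ 2 := by positivity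
    rw [le_div_iff₀ hposR] at k
    refine le_trans ?_ k
    have aR : (2 : ℝ) * (((n : ℝ) + 1) * M n) ≤ D := by exact_mod_cast a
    push_cast
    have hn : (1 : ℝ) ≤ (n : ℝ) + 1 := by linarith [Nat.cast_nonneg (α := ℝ) n]
    have hsq : ((2 : ℝ) * (((n : ℝ) + 1) * M n)) ^ 2 ≤ (D : ℝ) ^ 2 := by
      exact pow_le_pow_left₀ (by positivity) aR 2
    have : ((n : ℝ) + 1) * (M n : ℝ) ^ 2 ≤ ((n : ℝ) + 1) ^ 2 * (M n : ℝ) ^ 2 := by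
      refine mul_le_mul_of_nonneg_right ?_ (by positivity)
      nlinarith
    have key : (4 * ((n : ℝ) + 1)) * ((M n : ℝ) * (2 * M n)) ≤ 8 * (D : ℝ) ^ 2 := by nlinarith
    have fin := mul_le_mul_of_nonneg_left key
      (show (0 : ℝ) ≤ 2 ^ (4 * (n + 1)) by positivity)
    linarith
  · intro φ hφ Y _ _
    refine RTG.no_limit (V := fun k => RTG.VV (4 * (φ k + 1)) (M (φ k))) _
      (fun k i => RTG.P (RTG.lamp (RTG.tp (m := 4 * (φ k + 1)) (φ k + 1) i.val)) 0 0 0) ?_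
    intro k i i' hne
    have hk := hφ.le_apply (x := k)
    have v1 := RTG.tp_val (m := 4 * (φ k + 1)) (φ k + 1) rfl i.val (by omega)
    have v2 := RTG.tp_val (m := 4 * (φ k + 1)) (φ k + 1) rfl i'.val (by omega)
    refine RTG.sep_scaled (m := 4 * (φ k + 1)) (φ k + 1) rfl (RTG.tp (φ k + 1) i.val)
      (RTG.tp (φ k + 1) i'.val) (by omega) (by omega) ?_
    intro e
    rw [e] at v1
    exact hne (Fin.ext (by omega))
end
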